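/- Let K be an algebraically closed field and n ≥ 4. There exist A-module homomorphisms f : Õ_{1,3,n} → Õ_{2,3,n} and g : Õ_{2,3,n} → O_{3,3,n} such that the sequence of A-modules 0 → O_{1,3,n} → Õ_{1,3,n} → Õ_{2,3,n} → O_{3,3,n} → 0 is exact, where the first map is the inclusion of O_{1,3,n} into its integral closure (in the paper the maps are graded of degree shifts 1 and 2, respectively). -/

import Mathlib

set_option synthInstance.maxHeartbeats 1000000
set_option maxHeartbeats 4000000

open Matrix

/-- The span of the first `d` standard basis vectors of `K^n`. -/
def firstCoordsSubspace (K : Type*) [Field K] (n d : ℕ) : Submodule K (Fin n → K) where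
  carrier := {v | ∀ i : Fin n, d ≤ (i : ℕ) → v i = 0}
  add_mem' := fun hv hw i hi => by simp [hv i hi, hw i hi]
  zero_mem' := fun i _ => rfl
  smul_mem' := fun c v hv i hi => by simp [hv i hi]

/-- The Kalman variety `K_{s,d,n}`: matrices having an `s`-dimensional invariant
subspace contained in the span `L` of the first `d` standard basis vectors. -/
def kalmanSet (K : Type*) [Field K] (n d s : ℕ) : Set (Matrix (Fin n) (Fin n) K) :=
  {M | ∃ U : Submodule K (Fin n → K), U ≤ firstCoordsSubspace K n d ∧
    Module.finrank K U = s ∧ ∀ v ∈ U, M.mulVec v ∈ U}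

/-- The upper-left `d × d` block `α` of an `n × n` matrix. -/
def alphaBlock {K : Type*} [Field K] {n : ℕ} (d : ℕ) (h : d ≤ n)
    (M : Matrix (Fin n) (Fin n) K) : Matrix (Fin d) (Fin d) K :=
  fun i j => M (Fin.castLE h i) (Fin.castLE h j)

/-- The lower-left `(n-d) × d` block `γ` of an `n × n` matrix. -/
def gammaBlock {K : Type*} [Field K] {n : ℕ} (d : ℕ) (h : d ≤ n)
    (M : Matrix (Fin n) (Fin n) K) : Matrix (Fin (n - d)) (Fin d) K :=
  fun i j => M ⟨d + (i : ℕ), by have := i.isLt; omega⟩ (Fin.castLE h j)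

/-- The reduced Kalman matrix: the `d(n-d) × d` matrix obtained by stacking
`γ, γα, γα², …, γα^{d-1}`; row `(k, i)` is row `i` of the block `γ * α^k`. -/
def redKalman {K : Type*} [Field K] {n : ℕ} (d : ℕ) (h : d ≤ n)
    (M : Matrix (Fin n) (Fin n) K) : Matrix (Fin d × Fin (n - d)) (Fin d) K :=
  fun p j => (gammaBlock d h M * (alphaBlock d h M) ^ (p.1 : ℕ)) p.2 j

/-- The vanishing ideal of a set of `n × n` matrices, inside the polynomial
coordinate ring `A = K[x_{ij}]` of the matrix space. -/
def matVanishingIdeal (K : Type*) [Field K] (n : ℕ)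
    (S : Set (Matrix (Fin n) (Fin n) K)) : Ideal (MvPolynomial (Fin n × Fin n) K) where
  carrier := {f | ∀ M ∈ S, MvPolynomial.eval (fun p => M p.1 p.2) f = 0}
  add_mem' := fun ha hb M hM => by simp [ha M hM, hb M hM]
  zero_mem' := fun M hM => by simp
  smul_mem' := fun c f hf M hM => by simp [smul_eq_mul, hf M hM]

/-- The coordinate ring `A` of the space of `n × n` matrices. -/
abbrev MatCoordRing (K : Type*) [Field K] (n : ℕ) := MvPolynomial (Fin n × Fin n) K

/-- The vanishing ideal `I_{s,d,n}` of the Kalman variety. -/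
noncomputable def kalmanIdeal (K : Type*) [Field K] (n d s : ℕ) :
    Ideal (MatCoordRing K n) :=
  matVanishingIdeal K n (kalmanSet K n d s)

/-- The irrelevant (maximal graded) ideal `A₊` of the polynomial ring,
generated by all the variables. -/
noncomputable def irrelevantIdeal (K : Type*) [Field K] (n : ℕ) :
    Ideal (MatCoordRing K n) :=
  Ideal.span (Set.range MvPolynomial.X)

/-- The coordinate ring `O_{s,d,n} = A/I_{s,d,n}` of the Kalman variety. -/
abbrev KalmanCoordRing (K : Type*) [Field K] (n d s : ℕ) :=
  MatCoordRing K n ⧸ kalmanIdeal K n d s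

/-- The normalization `Õ_{s,d,n}`: the integral closure of `O_{s,d,n}` in its
total ring of fractions (which is its field of fractions when `O_{s,d,n}` is a
domain, e.g. when `K` is algebraically closed). -/
def KalmanNormalization (K : Type*) [Field K] (n d s : ℕ) : Type _ :=
  ↥(integralClosure (KalmanCoordRing K n d s) (FractionRing (KalmanCoordRing K n d s)))

noncomputable instance (K : Type*) [Field K] (n d s : ℕ) :
    CommRing (KalmanNormalization K n d s) :=
  Subalgebra.toCommRing (R := KalmanCoordRing K n d s)
    (A := FractionRing (KalmanCoordRing K n d s)) (integralClosure _ _)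

noncomputable instance (K : Type*) [Field K] (n d s : ℕ) :
    Algebra (KalmanCoordRing K n d s) (KalmanNormalization K n d s) :=
  Subalgebra.algebra (R := KalmanCoordRing K n d s)
    (A := FractionRing (KalmanCoordRing K n d s)) (integralClosure _ _)

noncomputable instance (K : Type*) [Field K] (n d s : ℕ) :
    Algebra (MatCoordRing K n) (KalmanNormalization K n d s) :=
  ((algebraMap (KalmanCoordRing K n d s) (KalmanNormalization K n d s)).comp
    (algebraMap (MatCoordRing K n) (KalmanCoordRing K n d s))).toAlgebra

instance (K : Type*) [Field K] (n d s : ℕ) :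
    IsScalarTower (MatCoordRing K n) (KalmanCoordRing K n d s)
      (KalmanNormalization K n d s) :=
  IsScalarTower.of_algebraMap_eq' (R := MatCoordRing K n)
    (S := KalmanCoordRing K n d s) (A := KalmanNormalization K n d s) rfl

noncomputable instance (K : Type*) [Field K] (n d s : ℕ) :
    Algebra K (KalmanNormalization K n d s) :=
  ((algebraMap (KalmanCoordRing K n d s) (KalmanNormalization K n d s)).comp
    (algebraMap K (KalmanCoordRing K n d s))).toAlgebra

instance (K : Type*) [Field K] (n d s : ℕ) :
    IsScalarTower K (MatCoordRing K n) (KalmanNormalization K n d s) :=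
  IsScalarTower.of_algebraMap_eq fun x => by
    show algebraMap (KalmanCoordRing K n d s) _ (algebraMap K _ x) =
      algebraMap (KalmanCoordRing K n d s) _
        (algebraMap (MatCoordRing K n) _ (algebraMap K (MatCoordRing K n) x))
    rw [← IsScalarTower.algebraMap_apply K (MatCoordRing K n) (KalmanCoordRing K n d s)]

/-- The inclusion of `O_{s,d,n}` into its normalization `Õ_{s,d,n}`,
as an `A`-module map. -/
noncomputable def kalmanNormInclusion (K : Type*) [Field K] (n d s : ℕ) :
    KalmanCoordRing K n d s →ₗ[MatCoordRing K n] KalmanNormalization K n d s :=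
  (IsScalarTower.toAlgHom (MatCoordRing K n) (KalmanCoordRing K n d s)
    (KalmanNormalization K n d s)).toLinearMap

namespace KalmanAux
open MvPolynomial

section Coefficients

variable {σ S : Type*} [CommRing S]

/-- Polynomials whose coefficient at the exponent `ν` lies in `V ν`. -/
def coeffwise (V : (σ →₀ ℕ) → AddSubgroup S) : AddSubgroup (MvPolynomial σ S) where
  carrier := {x | ∀ ν, coeff ν x ∈ V ν}
  add_mem' ha hb ν := by simpa using add_mem (ha ν) (hb ν)
  zero_mem' ν := by simp
  neg_mem' ha ν := by simpa using neg_mem (ha ν)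

theorem mem_coeffwise {V : (σ →₀ ℕ) → AddSubgroup S} {x : MvPolynomial σ S} :
    x ∈ coeffwise V ↔ ∀ ν, coeff ν x ∈ V ν := Iff.rfl

theorem monomial_mem_coeffwise {V : (σ →₀ ℕ) → AddSubgroup S} {ν : σ →₀ ℕ} {a : S}
    (h : a ∈ V ν) : monomial ν a ∈ coeffwise V := by
  classical
  intro μ
  rw [coeff_monomial]
  split_ifs with hν
  · exact hν ▸ h
  · exact zero_mem _

theorem mul_mem_coeffwise {U V W : (σ →₀ ℕ) → AddSubgroup S}
    (h : ∀ {μ ν a b}, a ∈ U μ → b ∈ V ν → a * b ∈ W (μ + ν))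
    {x y : MvPolynomial σ S} (hx : x ∈ coeffwise U) (hy : y ∈ coeffwise V) :
    x * y ∈ coeffwise W := by
  classical
  intro ν
  rw [coeff_mul]
  refine sum_mem fun p hp => ?_
  rw [← Finset.HasAntidiagonal.mem_antidiagonal.1 hp]
  exact h (hx _) (hy _)

theorem coeffwise_of_mul_mem [IsDomain S] [Finite σ] {U V W : (σ →₀ ℕ) → AddSubgroup S}
    (h : ∀ {μ ν a b}, a ∈ U μ → b ∈ V ν → a * b ∈ W (μ + ν))
    (hq : ∀ {μ ν a b}, a ∈ U μ → a ≠ 0 → a * b ∈ W (μ + ν) → b ∈ V ν)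
    {s x : MvPolynomial σ S} (hs : s ∈ coeffwise U) (hs0 : s ≠ 0)
    (hsx : s * x ∈ coeffwise W) : x ∈ coeffwise V := by
  classical
  let : Fintype σ := Fintype.ofFinite σ
  let : LinearOrder σ := LinearOrder.lift' (Fintype.equivFin σ) (Fintype.equivFin σ).injective
  let m : MonomialOrder σ := MonomialOrder.lex
  induction hn : x.support.card using Nat.strong_induction_on generalizing x with
  | _ n ih =>
    by_cases hx : x = 0
    · rw [hx]; exact zero_mem _
    have hlc : coeff (m.degree x) x ∈ V (m.degree x) := by
      refine hq (hs (m.degree s)) (m.coeff_degree_ne_zero_iff.2 hs0) ?_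
      have := hsx (m.degree s + m.degree x)
      rwa [m.coeff_mul_of_degree_add] at this
    set t := monomial (m.degree x) (coeff (m.degree x) x) with ht
    have htm : t ∈ coeffwise V := monomial_mem_coeffwise hlc
    have hcard : (x - t).support.card < n := by
      rw [← hn]
      apply Finset.card_lt_card
      refine ⟨fun ν hν => ?_, fun hsub => ?_⟩
      · rw [mem_support_iff, coeff_sub, ht, coeff_monomial] at hν
        rw [mem_support_iff]
        split_ifs at hν with h1
        · subst h1; simp at hν
        · simpa using hν
      · have := hsub (m.degree_mem_support hx)
        rw [mem_support_iff, coeff_sub, ht, coeff_monomial] at this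
        simp at this
    have := ih _ hcard (x := x - t)
      (by rw [mul_sub]; exact sub_mem hsx (mul_mem_coeffwise h hs htm)) rfl
    simpa using add_mem this htm

theorem coeff_aeval_C_mul_X (s : σ → S) (q : MvPolynomial σ S) (ν : σ →₀ ℕ) :
    coeff ν (aeval (fun i => C (s i) * X i : σ → MvPolynomial σ S) q) =
      ν.prod (fun i k => s i ^ k) * coeff ν q := by
  classical
  induction q using MvPolynomial.induction_on' with
  | monomial μ a =>
    have : aeval (fun i => C (s i) * X i : σ → MvPolynomial σ S) (monomial μ a) =
        monomial μ (μ.prod (fun i k => s i ^ k) * a) := by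
      rw [aeval_monomial]
      simp only [mul_pow, Finsupp.prod_mul, ← map_pow]
      rw [monomial_eq, MvPolynomial.algebraMap_eq, C_mul, Finsupp.prod, Finsupp.prod, Finsupp.prod,
        map_prod]
      ring
    rw [this, coeff_monomial, coeff_monomial]
    split_ifs with h
    · rw [h]
    · simp
  | add p q hp hq => simp only [map_add, coeff_add, hp, hq, mul_add]

theorem aeval_C_mul_X_injective [IsDomain S] {s : σ → S} (hs : ∀ i, s i ≠ 0) :
    Function.Injective
      (aeval (R := S) (S₁ := MvPolynomial σ S) (fun i => C (s i) * X i : σ → MvPolynomial σ S)) := by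
  rw [injective_iff_map_eq_zero]
  intro q hq
  ext ν
  have := coeff_aeval_C_mul_X s q ν
  rw [hq, coeff_zero] at this
  rcases mul_eq_zero.1 this.symm with h | h
  · obtain ⟨i, -, hi⟩ := Finset.prod_eq_zero_iff.1 h
    exact absurd (eq_zero_of_pow_eq_zero hi) (hs i)
  · simpa using h

end Coefficients

end KalmanAux

namespace KalmanAux
open MvPolynomial

section Good

/-- Data of a graded family of additive subgroups `W e` behaving like the modules of covariants
generated by the coordinates of a vector `v`. -/
structure Good {S : Type*} [CommRing S] (v : Fin 3 → S) (W : ℕ → AddSubgroup S) : Prop where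
  mem_v : ∀ i, v i ∈ W 1
  one_mem : 1 ∈ W 0
  mul : ∀ {e f x y}, x ∈ W e → y ∈ W f → x * y ∈ W (e + f)
  gen : ∀ {e x}, x ∈ W (e + 1) →
    ∃ a ∈ W e, ∃ b ∈ W e, ∃ c ∈ W e, x = v 0 * a + v 1 * b + v 2 * c
  star : ∀ {e x}, x ∈ W (e + 1) → (∃ p q, x = v 0 * p + v 1 * q) →
    ∃ a ∈ W e, ∃ b ∈ W e, x = v 0 * a + v 1 * b
  ne : ∀ i, v i ≠ 0
  reg1 : ∀ {x y}, v 1 * x = v 0 * y → v 0 ∣ x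
  reg2 : ∀ {x}, (∃ p q, v 2 * x = v 0 * p + v 1 * q) → ∃ p q, x = v 0 * p + v 1 * q
  quot : ∀ {e f s x}, s ∈ W f → s ≠ 0 → s * x ∈ W (f + e) → x ∈ W e

variable {S : Type*} [CommRing S]

/-- The `d`-th power of the ideal generated by two elements, presented recursively. -/
def pairPow (x y : S) : ℕ → Ideal S
  | 0 => ⊤
  | d + 1 => Ideal.span {x} * pairPow x y d ⊔ Ideal.span {y ^ (d + 1)}

theorem mem_pairPow_succ {x y z : S} {d : ℕ} :
    z ∈ pairPow x y (d + 1) ↔ ∃ p ∈ pairPow x y d, ∃ q, z = x * p + y ^ (d + 1) * q := by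
  rw [pairPow, Submodule.mem_sup]
  constructor
  · rintro ⟨_, h1, _, h2, rfl⟩
    obtain ⟨p, hp, rfl⟩ := Ideal.mem_span_singleton_mul.1 h1
    obtain ⟨q, rfl⟩ := Ideal.mem_span_singleton.1 h2
    exact ⟨p, hp, q, rfl⟩
  · rintro ⟨p, hp, q, rfl⟩
    exact ⟨_, Ideal.mem_span_singleton_mul.2 ⟨p, hp, rfl⟩, _,
      Ideal.mem_span_singleton.2 ⟨q, rfl⟩, rfl⟩

theorem pow_mul_pow_mem_pairPow (x y : S) (i j : ℕ) : x ^ i * y ^ j ∈ pairPow x y (i + j) := by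
  induction i with
  | zero =>
    cases j with
    | zero => exact Submodule.mem_top
    | succ j =>
      rw [zero_add]
      exact mem_pairPow_succ.2 ⟨0, zero_mem _, 1, by ring⟩
  | succ i ih =>
    rw [show i + 1 + j = i + j + 1 by ring]
    exact mem_pairPow_succ.2 ⟨_, ih, 0, by ring⟩

namespace Good

variable {v : Fin 3 → S} {W : ℕ → AddSubgroup S}

theorem reg1_pow (h : Good v W) {k : ℕ} {x y : S} (hxy : v 1 ^ k * x = v 0 * y) : v 0 ∣ x := by
  induction k generalizing y with
  | zero => exact ⟨y, by simpa using hxy⟩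
  | succ k ih =>
    rw [pow_succ', mul_assoc] at hxy
    obtain ⟨z, hz⟩ := h.reg1 hxy
    exact ih hz

theorem mem_pairPow_of_mul [IsDomain S] (h : Good v W) {d : ℕ} {x : S}
    (hx : v 0 * x ∈ pairPow (v 0) (v 1) (d + 1)) : x ∈ pairPow (v 0) (v 1) d := by
  obtain ⟨p, hp, q, hq⟩ := mem_pairPow_succ.1 hx
  obtain ⟨r, rfl⟩ := h.reg1_pow (k := d + 1) (x := q) (y := x - p) (by linear_combination -hq)
  have : x = p + v 1 ^ (d + 1) * r := mul_left_cancel₀ (h.ne 0) (by linear_combination hq)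
  rw [this]
  refine add_mem hp (Ideal.mul_mem_right _ _ ?_)
  rw [pow_succ']
  exact Ideal.mul_mem_left _ _ (by simpa using pow_mul_pow_mem_pairPow (v 0) (v 1) 0 d)

theorem reg2_pow (h : Good v W) (k : ℕ) {x : S} (hx : ∃ p q, v 2 * x = v 0 * p + v 1 ^ k * q) :
    ∃ p q, x = v 0 * p + v 1 ^ k * q := by
  induction k generalizing x with
  | zero => exact ⟨0, x, by ring⟩
  | succ k ih =>
    obtain ⟨p, q, hpq⟩ := hx
    obtain ⟨a, b, rfl⟩ := h.reg2 ⟨p, v 1 ^ k * q, by rw [hpq]; ring⟩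
    obtain ⟨c, hc⟩ := h.reg1 (x := v 2 * b - v 1 ^ k * q) (y := p - v 2 * a)
      (by linear_combination hpq)
    obtain ⟨p', q', rfl⟩ := ih (x := b) ⟨c, q, by linear_combination hc⟩
    exact ⟨a + v 1 * p', q', by ring⟩

theorem mem_pairPow_of_mul_two [IsDomain S] (h : Good v W) {d : ℕ} {x : S}
    (hx : v 2 * x ∈ pairPow (v 0) (v 1) d) : x ∈ pairPow (v 0) (v 1) d := by
  induction d generalizing x with
  | zero => exact Submodule.mem_top
  | succ d ih =>
    obtain ⟨p, hp, q, hq⟩ := mem_pairPow_succ.1 hx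
    obtain ⟨a, b, rfl⟩ := h.reg2_pow (d + 1) ⟨p, q, hq⟩
    refine mem_pairPow_succ.2 ⟨a, ih (h.mem_pairPow_of_mul ?_), b, rfl⟩
    exact mem_pairPow_succ.2 ⟨p, hp, q - v 2 * b, by linear_combination hq⟩

theorem mem_pairPow_of_pow_mul [IsDomain S] (h : Good v W) {d N : ℕ} {x : S}
    (hx : v 2 ^ N * x ∈ pairPow (v 0) (v 1) d) : x ∈ pairPow (v 0) (v 1) d := by
  induction N with
  | zero => simpa using hx
  | succ N ih =>
    rw [pow_succ', mul_assoc] at hx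
    exact ih (h.mem_pairPow_of_mul_two hx)

theorem pow_mem (h : Good v W) (i : Fin 3) (k : ℕ) : v i ^ k ∈ W k := by
  induction k with
  | zero => simpa using h.one_mem
  | succ k ih => rw [pow_succ]; exact h.mul ih (h.mem_v i)

theorem star_pow (h : Good v W) {e k : ℕ} {x : S} (hx : x ∈ W (e + k + 1))
    (hp : ∃ p q, x = v 0 * p + v 1 ^ (k + 1) * q) :
    ∃ a ∈ W (e + k), ∃ b ∈ W e, x = v 0 * a + v 1 ^ (k + 1) * b := by
  induction k generalizing x with
  | zero => simpa using h.star hx (by simpa using hp)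
  | succ k ih =>
    obtain ⟨p, q, hpq⟩ := hp
    obtain ⟨a, ha, b, hb, rfl⟩ := h.star hx ⟨p, v 1 ^ (k + 1) * q, by rw [hpq]; ring⟩
    obtain ⟨c, hc⟩ := h.reg1 (x := b - v 1 ^ (k + 1) * q) (y := p - a)
      (by linear_combination hpq)
    obtain ⟨a', ha', b', hb', hb2⟩ := ih (x := b) hb ⟨c, q, by linear_combination hc⟩
    refine ⟨a + v 1 * a', add_mem ha ?_, b', hb', by rw [hb2]; ring⟩
    have := h.mul (h.mem_v 1) ha'
    rwa [add_comm] at this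

theorem exists_sum [IsDomain S] (h : Good v W) {e d : ℕ} {x : S} (hx : x ∈ W (e + d))
    (hd : x ∈ pairPow (v 0) (v 1) d) :
    ∃ w : ℕ → S, (∀ i, w i ∈ W e) ∧
      x = ∑ i ∈ Finset.range (d + 1), w i * (v 0 ^ i * v 1 ^ (d - i)) := by
  induction d generalizing x with
  | zero => exact ⟨fun _ => x, fun _ => hx, by simp⟩
  | succ d ih =>
    obtain ⟨p, hp, q, hq⟩ := mem_pairPow_succ.1 hd
    obtain ⟨a, ha, b, hb, rfl⟩ := h.star_pow hx ⟨p, q, hq⟩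
    obtain ⟨w, hw, rfl⟩ := ih ha (h.mem_pairPow_of_mul
      (mem_pairPow_succ.2 ⟨p, hp, q - b, by linear_combination hq⟩))
    refine ⟨fun i => Nat.casesOn i b w, fun i => ?_, ?_⟩
    · cases i with
      | zero => exact hb
      | succ i => exact hw i
    · rw [Finset.sum_range_succ' _ (d + 1), Finset.mul_sum]
      simp only [Nat.add_sub_add_right]
      congr 1
      · exact Finset.sum_congr rfl fun i _ => by ring
      · simp [mul_comm]

end Good

end Good

end KalmanAux

namespace KalmanAux
open MvPolynomial

section Line

variable {σ S : Type*} [CommRing S]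

theorem C_dvd_iff {x : S} {q : MvPolynomial σ S} : C x ∣ q ↔ ∀ ν, x ∣ coeff ν q :=
  C_dvd_iff_dvd_coeff x q

theorem dvd_of_C_pow_mul [IsDomain S] {x y : S} (hx : x ≠ 0)
    (reg : ∀ a b, y * a = x * b → x ∣ a) {i j : σ} {N : ℕ}
    {h q : MvPolynomial σ S} (hq : C x ^ N * h = (C x * X j - C y * X i) * q) :
    (C x * X j - C y * X i) ∣ h := by
  induction N generalizing q with
  | zero => exact ⟨q, by simpa using hq⟩
  | succ N ih =>
    have hd : C x ∣ q := by
      rw [C_dvd_iff]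
      intro ν
      have h1 : C y * q * X i = C x * (X j * q - C x ^ N * h) := by
        linear_combination hq
      have h2 := congrArg (coeff (ν + Finsupp.single i 1)) h1
      rw [coeff_mul_X, coeff_C_mul, coeff_C_mul] at h2
      exact reg _ _ h2
    obtain ⟨r, rfl⟩ := hd
    refine ih (q := r) (mul_left_cancel₀ (C_ne_zero.2 hx : (C x : MvPolynomial σ S) ≠ 0) ?_)
    linear_combination hq

theorem line_dvd [DecidableEq σ] [IsDomain S] {x y : S} (hx : x ≠ 0)
    (reg : ∀ a b, y * a = x * b → x ∣ a) {i j : σ} (hij : i ≠ j) {h : MvPolynomial σ S}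
    (hh : aeval (R := S) (S₁ := MvPolynomial σ S)
      (fun l => if l = j then C y * X i else if l = i then C x * X i else X l) h = 0) :
    (C x * X j - C y * X i) ∣ h := by
  set ev : MvPolynomial σ S →ₐ[S] MvPolynomial σ S := aeval
      (fun l => if l = j then C y * X i else if l = i then C x * X i else X l) with hev
  set sc : MvPolynomial σ S →ₐ[S] MvPolynomial σ S :=
    aeval (fun l => C (if l = i then x else 1) * X l) with hsc
  have key : ∀ f : MvPolynomial σ S, ∃ (N : ℕ) (q r : MvPolynomial σ S),
      C x ^ N * f = (C x * X j - C y * X i) * q + r ∧ ev r = sc r := by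
    intro f
    induction f using MvPolynomial.induction_on with
    | C a => exact ⟨0, 0, C a, by ring, by simp [hev, hsc, algHom_C]⟩
    | add f g hf hg =>
      obtain ⟨N, q, r, h1, h2⟩ := hf
      obtain ⟨N', q', r', h1', h2'⟩ := hg
      refine ⟨N + N', C x ^ N' * q + C x ^ N * q', C x ^ N' * r + C x ^ N * r', ?_, ?_⟩
      · linear_combination C x ^ N' * h1 + C x ^ N * h1'
      · simp only [map_add, map_mul, map_pow, algHom_C, h2, h2']
    | mul_X f l hf =>
      obtain ⟨N, q, r, h1, h2⟩ := hf
      by_cases hl : l = j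
      · subst hl
        refine ⟨N + 1, C x * X l * q + r, C y * X i * r, ?_, ?_⟩
        · linear_combination C x * X l * h1
        · simp only [map_mul, algHom_C, h2]
          congr 2
          simp [hev, hsc, hij]
      · refine ⟨N, X l * q, X l * r, by linear_combination X l * h1, ?_⟩
        simp only [map_mul, h2]
        congr 1
        by_cases hli : l = i <;> simp [hev, hsc, hl, hli]
        simp [hij]
  obtain ⟨N, q, r, h1, h2⟩ := key h
  have h3 : ev r = 0 := by
    have := congrArg ev h1
    simp only [map_mul, map_pow, map_add, map_sub, hh, algHom_C] at this
    have e1 : ev (X j) = C y * X i := by simp [hev]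
    have e2 : ev (X i) = C x * X i := by simp [hev, hij]
    rw [e1, e2] at this
    simp only [algebraMap_eq] at this
    linear_combination -this
  have h4 : r = 0 := by
    refine aeval_C_mul_X_injective (s := fun l => if l = i then x else 1) ?_ ?_
    · intro l
      split_ifs
      · exact hx
      · exact one_ne_zero
    · rw [map_zero]
      exact h2.symm.trans h3
  exact dvd_of_C_pow_mul hx reg (N := N) (by rw [h1, h4, add_zero])

end Line

section Shift

variable {S : Type*} [CommRing S] (v : Fin 3 → S)

/-- The translation `X i ↦ X i + v i t` with a new variable `t`. -/
noncomputable def shift : MvPolynomial (Fin 3) S →ₐ[S] Polynomial (MvPolynomial (Fin 3) S) :=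
  aeval fun i => Polynomial.C (X i) + Polynomial.C (C (v i)) * Polynomial.X

/-- The polynomials invariant under translation by multiples of `v`. -/
noncomputable def shiftInv : Subalgebra S (MvPolynomial (Fin 3) S) :=
  AlgHom.equalizer (shift v) Polynomial.CAlgHom

variable {v}

theorem mem_shiftInv {h : MvPolynomial (Fin 3) S} :
    h ∈ shiftInv v ↔ shift v h = Polynomial.C h := Iff.rfl

theorem aeval_add_of_mem_shiftInv {h : MvPolynomial (Fin 3) S} (hh : h ∈ shiftInv v)
    {T : Type*} [CommRing T] [Algebra S T] (y : Fin 3 → T) (t : T) :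
    aeval (fun i => y i + algebraMap S T (v i) * t) h = aeval y h := by
  have h1 := congrArg (Polynomial.eval₂RingHom (aeval y : MvPolynomial (Fin 3) S →ₐ[S] T).toRingHom t)
    (mem_shiftInv.1 hh)
  have h2 : ((Polynomial.eval₂RingHom (aeval y : MvPolynomial (Fin 3) S →ₐ[S] T).toRingHom t).comp
      (shift v).toRingHom) = (aeval fun i => y i + algebraMap S T (v i) * t :
        MvPolynomial (Fin 3) S →ₐ[S] T).toRingHom := by
    apply MvPolynomial.ringHom_ext
    · intro r
      simp [shift, Polynomial.algebraMap_apply]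
    · intro i
      simp [shift]
  have h3 := congrArg (fun g => g h) h2
  simp at h1 h3
  rw [← h3, h1]

theorem mem_shiftInv_of_mul [IsDomain S] {c h : MvPolynomial (Fin 3) S} (hc : c ∈ shiftInv v)
    (hc0 : c ≠ 0) (hch : c * h ∈ shiftInv v) : h ∈ shiftInv v := by
  rw [mem_shiftInv] at *
  rw [map_mul, hc, Polynomial.C_mul] at hch
  exact mul_left_cancel₀ (Polynomial.C_ne_zero.2 hc0) hch

end Shift

end KalmanAux

namespace KalmanAux
open MvPolynomial

section Step

variable {S : Type*} [CommRing S]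

/-- The polynomials of weight `e` invariant under translation by multiples of `v`. -/
noncomputable def stepW (v : Fin 3 → S) (W : ℕ → AddSubgroup S) (e : ℕ) :
    AddSubgroup (MvPolynomial (Fin 3) S) :=
  coeffwise (fun ν => W (e + ν.degree)) ⊓ (Subalgebra.toSubmodule (shiftInv v)).toAddSubgroup

theorem mem_stepW {v : Fin 3 → S} {W : ℕ → AddSubgroup S} {e : ℕ} {h : MvPolynomial (Fin 3) S} :
    h ∈ stepW v W e ↔ h ∈ coeffwise (fun ν => W (e + ν.degree)) ∧ h ∈ shiftInv v := Iff.rfl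

/-- The coordinates of the cross product of `v` with the vector of variables, reordered. -/
noncomputable def crossPoly (v : Fin 3 → S) : Fin 3 → MvPolynomial (Fin 3) S :=
  ![C (v 2) * X 0 - C (v 0) * X 2, C (v 1) * X 2 - C (v 2) * X 1, C (v 0) * X 1 - C (v 1) * X 0]

namespace Good

variable {v : Fin 3 → S} {W : ℕ → AddSubgroup S}

theorem C_mul_X_mem_coeffwise (h : Good v W) (i j : Fin 3) :
    (C (v i) * X j : MvPolynomial (Fin 3) S) ∈ coeffwise (fun ν => W (0 + ν.degree)) := by
  have : (C (v i) * X j : MvPolynomial (Fin 3) S) = monomial (Finsupp.single j 1) (v i) := by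
    rw [monomial_eq]; simp
  rw [this]
  exact monomial_mem_coeffwise (by simpa using h.mem_v i)

theorem crossPoly_mem (h : Good v W) (i : Fin 3) : crossPoly v i ∈ stepW v W 0 := by
  refine mem_stepW.2 ⟨?_, ?_⟩
  · fin_cases i <;> exact sub_mem (h.C_mul_X_mem_coeffwise _ _) (h.C_mul_X_mem_coeffwise _ _)
  · rw [mem_shiftInv]
    fin_cases i <;> simp [crossPoly, shift, Polynomial.algebraMap_apply] <;> ring

theorem C_mem (_h : Good v W) {e : ℕ} {x : S} (hx : x ∈ W e) : C x ∈ stepW v W e := by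
  refine mem_stepW.2 ⟨monomial_mem_coeffwise (by simpa using hx), ?_⟩
  rw [← algebraMap_eq]
  exact Subalgebra.algebraMap_mem _ _

theorem step_mul (h : Good v W) {e f : ℕ} {x y : MvPolynomial (Fin 3) S} (hx : x ∈ stepW v W e)
    (hy : y ∈ stepW v W f) : x * y ∈ stepW v W (e + f) := by
  refine mem_stepW.2 ⟨mul_mem_coeffwise (fun {μ ν a b} ha hb => ?_) hx.1 hy.1,
    (shiftInv v).mul_mem hx.2 hy.2⟩
  have := h.mul ha hb
  rwa [show e + μ.degree + (f + ν.degree) = e + f + (μ + ν).degree by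
    rw [map_add]; ring] at this

theorem step_quot [IsDomain S] (h : Good v W) {e f : ℕ} {s x : MvPolynomial (Fin 3) S}
    (hs : s ∈ stepW v W f) (hs0 : s ≠ 0) (hx : s * x ∈ stepW v W (f + e)) : x ∈ stepW v W e := by
  refine mem_stepW.2 ⟨coeffwise_of_mul_mem (fun {μ ν a b} ha hb => ?_)
    (fun {μ ν a b} ha ha0 hab => ?_) hs.1 hs0 hx.1, mem_shiftInv_of_mul hs.2 hs0 hx.2⟩
  · have := h.mul ha hb
    rwa [show f + μ.degree + (e + ν.degree) = f + e + (μ + ν).degree by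
      rw [map_add]; ring] at this
  · refine h.quot ha ha0 ?_
    rwa [show f + μ.degree + (e + ν.degree) = f + e + (μ + ν).degree by
      rw [map_add]; ring]

theorem aeval_crossPoly_mem (h : Good v W) {e : ℕ} {p : MvPolynomial (Fin 3) S}
    (hp : p ∈ coeffwise (fun _ => W e)) : aeval (crossPoly v) p ∈ stepW v W e := by
  rw [p.as_sum, map_sum]
  refine sum_mem fun ν _ => ?_
  rw [aeval_monomial, algebraMap_eq]
  refine h.step_mul (f := 0) (h.C_mem (hp ν)) ?_
  have key : ∀ x ∈ stepW v W 0, ∀ k : ℕ, x ^ k ∈ stepW v W 0 := by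
    intro x hx k
    induction k with
    | zero => simpa using h.C_mem h.one_mem
    | succ k ih => rw [pow_succ]; exact h.step_mul (e := 0) (f := 0) ih hx
  rw [Finsupp.prod]
  refine Finset.prod_induction _ (· ∈ stepW v W 0) (fun _ _ h1 h2 => h.step_mul (e := 0) (f := 0) h1 h2)
    (by simpa using h.C_mem h.one_mem) fun i _ => key _ (h.crossPoly_mem i) _

theorem mul_mem_const (h : Good v W) {e : ℕ} {p q : MvPolynomial (Fin 3) S}
    (hp : p ∈ coeffwise (fun _ => W 0)) (hq : q ∈ coeffwise (fun _ => W e)) :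
    p * q ∈ coeffwise (fun _ => W e) :=
  mul_mem_coeffwise (fun ha hb => by simpa using h.mul ha hb) hp hq

theorem X_mem_const (h : Good v W) (i : Fin 3) :
    (X i : MvPolynomial (Fin 3) S) ∈ coeffwise (fun _ => W 0) :=
  monomial_mem_coeffwise h.one_mem

theorem pow_mem_const (h : Good v W) {p : MvPolynomial (Fin 3) S}
    (hp : p ∈ coeffwise (fun _ => W 0)) (k : ℕ) : p ^ k ∈ coeffwise (fun _ => W 0) := by
  induction k with
  | zero => rw [pow_zero]; exact monomial_mem_coeffwise h.one_mem
  | succ k ih => rw [pow_succ]; exact h.mul_mem_const ih hp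

/-- The restriction of a polynomial to the last coordinate axis. -/
noncomputable def axis (S : Type*) [CommRing S] : MvPolynomial (Fin 3) S →ₐ[S] Polynomial S :=
  aeval ![0, 0, Polynomial.X]

theorem coeff_axis (f : MvPolynomial (Fin 3) S) (d : ℕ) :
    (axis S f).coeff d = coeff (Finsupp.single 2 d) f := by
  induction f using MvPolynomial.induction_on' with
  | monomial μ a =>
    rw [axis, aeval_monomial, Finsupp.prod_fintype _ _ (by simp), Fin.prod_univ_three]
    simp only [Matrix.cons_val, Polynomial.algebraMap_eq, coeff_monomial]
    by_cases h0 : μ 0 = 0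
    · by_cases h1 : μ 1 = 0
      · rw [h0, h1]
        simp only [pow_zero, one_mul, Polynomial.coeff_C_mul_X_pow]
        have : d = μ 2 ↔ μ = Finsupp.single 2 d := by
          rw [Finsupp.ext_iff, Fin.forall_fin_succ, Fin.forall_fin_succ, Fin.forall_fin_succ]
          simp [h0, h1]
          tauto
        simp only [this]
      · rw [zero_pow h1, if_neg]
        · simp
        · rintro rfl; simp at h1
    · rw [zero_pow h0, if_neg]
      · simp
      · rintro rfl; simp at h0
  | add p q hp hq => simp [hp, hq]

theorem aeval_line_coeff (f : MvPolynomial (Fin 3) S) (d : ℕ) :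
    (aeval ![Polynomial.C (v 0) * Polynomial.X, Polynomial.C (v 1) * Polynomial.X, 0] f :
      Polynomial S).coeff d ∈ pairPow (v 0) (v 1) d := by
  induction f using MvPolynomial.induction_on' with
  | monomial μ a =>
    rw [aeval_monomial, Finsupp.prod_fintype _ _ (by simp), Fin.prod_univ_three]
    simp only [Matrix.cons_val, Polynomial.algebraMap_eq, mul_pow]
    rw [show (Polynomial.C a * (Polynomial.C (v 0) ^ μ 0 * Polynomial.X ^ μ 0 *
      (Polynomial.C (v 1) ^ μ 1 * Polynomial.X ^ μ 1) * 0 ^ μ 2) : Polynomial S) =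
      Polynomial.C (a * 0 ^ μ 2 * (v 0 ^ μ 0 * v 1 ^ μ 1)) * Polynomial.X ^ (μ 0 + μ 1) by
        simp only [map_mul, map_pow, map_zero]; ring]
    rw [Polynomial.coeff_C_mul_X_pow]
    split_ifs with hd
    · rw [hd]
      exact Ideal.mul_mem_left _ _ (pow_mul_pow_mem_pairPow _ _ _ _)
    · exact zero_mem _
  | add p q hp hq => simpa using add_mem hp hq

theorem axis_coeff_mem [IsDomain S] (h : Good v W) {e : ℕ} {f : MvPolynomial (Fin 3) S}
    (hf : f ∈ stepW v W e) (d : ℕ) : (axis S f).coeff d ∈ pairPow (v 0) (v 1) d := by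
  refine h.mem_pairPow_of_pow_mul (N := d) ?_
  have h1 := aeval_add_of_mem_shiftInv hf.2
    ![0, 0, -(Polynomial.C (v 2) * Polynomial.X)] (Polynomial.X : Polynomial S)
  have h2 : (fun i => (![0, 0, -(Polynomial.C (v 2) * Polynomial.X)] : Fin 3 → Polynomial S) i +
      algebraMap S (Polynomial S) (v i) * Polynomial.X) =
      ![Polynomial.C (v 0) * Polynomial.X, Polynomial.C (v 1) * Polynomial.X, 0] := by
    funext i
    fin_cases i <;> simp
  have h3 : (aeval ![0, 0, -(Polynomial.C (v 2) * Polynomial.X)] f : Polynomial S) =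
      (axis S f).comp (Polynomial.C (-v 2) * Polynomial.X) := by
    have : (aeval ![0, 0, -(Polynomial.C (v 2) * Polynomial.X)] :
        MvPolynomial (Fin 3) S →ₐ[S] Polynomial S) =
        (Polynomial.aeval (Polynomial.C (-v 2) * Polynomial.X)).comp (axis S) := by
      ext i : 1
      fin_cases i <;> simp [axis]
    rw [this, AlgHom.comp_apply, Polynomial.comp, Polynomial.aeval_def]
    rfl
  rw [h2, h3] at h1
  have h4 := aeval_line_coeff (v := v) f d
  rw [h1, Polynomial.comp_C_mul_X_coeff, neg_pow] at h4
  have h5 := Ideal.mul_mem_left _ ((-1) ^ d) h4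
  convert h5 using 1
  rw [mul_left_comm, ← mul_assoc ((-1) ^ d), ← mul_pow]
  simp [mul_comm]

theorem exists_eq_aeval_crossPoly [IsDomain S] (h : Good v W) {e : ℕ}
    {f : MvPolynomial (Fin 3) S} (hf : f ∈ stepW v W e) :
    ∃ p ∈ coeffwise (fun _ => W e), f = aeval (crossPoly v) p := by
  induction hN : f.totalDegree using Nat.strong_induction_on generalizing f with
  | _ N ih =>
    have hw : ∀ d, ∃ w : ℕ → S, (∀ i, w i ∈ W e) ∧ (axis S f).coeff d =
        ∑ i ∈ Finset.range (d + 1), w i * (v 0 ^ i * v 1 ^ (d - i)) := fun d =>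
      h.exists_sum (by rw [coeff_axis]; simpa using hf.1 (Finsupp.single 2 d))
        (h.axis_coeff_mem hf d)
    choose w hwW hw using hw
    set p₁ : MvPolynomial (Fin 3) S := ∑ d ∈ Finset.range (N + 1), ∑ i ∈ Finset.range (d + 1),
      (-X 0) ^ i * X 1 ^ (d - i) * C (w d i) with hp₁
    have hp₁W : p₁ ∈ coeffwise (fun _ => W e) := by
      refine sum_mem fun d _ => sum_mem fun i _ => h.mul_mem_const (h.mul_mem_const
        (h.pow_mem_const (neg_mem (h.X_mem_const 0)) i) (h.pow_mem_const (h.X_mem_const 1) _))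
        (monomial_mem_coeffwise (hwW d i))
    have hdeg1 : (aeval (crossPoly v) p₁).totalDegree ≤ N := by
      have hX : ∀ (s t : S) (i j : Fin 3),
          (C s * X i - C t * X j : MvPolynomial (Fin 3) S).totalDegree ≤ 1 := by
        intro s t i j
        refine (totalDegree_sub _ _).trans (max_le ?_ ?_) <;>
        · refine (totalDegree_mul _ _).trans ?_
          rw [totalDegree_C, totalDegree_X, zero_add]
      rw [hp₁, map_sum]
      refine totalDegree_finsetSum_le fun d hd => ?_
      rw [map_sum]
      refine totalDegree_finsetSum_le fun i hi => ?_
      simp only [map_mul, map_pow, map_neg, aeval_X, algHom_C, algebraMap_eq]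
      refine (totalDegree_mul _ _).trans ?_
      rw [totalDegree_C, add_zero]
      refine (totalDegree_mul _ _).trans ?_
      have e1 : ((-crossPoly v 0) ^ i).totalDegree ≤ i := by
        refine (totalDegree_pow _ _).trans ?_
        rw [totalDegree_neg]
        exact (Nat.mul_le_mul_left i (hX _ _ _ _)).trans (by simp)
      have e2 : (crossPoly v 1 ^ (d - i)).totalDegree ≤ d - i := by
        refine (totalDegree_pow _ _).trans ?_
        exact (Nat.mul_le_mul_left _ (hX _ _ _ _)).trans (by simp)
      have := Finset.mem_range.1 hd
      have := Finset.mem_range.1 hi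
      omega
    set f₂ := f - aeval (crossPoly v) p₁ with hf₂
    have hf₂W : f₂ ∈ stepW v W e := sub_mem hf (h.aeval_crossPoly_mem hp₁W)
    have hax : axis S f₂ = 0 := by
      have h1 : axis S (aeval (crossPoly v) p₁) = ∑ d ∈ Finset.range (N + 1),
          Polynomial.C ((axis S f).coeff d) * Polynomial.X ^ d := by
        rw [hp₁]
        simp only [map_sum, map_mul, map_pow, map_neg, aeval_X, algHom_C, algebraMap_eq]
        refine Finset.sum_congr rfl fun d _ => ?_
        rw [hw, map_sum, Finset.sum_mul]
        refine Finset.sum_congr rfl fun i hi => ?_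
        have := Finset.mem_range.1 hi
        rw [show (Polynomial.X ^ d : Polynomial S) = Polynomial.X ^ i * Polynomial.X ^ (d - i) by
          rw [← pow_add]; congr 1; omega]
        simp [axis, crossPoly, algHom_C]
        ring
      have h2 : axis S f = ∑ d ∈ Finset.range (N + 1),
          Polynomial.C ((axis S f).coeff d) * Polynomial.X ^ d := by
        refine Polynomial.as_sum_range_C_mul_X_pow' (axis S f) ?_
        rw [Nat.lt_succ_iff, Polynomial.natDegree_le_iff_coeff_eq_zero]
        intro d hd
        rw [coeff_axis]
        refine coeff_eq_zero_of_totalDegree_lt ?_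
        rw [hN]
        refine hd.trans_le (le_of_eq ?_)
        exact (Finsupp.degree_single (2 : Fin 3) d).symm
      rw [hf₂, map_sub, h1, ← h2, sub_self]
    have hdvd : crossPoly v 2 ∣ f₂ := by
      refine line_dvd (h.ne 0) (fun a b hab => h.reg1 hab) (i := 0) (j := 1) (by decide) ?_
      have h1 := aeval_add_of_mem_shiftInv hf₂W.2
        ![0, 0, X 2 - C (v 2) * X 0] (X 0 : MvPolynomial (Fin 3) S)
      have h2 : (fun l : Fin 3 => if l = 1 then C (v 1) * X 0 else if l = 0 then C (v 0) * X 0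
          else X l : Fin 3 → MvPolynomial (Fin 3) S) = fun i =>
          (![0, 0, X 2 - C (v 2) * X 0] : Fin 3 → MvPolynomial (Fin 3) S) i +
          algebraMap S (MvPolynomial (Fin 3) S) (v i) * X 0 := by
        funext i
        fin_cases i <;> simp [algebraMap_eq]
      rw [h2, h1]
      have h3 : (aeval ![0, 0, X 2 - C (v 2) * X 0] :
          MvPolynomial (Fin 3) S →ₐ[S] MvPolynomial (Fin 3) S) =
          (Polynomial.aeval (X 2 - C (v 2) * X 0)).comp (axis S) := by
        ext i : 1
        fin_cases i <;> simp [axis]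
      rw [h3, AlgHom.comp_apply, hax, map_zero]
    obtain ⟨q, hq⟩ := hdvd
    have hc0 : crossPoly v 2 ≠ 0 := by
      intro h0
      have := congrArg (coeff (Finsupp.single 1 1)) h0
      simp [crossPoly, coeff_C_mul, coeff_X, Finsupp.single_eq_single_iff] at this
      exact h.ne 0 this
    have hqW : q ∈ stepW v W e := h.step_quot (f := 0) (h.crossPoly_mem 2) hc0 (by
      rw [← hq]; simpa using hf₂W)
    have hfin : ∃ p ∈ coeffwise (fun _ => W e), q = aeval (crossPoly v) p := by
      by_cases hq0 : q = 0
      · exact ⟨0, zero_mem _, by rw [hq0, map_zero]⟩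
      refine ih _ ?_ hqW rfl
      have e1 : f₂.totalDegree ≤ N :=
        (totalDegree_sub _ _).trans (max_le hN.le hdeg1)
      rw [hq, totalDegree_mul_of_isDomain hc0 hq0] at e1
      have e2 : 0 < (crossPoly v 2).totalDegree := by
        have := le_totalDegree (p := crossPoly v 2) (s := Finsupp.single 1 1) (by
          rw [mem_support_iff]
          simpa [crossPoly, coeff_C_mul, coeff_X, Finsupp.single_eq_single_iff] using h.ne 0)
        rw [Finsupp.sum_single_index rfl] at this
        exact this
      omega
    obtain ⟨p, hp, rfl⟩ := hfin
    refine ⟨p₁ + X 2 * p, add_mem hp₁W (h.mul_mem_const (h.X_mem_const 2) hp), ?_⟩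
    rw [map_add, map_mul, aeval_X, ← hq, hf₂]
    ring

end Good

end Step

end KalmanAux

namespace KalmanAux
open MvPolynomial

section Step

variable {S : Type*} [CommRing S]

namespace Good

variable {v : Fin 3 → S} {W : ℕ → AddSubgroup S}

theorem step_gen [IsDomain S] (h : Good v W) {e : ℕ} {x : MvPolynomial (Fin 3) S}
    (hx : x ∈ stepW v W (e + 1)) : ∃ a ∈ stepW v W e, ∃ b ∈ stepW v W e, ∃ c ∈ stepW v W e,
      x = C (v 0) * a + C (v 1) * b + C (v 2) * c := by
  obtain ⟨P, hP, rfl⟩ := h.exists_eq_aeval_crossPoly hx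
  rw [P.as_sum, map_sum]
  refine Finset.sum_induction _ (fun x => ∃ a ∈ stepW v W e, ∃ b ∈ stepW v W e,
    ∃ c ∈ stepW v W e, x = C (v 0) * a + C (v 1) * b + C (v 2) * c) ?_ ?_ ?_
  · rintro _ _ ⟨a, ha, b, hb, c, hc, rfl⟩ ⟨a', ha', b', hb', c', hc', rfl⟩
    exact ⟨_, add_mem ha ha', _, add_mem hb hb', _, add_mem hc hc', by ring⟩
  · exact ⟨0, zero_mem _, 0, zero_mem _, 0, zero_mem _, by ring⟩
  · intro ν _
    obtain ⟨a, ha, b, hb, c, hc, habc⟩ := h.gen (hP ν)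
    refine ⟨_, h.aeval_crossPoly_mem (monomial_mem_coeffwise (ν := ν) ha), _,
      h.aeval_crossPoly_mem (monomial_mem_coeffwise (ν := ν) hb), _,
      h.aeval_crossPoly_mem (monomial_mem_coeffwise (ν := ν) hc), ?_⟩
    simp only [aeval_monomial, habc, algebraMap_eq, C_add, C_mul]
    ring

theorem reg2_neg_pow (h : Good v W) {k l : ℕ} {x : S}
    (hx : v 2 ^ k * (-v 2) ^ l * x ∈ Ideal.span {v 0, v 1}) : ∃ p q, x = v 0 * p + v 1 * q := by
  have h1 : ∀ n : ℕ, ∀ x, v 2 ^ n * x ∈ Ideal.span {v 0, v 1} →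
      ∃ p q, x = v 0 * p + v 1 * q := by
    intro n
    induction n with
    | zero =>
      intro x hx
      obtain ⟨p, q, hpq⟩ := Ideal.mem_span_pair.1 hx
      exact ⟨p, q, by linear_combination -hpq⟩
    | succ n ih =>
      intro x hx
      obtain ⟨p, q, hpq⟩ := ih (v 2 * x) (by rwa [← mul_assoc, ← pow_succ])
      exact h.reg2 ⟨p, q, hpq⟩
  refine h1 (k + l) x ?_
  have h2 := Ideal.mul_mem_left _ ((-1) ^ l) hx
  rw [neg_pow] at h2
  convert h2 using 1
  have h3 : ((-1 : S) ^ l) * (-1) ^ l = 1 := by rw [← mul_pow]; simp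
  linear_combination (-v 2 ^ k * v 2 ^ l * x) * h3

theorem coeff_mem_of_mem_span (h : Good v W) {P p q : MvPolynomial (Fin 3) S}
    (hP : aeval (crossPoly v) P = C (v 0) * p + C (v 1) * q) {ν : Fin 3 →₀ ℕ} (hν : ν 2 = 0) :
    ∃ p q, coeff ν P = v 0 * p + v 1 * q := by
  set I : Ideal S := Ideal.span {v 0, v 1}
  have h0 : Ideal.Quotient.mk I (v 0) = 0 :=
    Ideal.Quotient.eq_zero_iff_mem.2 (Ideal.subset_span (by simp))
  have h1 : Ideal.Quotient.mk I (v 1) = 0 :=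
    Ideal.Quotient.eq_zero_iff_mem.2 (Ideal.subset_span (by simp))
  set s : Fin 3 → S ⧸ I :=
    ![Ideal.Quotient.mk I (v 2), -Ideal.Quotient.mk I (v 2), 0] with hs
  have h2 : ((map (Ideal.Quotient.mk I)).comp
      (aeval (R := S) (S₁ := MvPolynomial (Fin 3) S) (crossPoly v)).toRingHom) =
      (aeval (R := S ⧸ I) (S₁ := MvPolynomial (Fin 3) (S ⧸ I))
        (fun i => C (s i) * X i)).toRingHom.comp (map (Ideal.Quotient.mk I)) := by
    apply MvPolynomial.ringHom_ext
    · intro r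
      simp
    · intro i
      fin_cases i <;> simp [crossPoly, h0, h1, hs] <;> ring
  have h3 := congrArg (fun g => coeff ν (g P)) h2
  simp only [RingHom.comp_apply, AlgHom.toRingHom_eq_coe, RingHom.coe_coe, hP,
    coeff_aeval_C_mul_X] at h3
  simp only [map_add, map_mul, map_C, h0, h1, map_zero, zero_mul, add_zero, coeff_zero,
    coeff_map] at h3
  rw [Finsupp.prod_fintype _ _ (by simp), Fin.prod_univ_three] at h3
  simp only [hs, hν, pow_zero, mul_one, Matrix.cons_val, Matrix.cons_val_one,
    Matrix.cons_val_zero] at h3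
  rw [← map_neg, ← map_pow, ← map_pow, ← map_mul, ← map_mul, eq_comm,
    Ideal.Quotient.eq_zero_iff_mem] at h3
  exact h.reg2_neg_pow h3

theorem step_star [IsDomain S] (h : Good v W) {e : ℕ} {x : MvPolynomial (Fin 3) S}
    (hx : x ∈ stepW v W (e + 1)) (hpq : ∃ p q, x = C (v 0) * p + C (v 1) * q) :
    ∃ a ∈ stepW v W e, ∃ b ∈ stepW v W e, x = C (v 0) * a + C (v 1) * b := by
  obtain ⟨P, hP, rfl⟩ := h.exists_eq_aeval_crossPoly hx
  obtain ⟨p, q, hpq⟩ := hpq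
  have key := fun ν hν => h.coeff_mem_of_mem_span hpq (ν := ν) hν
  conv in aeval (crossPoly v) P => rw [P.as_sum, map_sum]
  refine Finset.sum_induction _ (fun x => ∃ a ∈ stepW v W e, ∃ b ∈ stepW v W e,
    x = C (v 0) * a + C (v 1) * b) ?_ ?_ ?_
  · rintro _ _ ⟨a, ha, b, hb, rfl⟩ ⟨a', ha', b', hb', rfl⟩
    exact ⟨_, add_mem ha ha', _, add_mem hb hb', by ring⟩
  · exact ⟨0, zero_mem _, 0, zero_mem _, by ring⟩
  · intro ν _
    by_cases hν : ν 2 = 0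
    · obtain ⟨a, ha, b, hb, hab⟩ := h.star (hP ν) (key ν hν)
      refine ⟨_, h.aeval_crossPoly_mem (monomial_mem_coeffwise (ν := ν) ha), _,
        h.aeval_crossPoly_mem (monomial_mem_coeffwise (ν := ν) hb), ?_⟩
      simp only [aeval_monomial, hab, algebraMap_eq, C_add, C_mul]
      ring
    · obtain ⟨a, ha, b, hb, c, hc, habc⟩ := h.gen (hP ν)
      obtain ⟨μ, rfl⟩ : ∃ μ, ν = μ + Finsupp.single 2 1 :=
        ⟨ν - Finsupp.single 2 1, (tsub_add_cancel_of_le (by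
          rw [Finsupp.single_le_iff]; omega)).symm⟩
      have ha' := h.aeval_crossPoly_mem (monomial_mem_coeffwise (ν := μ) ha)
      have hb' := h.aeval_crossPoly_mem (monomial_mem_coeffwise (ν := μ) hb)
      have hc' := h.aeval_crossPoly_mem (monomial_mem_coeffwise (ν := μ) hc)
      refine ⟨_, sub_mem (h.step_mul (f := 0) ha' (h.crossPoly_mem 2))
        (h.step_mul (f := 0) hc' (h.crossPoly_mem 1)), _,
        sub_mem (h.step_mul (f := 0) hb' (h.crossPoly_mem 2))
        (h.step_mul (f := 0) hc' (h.crossPoly_mem 0)), ?_⟩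
      have e1 : (monomial (μ + Finsupp.single 2 1) (coeff (μ + Finsupp.single 2 1) P) :
          MvPolynomial (Fin 3) S) =
          (C (v 0) * monomial μ a + C (v 1) * monomial μ b + C (v 2) * monomial μ c) * X 2 := by
        rw [monomial_add_single, pow_one, habc]
        simp only [C_mul_monomial, map_add]
      rw [e1]
      simp only [map_add, map_mul, aeval_X, algHom_C, algebraMap_eq]
      have e2 : C (v 2) * crossPoly v 2 = -(C (v 0) * crossPoly v 1 + C (v 1) * crossPoly v 0) := by
        simp [crossPoly]
        ring
      linear_combination (aeval (crossPoly v) (monomial μ c)) * e2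

theorem step [IsDomain S] (h : Good v W) :
    Good (fun i => (C (v i) : MvPolynomial (Fin 3) S)) (stepW v W) where
  mem_v i := h.C_mem (h.mem_v i)
  one_mem := by simpa using h.C_mem h.one_mem
  mul := h.step_mul
  gen := h.step_gen
  star := h.step_star
  ne i := C_ne_zero.2 (h.ne i)
  reg1 {x y} hxy := by
    rw [C_dvd_iff]
    intro ν
    refine h.reg1 (y := coeff ν y) ?_
    rw [← coeff_C_mul, ← coeff_C_mul, hxy]
  reg2 {x} hx := by
    obtain ⟨p, q, hpq⟩ := hx
    have key : ∀ ν, ∃ a b, coeff ν x = v 0 * a + v 1 * b := fun ν =>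
      h.reg2 ⟨coeff ν p, coeff ν q, by simp only [← coeff_C_mul, hpq, coeff_add]⟩
    rw [x.as_sum]
    refine Finset.sum_induction _ (fun x => ∃ a b, x = C (v 0) * a + C (v 1) * b) ?_ ?_ ?_
    · rintro _ _ ⟨a, b, rfl⟩ ⟨a', b', rfl⟩
      exact ⟨a + a', b + b', by ring⟩
    · exact ⟨0, 0, by ring⟩
    · intro ν _
      obtain ⟨a, b, hab⟩ := key ν
      refine ⟨monomial ν a, monomial ν b, ?_⟩
      rw [hab]
      simp only [C_mul_monomial, map_add]
  quot := h.step_quot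

theorem of_ringEquiv (h : Good v W) {T : Type*} [CommRing T] (φ : S ≃+* T) :
    Good (fun i => φ (v i)) (fun e => (W e).comap (φ.symm : T →+ S)) where
  mem_v i := by simpa using h.mem_v i
  one_mem := by simpa using h.one_mem
  mul hx hy := by simpa using h.mul hx hy
  gen {e x} hx := by
    obtain ⟨a, ha, b, hb, c, hc, habc⟩ := h.gen hx
    refine ⟨φ a, by simpa using ha, φ b, by simpa using hb, φ c, by simpa using hc, ?_⟩
    rw [← map_mul, ← map_mul, ← map_mul, ← map_add, ← map_add, ← habc]
    simp
  star {e x} hx hpq := by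
    obtain ⟨p, q, hpq⟩ := hpq
    obtain ⟨a, ha, b, hb, hab⟩ := h.star hx ⟨φ.symm p, φ.symm q, by simp [hpq]⟩
    refine ⟨φ a, by simpa using ha, φ b, by simpa using hb, ?_⟩
    rw [← map_mul, ← map_mul, ← map_add, ← hab]
    simp
  ne i := by simpa using h.ne i
  reg1 {x y} hxy := by
    obtain ⟨z, hz⟩ := h.reg1 (x := φ.symm x) (y := φ.symm y) (φ.injective (by simpa using hxy))
    exact ⟨φ z, by rw [← map_mul, ← hz]; simp⟩
  reg2 {x} hx := by
    obtain ⟨p, q, hpq⟩ := hx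
    obtain ⟨a, b, hab⟩ := h.reg2 (x := φ.symm x)
      ⟨φ.symm p, φ.symm q, φ.injective (by simpa using hpq)⟩
    exact ⟨φ a, φ b, by rw [← map_mul, ← map_mul, ← map_add, ← hab]; simp⟩
  quot {e f s x} hs hs0 hsx :=
    h.quot (s := φ.symm s) (x := φ.symm x) hs (by simpa using hs0) (by simpa using hsx)

end Good

end Step

end KalmanAux

namespace KalmanAux
open MvPolynomial

section Base

variable {k : Type*} [CommRing k] {m : ℕ}

/-- The polynomials all of whose monomials have degree in the first group of variables exceeding
the degree in the second group by `e`. -/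
noncomputable def baseW (k : Type*) [CommRing k] (m : ℕ) (e : ℕ) :
    AddSubgroup (MvPolynomial (Fin 3 ⊕ Fin m) k) :=
  open Classical in
  coeffwise fun ν => if ∑ i, ν (Sum.inl i) = e + ∑ j, ν (Sum.inr j) then ⊤ else ⊥

theorem mem_baseW {e : ℕ} {x : MvPolynomial (Fin 3 ⊕ Fin m) k} :
    x ∈ baseW k m e ↔ ∀ ν, coeff ν x ≠ 0 → ∑ i, ν (Sum.inl i) = e + ∑ j, ν (Sum.inr j) := by
  rw [baseW, mem_coeffwise]
  refine forall_congr' fun ν => ?_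
  split_ifs with h
  · simp [h]
  · simp [h]

theorem monomial_mem_baseW {e : ℕ} {ν : Fin 3 ⊕ Fin m →₀ ℕ} {c : k}
    (h : c ≠ 0 → ∑ i, ν (Sum.inl i) = e + ∑ j, ν (Sum.inr j)) : monomial ν c ∈ baseW k m e := by
  classical
  rw [mem_baseW]
  intro μ hμ
  rw [coeff_monomial] at hμ
  split_ifs at hμ with hνμ
  · subst hνμ; exact h hμ
  · exact absurd rfl hμ

theorem exists_X_mul_of_mem_baseW {e : ℕ} {ν : Fin 3 ⊕ Fin m →₀ ℕ} {c : k} {i : Fin 3}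
    (hν : ν (Sum.inl i) ≠ 0)
    (h : c ≠ 0 → ∑ i, ν (Sum.inl i) = e + 1 + ∑ j, ν (Sum.inr j)) :
    ∃ y ∈ baseW k m e, (monomial ν c : MvPolynomial (Fin 3 ⊕ Fin m) k) = X (Sum.inl i) * y := by
  classical
  obtain ⟨μ, rfl⟩ : ∃ μ, ν = μ + Finsupp.single (Sum.inl i) 1 :=
    ⟨ν - Finsupp.single (Sum.inl i) 1, (tsub_add_cancel_of_le (by
      rw [Finsupp.single_le_iff]; omega)).symm⟩
  refine ⟨monomial μ c, monomial_mem_baseW fun hc => ?_, ?_⟩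
  · have := h hc
    simp only [Finsupp.add_apply, Finset.sum_add_distrib, Finsupp.single_apply, Sum.inl.injEq,
      Finset.sum_ite_eq, Finset.mem_univ, if_true, reduceCtorEq, if_false,
      Finset.sum_const_zero] at this
    omega
  · rw [monomial_add_single, pow_one, mul_comm]

theorem mul_mem_baseW {e f : ℕ} {x y : MvPolynomial (Fin 3 ⊕ Fin m) k} (hx : x ∈ baseW k m e)
    (hy : y ∈ baseW k m f) : x * y ∈ baseW k m (e + f) := by
  rw [mem_baseW] at *
  classical
  intro ν hν
  rw [coeff_mul] at hν
  obtain ⟨p, hp, hp0⟩ := Finset.exists_ne_zero_of_sum_ne_zero hν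
  rw [← Finset.HasAntidiagonal.mem_antidiagonal.1 hp]
  simp only [Finsupp.add_apply, Finset.sum_add_distrib, hx _ (left_ne_zero_of_mul hp0),
    hy _ (right_ne_zero_of_mul hp0)]
  ring

theorem good_base [IsDomain k] : Good (fun i : Fin 3 => (X (Sum.inl i) :
    MvPolynomial (Fin 3 ⊕ Fin m) k)) (baseW k m) where
  mem_v i := monomial_mem_baseW fun _ => by
    classical simp [Finsupp.single_apply]
  one_mem := monomial_mem_baseW fun _ => by simp
  mul hx hy := mul_mem_baseW hx hy
  gen {e x} hx := by
    rw [mem_baseW] at hx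
    rw [x.as_sum]
    refine Finset.sum_induction _ (fun x => ∃ a ∈ baseW k m e, ∃ b ∈ baseW k m e,
      ∃ c ∈ baseW k m e, x = X (Sum.inl 0) * a + X (Sum.inl 1) * b + X (Sum.inl 2) * c) ?_ ?_ ?_
    · rintro _ _ ⟨a, ha, b, hb, c, hc, rfl⟩ ⟨a', ha', b', hb', c', hc', rfl⟩
      exact ⟨_, add_mem ha ha', _, add_mem hb hb', _, add_mem hc hc', by ring⟩
    · exact ⟨0, zero_mem _, 0, zero_mem _, 0, zero_mem _, by ring⟩
    · intro ν hν
      have h := hx ν (mem_support_iff.1 hν)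
      rw [Fin.sum_univ_three] at h
      by_cases h0 : ν (Sum.inl 0) = 0
      · by_cases h1 : ν (Sum.inl 1) = 0
        · obtain ⟨y, hy, e1⟩ := exists_X_mul_of_mem_baseW (i := 2) (by omega) (hx ν)
          exact ⟨0, zero_mem _, 0, zero_mem _, y, hy, by rw [e1]; ring⟩
        · obtain ⟨y, hy, e1⟩ := exists_X_mul_of_mem_baseW h1 (hx ν)
          exact ⟨0, zero_mem _, y, hy, 0, zero_mem _, by rw [e1]; ring⟩
      · obtain ⟨y, hy, e1⟩ := exists_X_mul_of_mem_baseW h0 (hx ν)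
        exact ⟨y, hy, 0, zero_mem _, 0, zero_mem _, by rw [e1]; ring⟩
  star {e x} hx hpq := by
    obtain ⟨p, q, hpq⟩ := hpq
    have hI : x ∈ Ideal.span (Set.image X {Sum.inl 0, Sum.inl 1} :
        Set (MvPolynomial (Fin 3 ⊕ Fin m) k)) := by
      rw [hpq]
      exact add_mem (Ideal.mul_mem_right _ _ (Ideal.subset_span ⟨_, by simp, rfl⟩))
        (Ideal.mul_mem_right _ _ (Ideal.subset_span ⟨_, by simp, rfl⟩))
    rw [mem_ideal_span_X_image] at hI
    rw [mem_baseW] at hx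
    clear hpq
    rw [x.as_sum]
    refine Finset.sum_induction _ (fun x => ∃ a ∈ baseW k m e, ∃ b ∈ baseW k m e,
      x = X (Sum.inl 0) * a + X (Sum.inl 1) * b) ?_ ?_ ?_
    · rintro _ _ ⟨a, ha, b, hb, rfl⟩ ⟨a', ha', b', hb', rfl⟩
      exact ⟨_, add_mem ha ha', _, add_mem hb hb', by ring⟩
    · exact ⟨0, zero_mem _, 0, zero_mem _, by ring⟩
    · intro ν hν
      obtain ⟨i, hi, hi0⟩ := hI ν hν
      rcases hi with rfl | rfl
      · obtain ⟨y, hy, e1⟩ := exists_X_mul_of_mem_baseW hi0 (hx ν)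
        exact ⟨y, hy, 0, zero_mem _, by rw [e1]; ring⟩
      · obtain ⟨y, hy, e1⟩ := exists_X_mul_of_mem_baseW hi0 (hx ν)
        exact ⟨0, zero_mem _, y, hy, by rw [e1]; ring⟩
  ne i := X_ne_zero _
  reg1 {x y} hxy := by
    rcases (X_prime (R := k) (i := (Sum.inl (0 : Fin 3) : Fin 3 ⊕ Fin m))).dvd_or_dvd
      (Dvd.intro y hxy.symm) with h | h
    · rw [X_dvd_X] at h
      rcases h with h | h
    · exact h
  reg2 {x} hx := by
    obtain ⟨p, q, hpq⟩ := hx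
    have hI : X (Sum.inl 2) * x ∈ Ideal.span (Set.image X {Sum.inl 0, Sum.inl 1} :
        Set (MvPolynomial (Fin 3 ⊕ Fin m) k)) := by
      rw [hpq]
      exact add_mem (Ideal.mul_mem_right _ _ (Ideal.subset_span ⟨_, by simp, rfl⟩))
        (Ideal.mul_mem_right _ _ (Ideal.subset_span ⟨_, by simp, rfl⟩))
    have hI2 : x ∈ Ideal.span (Set.image X {Sum.inl 0, Sum.inl 1} :
        Set (MvPolynomial (Fin 3 ⊕ Fin m) k)) := by
      rw [mem_ideal_span_X_image] at hI ⊢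
      intro ν hν
      obtain ⟨i, hi, hi0⟩ := hI (Finsupp.single (Sum.inl 2) 1 + ν) (by
        rw [mem_support_iff, coeff_X_mul]; exact mem_support_iff.1 hν)
      refine ⟨i, hi, ?_⟩
      rcases hi with rfl | rfl <;> simpa using hi0
    rw [Set.image_pair, Ideal.mem_span_pair] at hI2
    obtain ⟨a, b, hab⟩ := hI2
    exact ⟨a, b, by rw [← hab]; ring⟩
  quot {e f s x} hs hs0 hsx := by
    refine coeffwise_of_mul_mem (fun {μ ν a b} ha hb => ?_) (fun {μ ν a b} ha ha0 hab => ?_)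
      hs hs0 hsx
    · split_ifs at ha with h1
      · split_ifs at hb with h2
        · rw [if_pos]
          · trivial
          · simp only [Finsupp.add_apply, Finset.sum_add_distrib, h1, h2]; ring
        · rw [show b = 0 from hb, mul_zero]; exact zero_mem _
      · rw [show a = 0 from ha, zero_mul]; exact zero_mem _
    · split_ifs at ha with h1
      · split_ifs at hab with h2
        · rw [if_pos]
          · trivial
          · simp only [Finsupp.add_apply, Finset.sum_add_distrib] at h2; omega
        · rw [(mul_eq_zero.1 (show a * b = 0 from hab)).resolve_left ha0]; exact zero_mem _
      · exact absurd ha ha0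

theorem mem_baseW_zero_iff {x : MvPolynomial (Fin 3 ⊕ Fin m) k} :
    x ∈ baseW k m 0 ↔ x ∈ Algebra.adjoin k (Set.range fun a : Fin m × Fin 3 =>
      (X (Sum.inr a.1) * X (Sum.inl a.2) : MvPolynomial (Fin 3 ⊕ Fin m) k)) := by
  classical
  set B := Algebra.adjoin k (Set.range fun a : Fin m × Fin 3 =>
      (X (Sum.inr a.1) * X (Sum.inl a.2) : MvPolynomial (Fin 3 ⊕ Fin m) k)) with hB
  have key : ∀ (N : ℕ) (ν : Fin 3 ⊕ Fin m →₀ ℕ) (c : k), ∑ j, ν (Sum.inr j) = N →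
      ∑ i, ν (Sum.inl i) = N → monomial ν c ∈ B := by
    intro N
    induction N with
    | zero =>
      intro ν c h1 h2
      have : ν = 0 := by
        ext i
        rcases i with i | i
        · exact Finset.sum_eq_zero_iff.1 h2 i (Finset.mem_univ _)
        · exact Finset.sum_eq_zero_iff.1 h1 i (Finset.mem_univ _)
      rw [this]
      exact B.algebraMap_mem c
    | succ N ih =>
      intro ν c h1 h2
      obtain ⟨j, -, hj⟩ := Finset.exists_ne_zero_of_sum_ne_zero (h1.trans_ne (Nat.succ_ne_zero N))
      obtain ⟨i, -, hi⟩ := Finset.exists_ne_zero_of_sum_ne_zero (h2.trans_ne (Nat.succ_ne_zero N))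
      obtain ⟨μ, rfl⟩ : ∃ μ, ν = μ + Finsupp.single (Sum.inr j) 1 + Finsupp.single (Sum.inl i) 1 := by
        refine ⟨ν - (Finsupp.single (Sum.inr j) 1 + Finsupp.single (Sum.inl i) 1), ?_⟩
        rw [add_assoc]
        refine (tsub_add_cancel_of_le fun l => ?_).symm
        rcases l with l | l
        · by_cases hl : l = i
          · subst hl; simp; omega
          · simp [Ne.symm hl]
        · by_cases hl : l = j
          · subst hl; simp; omega
          · simp [Ne.symm hl]
      rw [monomial_add_single, monomial_add_single, pow_one, pow_one, mul_assoc]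
      simp only [Finsupp.add_apply, Finset.sum_add_distrib, Finsupp.single_apply, Sum.inl.injEq,
        Sum.inr.injEq, Finset.sum_ite_eq, Finset.mem_univ, if_true, reduceCtorEq, if_false,
        Finset.sum_const_zero] at h1 h2
      exact B.mul_mem (ih μ c (by omega) (by omega)) (Algebra.subset_adjoin ⟨(j, i), rfl⟩)
  constructor
  · intro hx
    rw [mem_baseW] at hx
    rw [x.as_sum]
    refine sum_mem fun ν hν => key _ ν _ rfl ?_
    simpa using hx ν (mem_support_iff.1 hν)
  · intro hx
    induction hx using Algebra.adjoin_induction with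
    | mem x hx =>
      obtain ⟨⟨j, i⟩, rfl⟩ := hx
      have : (X (Sum.inr j) * X (Sum.inl i) : MvPolynomial (Fin 3 ⊕ Fin m) k) =
          monomial (Finsupp.single (Sum.inr j) 1 + Finsupp.single (Sum.inl i) 1) 1 := by
        rw [X, X, monomial_mul, mul_one]
      dsimp only
      rw [this]
      exact monomial_mem_baseW fun _ => by simp [Finsupp.single_apply]
    | algebraMap r => exact monomial_mem_baseW fun _ => by simp
    | add x y _ _ h1 h2 => exact add_mem h1 h2
    | mul x y _ _ h1 h2 =>
      exact mul_mem_baseW (e := 0) (f := 0) h1 h2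

end Base

end KalmanAux

namespace KalmanAux
open MvPolynomial

section FFT

/-- The ring of polynomials in `p` vectors of length three with coefficients in the ring of
polynomials in one further vector and `m` scalars. -/
abbrev BigRing (p m : ℕ) (k : Type*) [CommRing k] :=
  MvPolynomial (Fin p × Fin 3) (MvPolynomial (Fin 3 ⊕ Fin m) k)

variable {k : Type*} [CommRing k]

/-- The distinguished vector. -/
noncomputable def vV (p m : ℕ) (k : Type*) [CommRing k] : Fin 3 → BigRing p m k :=
  fun i => C (X (Sum.inl i))

/-- The scalars. -/
noncomputable def uV (p m : ℕ) (k : Type*) [CommRing k] : Fin m → BigRing p m k :=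
  fun j => C (X (Sum.inr j))

/-- The cross product of the distinguished vector with one of the others. -/
noncomputable def rV (p m : ℕ) (k : Type*) [CommRing k] (j : Fin p) : Fin 3 → BigRing p m k :=
  crossProduct (vV p m k) fun i => X (j, i)

/-- The generators of the ring of invariants. -/
def gens (p m : ℕ) (k : Type*) [CommRing k] : Set (BigRing p m k) :=
  Set.range (fun a : Fin m × Fin 3 => uV p m k a.1 * vV p m k a.2) ∪
    Set.range fun a : Fin p × Fin 3 => rV p m k a.1 a.2

/-- Splitting off the first vector. -/
def splitEquiv (p : ℕ) : Fin 3 ⊕ Fin p × Fin 3 ≃ Fin (p + 1) × Fin 3 where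
  toFun := Sum.elim (fun i => (0, i)) fun a => (a.1.succ, a.2)
  invFun x := Fin.cases (Sum.inl x.2) (fun j => Sum.inr (j, x.2)) x.1
  left_inv x := by rcases x with i | ⟨j, i⟩ <;> rfl
  right_inv x := by
    obtain ⟨j, i⟩ := x
    induction j using Fin.cases <;> rfl

/-- Splitting off the first vector, on polynomial rings. -/
noncomputable def bigEquiv (p m : ℕ) (k : Type*) [CommRing k] :
    MvPolynomial (Fin 3) (BigRing p m k) ≃ₐ[MvPolynomial (Fin 3 ⊕ Fin m) k] BigRing (p + 1) m k :=
  (sumAlgEquiv _ _ _).symm.trans (renameEquiv _ (splitEquiv p))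

theorem bigEquiv_X (p m : ℕ) (i : Fin 3) : bigEquiv p m k (X i) = X (0, i) := by
  simp [bigEquiv, splitEquiv]

theorem bigEquiv_C_X (p m : ℕ) (j : Fin p) (i : Fin 3) :
    bigEquiv p m k (C (X (j, i))) = X (j.succ, i) := by
  simp [bigEquiv, splitEquiv]

theorem bigEquiv_C_C (p m : ℕ) (x : MvPolynomial (Fin 3 ⊕ Fin m) k) :
    bigEquiv p m k (C (C x)) = C x :=
  (bigEquiv p m k).commutes x

theorem exists_good [IsDomain k] (p m : ℕ) : ∃ W : ℕ → AddSubgroup (BigRing p m k),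
    Good (vV p m k) W ∧ ∀ x, x ∈ W 0 ↔ x ∈ Algebra.adjoin k (gens p m k) := by
  induction p with
  | zero =>
    let e : MvPolynomial (Fin 3 ⊕ Fin m) k ≃ₐ[k] BigRing 0 m k :=
      ((isEmptyAlgEquiv (MvPolynomial (Fin 3 ⊕ Fin m) k) (Fin 0 × Fin 3)).symm.restrictScalars k)
    have he : ∀ x, e x = C x := fun x => rfl
    refine ⟨_, (good_base (k := k) (m := m)).of_ringEquiv e.toRingEquiv, fun x => ?_⟩
    obtain ⟨x, rfl⟩ := e.surjective x
    have h1 : Algebra.adjoin k (gens 0 m k) = (Algebra.adjoin k (Set.range fun a : Fin m × Fin 3 =>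
      (X (Sum.inr a.1) * X (Sum.inl a.2) : MvPolynomial (Fin 3 ⊕ Fin m) k))).map e.toAlgHom := by
      rw [AlgHom.map_adjoin]
      congr 1
      ext y
      constructor
      · rintro (⟨a, rfl⟩ | ⟨⟨a, _⟩, _⟩)
        · exact ⟨_, ⟨a, rfl⟩, map_mul e _ _⟩
        · exact a.elim0
      · rintro ⟨_, ⟨a, rfl⟩, rfl⟩
        exact Or.inl ⟨a, (map_mul e _ _).symm⟩
    have h2 : e x ∈ (baseW k m 0).comap (e.toRingEquiv.symm : BigRing 0 m k →+ _) ↔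
        x ∈ baseW k m 0 := by
      rw [AddSubgroup.mem_comap]
      have : (e.toRingEquiv.symm : BigRing 0 m k →+ _) (e x) = x := e.symm_apply_apply x
      rw [this]
    rw [h1, h2, mem_baseW_zero_iff, Subalgebra.mem_map]
    constructor
    · intro h; exact ⟨x, h, rfl⟩
    · rintro ⟨y, hy, hyx⟩; rwa [← e.injective hyx]
  | succ p ih =>
    obtain ⟨W, hW, hW0⟩ := ih
    set φ := (bigEquiv p m k) with hφ
    have hv : (fun i => φ.toRingEquiv (C (vV p m k i))) = vV (p + 1) m k := by
      funext i; exact bigEquiv_C_C p m _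
    have hgood := hW.step.of_ringEquiv φ.toRingEquiv
    rw [hv] at hgood
    have hc : ∀ i, φ (crossProduct (fun i => C (vV p m k i)) X i) = rV (p + 1) m k 0 i := by
      intro i
      have h1 : ∀ i, φ (C (vV p m k i)) = vV (p + 1) m k i := fun i => bigEquiv_C_C p m _
      fin_cases i <;> simp [cross_apply, rV, h1] <;> simp [hφ, bigEquiv_X]
    have hc2 : ∀ i, ∃ i', crossPoly (vV p m k) i =
        crossProduct (fun i => C (vV p m k i)) X i' := by
      intro i
      refine ⟨![1, 0, 2] i, ?_⟩
      fin_cases i <;> simp [cross_apply, crossPoly]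
    have hc3 : ∀ i, ∃ i', crossProduct (fun i => C (vV p m k i)) X i =
        crossPoly (vV p m k) i' := by
      intro i
      refine ⟨![1, 0, 2] i, ?_⟩
      fin_cases i <;> simp [cross_apply, crossPoly]
    have hr : ∀ j i, φ (C (rV p m k j i)) = rV (p + 1) m k j.succ i := by
      intro j i
      have h1 : ∀ i, φ (C (vV p m k i)) = vV (p + 1) m k i := fun i => bigEquiv_C_C p m _
      fin_cases i <;> simp [cross_apply, rV, h1] <;> simp [hφ, bigEquiv_C_X]
    refine ⟨_, hgood, fun x => ?_⟩
    obtain ⟨x, rfl⟩ := φ.surjective x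
    have h2 : φ x ∈ (stepW (vV p m k) W 0).comap (φ.toRingEquiv.symm : BigRing (p + 1) m k →+ _) ↔
        x ∈ stepW (vV p m k) W 0 := by
      rw [AddSubgroup.mem_comap]
      have : (φ.toRingEquiv.symm : BigRing (p + 1) m k →+ _) (φ x) = x := φ.symm_apply_apply x
      rw [this]
    rw [h2]
    have hC : ∀ y ∈ W 0, φ (C y) ∈ Algebra.adjoin k (gens (p + 1) m k) := by
      intro y hy
      rw [hW0] at hy
      induction hy using Algebra.adjoin_induction with
      | mem y hy =>
        rcases hy with ⟨⟨j, i⟩, rfl⟩ | ⟨⟨j, i⟩, rfl⟩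
        · refine Algebra.subset_adjoin (Or.inl ⟨(j, i), ?_⟩)
          rw [C_mul, map_mul]
          exact (congrArg₂ _ (bigEquiv_C_C p m _) (bigEquiv_C_C p m _)).symm
        · exact Algebra.subset_adjoin (Or.inr ⟨(j.succ, i), (hr j i).symm⟩)
      | algebraMap r =>
        have : φ (C (algebraMap k (BigRing p m k) r)) = algebraMap k (BigRing (p + 1) m k) r :=
          bigEquiv_C_C p m _
        rw [this]
        exact Subalgebra.algebraMap_mem _ _
      | add x y _ _ h1 h2 => rw [C_add, map_add]; exact add_mem h1 h2
      | mul x y _ _ h1 h2 => rw [C_mul, map_mul]; exact mul_mem h1 h2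
    constructor
    · intro hx
      obtain ⟨P, hP, rfl⟩ := hW.exists_eq_aeval_crossPoly hx
      rw [P.as_sum, map_sum, map_sum]
      refine sum_mem fun ν _ => ?_
      rw [aeval_monomial, map_mul]
      refine mul_mem (hC _ (hP ν)) ?_
      rw [Finsupp.prod, map_prod]
      refine prod_mem fun i _ => ?_
      rw [map_pow]
      refine pow_mem ?_ _
      obtain ⟨i', hi'⟩ := hc2 i
      rw [hi', hc]
      exact Algebra.subset_adjoin (Or.inr ⟨(0, i'), rfl⟩)
    · intro hx
      rw [← φ.symm_apply_apply x]
      generalize φ x = z at hx ⊢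
      induction hx using Algebra.adjoin_induction with
      | mem y hy =>
        rcases hy with ⟨⟨j, i⟩, rfl⟩ | ⟨⟨j, i⟩, rfl⟩
        · have h3 : φ (C (uV p m k j * vV p m k i)) = uV (p + 1) m k j * vV (p + 1) m k i := by
            rw [C_mul, map_mul]
            exact (congrArg₂ _ (bigEquiv_C_C p m _) (bigEquiv_C_C p m _))
          dsimp only
          rw [← h3, φ.symm_apply_apply]
          exact hW.C_mem ((hW0 _).2 (Algebra.subset_adjoin (Or.inl ⟨(j, i), rfl⟩)))
        · dsimp only
          induction j using Fin.cases with
          | zero =>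
            rw [← hc, φ.symm_apply_apply]
            obtain ⟨i', hi'⟩ := hc3 i
            rw [hi']
            exact hW.crossPoly_mem i'
          | succ j =>
            rw [← hr, φ.symm_apply_apply]
            exact hW.C_mem ((hW0 _).2 (Algebra.subset_adjoin (Or.inr ⟨(j, i), rfl⟩)))
      | algebraMap r =>
        have : φ (C (algebraMap k (BigRing p m k) r)) = algebraMap k (BigRing (p + 1) m k) r :=
          bigEquiv_C_C p m _
        rw [← this, φ.symm_apply_apply]
        exact hW.C_mem ((hW0 _).2 (Subalgebra.algebraMap_mem _ _))
      | add x y _ _ h1 h2 => rw [map_add]; exact add_mem h1 h2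
      | mul x y _ _ h1 h2 => rw [map_mul]; exact hW.step_mul (e := 0) (f := 0) h1 h2

/-- The ring generated by the invariants is the intersection of the big ring with its own field
of fractions. -/
theorem mem_adjoin_of_mul_mem [IsDomain k] {p m : ℕ} {s x : BigRing p m k}
    (hs : s ∈ Algebra.adjoin k (gens p m k)) (hs0 : s ≠ 0)
    (hsx : s * x ∈ Algebra.adjoin k (gens p m k)) : x ∈ Algebra.adjoin k (gens p m k) := by
  obtain ⟨W, hW, hW0⟩ := exists_good (k := k) p m
  rw [← hW0] at *
  exact hW.quot hs hs0 hsx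

end FFT

end KalmanAux

namespace KalmanAux

section Normalization

variable {K : Type*} [Field K] {n s : ℕ}

theorem exists_presentation {S : Type*} [CommRing S] [IsDomain S] [IsIntegrallyClosed S]
    (π : MatCoordRing K n →+* S) (hker : RingHom.ker π = kalmanIdeal K n 3 s) (lam : S)
    {c₀ c₁ c₂ : MatCoordRing K n} (hcubic : lam ^ 3 = π c₂ * lam ^ 2 + π c₁ * lam + π c₀)
    {f g : MatCoordRing K n} (hg : π g ≠ 0) (hfg : π g * lam = π f)
    (hT : ∀ x a b, π b ≠ 0 → π b * x = π a → ∃ a b c, x = π a + π b * lam + π c * lam ^ 2) :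
    ∃ q : (MatCoordRing K n × MatCoordRing K n × MatCoordRing K n) →ₗ[MatCoordRing K n]
        KalmanNormalization K n 3 s,
      Function.Surjective q ∧
      (∀ a b c, q (a, b, c) = 0 ↔ π a + π b * lam + π c * lam ^ 2 = 0) ∧
      ∀ a, q (a, 0, 0) = kalmanNormInclusion K n 3 s (Ideal.Quotient.mk _ a) := by
  have hprime : (kalmanIdeal K n 3 s).IsPrime := hker ▸ RingHom.ker_isPrime π
  have hdom : IsDomain (KalmanCoordRing K n 3 s) := Ideal.Quotient.isDomain _
  set O := KalmanCoordRing K n 3 s with hO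
  let F := FractionRing O
  let E := FractionRing S
  let mk : MatCoordRing K n →+* O := Ideal.Quotient.mk (kalmanIdeal K n 3 s)
  let πb : O →+* S := Ideal.Quotient.lift (kalmanIdeal K n 3 s) π
    (fun a ha => by rw [← hker] at ha; exact ha)
  have hπb : ∀ a, πb (mk a) = π a := fun a => Ideal.Quotient.lift_mk _ _ _
  have hinj : Function.Injective πb := by
    rw [injective_iff_map_eq_zero]
    intro x hx
    obtain ⟨a, rfl⟩ := Ideal.Quotient.mk_surjective x
    refine Ideal.Quotient.eq_zero_iff_mem.2 ?_
    rw [← hker]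
    exact (hπb a).symm.trans hx
  have hinj2 : Function.Injective ((algebraMap S E).comp πb) :=
    (IsFractionRing.injective S E).comp hinj
  let j : F →+* E := IsFractionRing.lift hinj2
  have hj : ∀ x : O, j (algebraMap O F x) = algebraMap S E (πb x) := fun x =>
    IsFractionRing.lift_algebraMap hinj2 x
  have hjinj : Function.Injective j := RingHom.injective j
  have hg0 : algebraMap O F (mk g) ≠ 0 := by
    intro h0
    apply hg
    have := (IsFractionRing.injective O F) (h0.trans (map_zero _).symm)
    rw [← hπb, this, map_zero]
  let lF : F := algebraMap O F (mk f) / algebraMap O F (mk g)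
  have hlF : j lF = algebraMap S E lam := by
    have hπg : algebraMap S E (π g) ≠ 0 := by
      intro h0
      exact hg ((IsFractionRing.injective S E) (h0.trans (map_zero _).symm))
    simp only [lF, map_div₀, hj, hπb]
    rw [div_eq_iff hπg, ← map_mul, mul_comm lam, hfg]
  have hcubF : lF ^ 3 = algebraMap O F (mk c₂) * lF ^ 2 + algebraMap O F (mk c₁) * lF +
      algebraMap O F (mk c₀) := by
    apply hjinj
    rw [map_add, map_add, map_mul, map_mul, map_pow, map_pow, hlF, hj, hj, hj, hπb, hπb, hπb,
      ← map_pow, hcubic, map_add, map_add, map_mul, map_mul, map_pow]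
  have hlF_int : IsIntegral O lF := by
    refine ⟨Polynomial.X ^ 3 - (Polynomial.C (mk c₂) * Polynomial.X ^ 2 +
      Polynomial.C (mk c₁) * Polynomial.X + Polynomial.C (mk c₀)), ?_, ?_⟩
    · refine Polynomial.monic_X_pow_sub ?_
      exact Polynomial.degree_quadratic_le.trans_lt (by norm_num)
    · simp only [Polynomial.eval₂_sub, Polynomial.eval₂_add, Polynomial.eval₂_mul,
        Polynomial.eval₂_pow, Polynomial.eval₂_X, Polynomial.eval₂_C]
      rw [hcubF, sub_self]
  let lt : KalmanNormalization K n 3 s := (⟨lF, hlF_int⟩ : integralClosure O F)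
  let val : KalmanNormalization K n 3 s →+* F := (integralClosure O F).val.toRingHom
  have hval : Function.Injective val := Subtype.val_injective
  have hlt : val lt = lF := rfl
  have hvala : ∀ a : MatCoordRing K n,
      val (algebraMap (MatCoordRing K n) (KalmanNormalization K n 3 s) a) =
        algebraMap O F (mk a) := fun a => rfl
  let q : (MatCoordRing K n × MatCoordRing K n × MatCoordRing K n) →ₗ[MatCoordRing K n]
        KalmanNormalization K n 3 s :=
    (LinearMap.toSpanSingleton _ _ 1).coprod
      ((LinearMap.toSpanSingleton _ _ lt).coprod (LinearMap.toSpanSingleton _ _ (lt ^ 2)))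
  have hq : ∀ a b c, j (val (q (a, b, c))) =
      algebraMap S E (π a + π b * lam + π c * lam ^ 2) := by
    intro a b c
    simp only [q, LinearMap.coprod_apply, LinearMap.toSpanSingleton_apply, Algebra.smul_def,
      map_add, map_mul, map_pow, hlt, hvala, hlF, hj, hπb, map_one]
    ring
  refine ⟨q, ?_, ?_, ?_⟩
  · intro x
    have h1 : IsIntegral S (j (val x)) := by
      have h2 : IsIntegral O (val x) := x.2
      obtain ⟨P, hP, hPx⟩ := h2
      refine ⟨P.map πb, hP.map _, ?_⟩
      rw [Polynomial.eval₂_map]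
      have h3 : (algebraMap S E).comp πb = j.comp (algebraMap O F) :=
        RingHom.ext fun y => (hj y).symm
      rw [h3, ← Polynomial.hom_eval₂, hPx, map_zero]
    obtain ⟨y, hy⟩ := IsIntegrallyClosed.isIntegral_iff.1 h1
    obtain ⟨a, b, hb, hab⟩ := IsFractionRing.div_surjective (A := O) (val x)
    obtain ⟨a, rfl⟩ := Ideal.Quotient.mk_surjective a
    obtain ⟨b, rfl⟩ := Ideal.Quotient.mk_surjective b
    have hb0 : π b ≠ 0 := by
      rw [← hπb]
      intro h0
      exact nonZeroDivisors.ne_zero hb (hinj (h0.trans (map_zero _).symm))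
    have hb1 : algebraMap S E (π b) ≠ 0 := by
      intro h0
      exact hb0 ((IsFractionRing.injective S E) (h0.trans (map_zero _).symm))
    have hxy : π b * y = π a := by
      apply IsFractionRing.injective S E
      rw [map_mul, hy, ← hab, map_div₀]
      have e1 : j (algebraMap O F (Ideal.Quotient.mk _ a)) = algebraMap S E (π a) := by
        rw [hj]; exact congrArg _ (hπb a)
      have e2 : j (algebraMap O F (Ideal.Quotient.mk _ b)) = algebraMap S E (π b) := by
        rw [hj]; exact congrArg _ (hπb b)
      rw [e1, e2]
      rw [mul_div_assoc', mul_div_cancel_left₀ _ hb1]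
    obtain ⟨a', b', c', h⟩ := hT y a b hb0 hxy
    refine ⟨(a', b', c'), hval (hjinj ?_)⟩
    rw [hq, ← h, hy]
  · intro a b c
    rw [← map_eq_zero_iff val hval, ← map_eq_zero_iff j hjinj, hq,
      map_eq_zero_iff _ (IsFractionRing.injective S E)]
  · intro a
    apply hval
    simp only [q, LinearMap.coprod_apply, LinearMap.toSpanSingleton_apply, Algebra.smul_def,
      hvala, map_zero, add_zero, mul_one]
    rfl

end Normalization

end KalmanAux

namespace KalmanAux

section Blocks

variable {R : Type*} {m : ℕ}

/-- The upper left block of a matrix. -/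
def alph (M : Matrix (Fin (3 + m)) (Fin (3 + m)) R) : Matrix (Fin 3) (Fin 3) R :=
  fun i j => M (Fin.castAdd m i) (Fin.castAdd m j)

/-- The lower left block of a matrix. -/
def gam (M : Matrix (Fin (3 + m)) (Fin (3 + m)) R) : Matrix (Fin m) (Fin 3) R :=
  fun i j => M (Fin.natAdd 3 i) (Fin.castAdd m j)

/-- The matrix with given blocks. -/
def mkM (α : Matrix (Fin 3) (Fin 3) R) (γ : Matrix (Fin m) (Fin 3) R)
    (fr : Fin (3 + m) × Fin m → R) : Matrix (Fin (3 + m)) (Fin (3 + m)) R :=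
  fun i j => Fin.addCases (fun j => Fin.addCases (fun i => α i j) (fun k => γ k j) i)
    (fun l => fr (i, l)) j

@[simp] theorem alph_mkM (α : Matrix (Fin 3) (Fin 3) R) (γ : Matrix (Fin m) (Fin 3) R)
    (fr : Fin (3 + m) × Fin m → R) : alph (mkM α γ fr) = α := by
  ext i j; simp [alph, mkM]

@[simp] theorem gam_mkM (α : Matrix (Fin 3) (Fin 3) R) (γ : Matrix (Fin m) (Fin 3) R)
    (fr : Fin (3 + m) × Fin m → R) : gam (mkM α γ fr) = γ := by
  ext i j; simp [gam, mkM]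

theorem mkM_map {S : Type*} (φ : R → S) (α : Matrix (Fin 3) (Fin 3) R)
    (γ : Matrix (Fin m) (Fin 3) R) (fr : Fin (3 + m) × Fin m → R) (i j) :
    φ (mkM α γ fr i j) = mkM (fun i j => φ (α i j)) (fun i j => φ (γ i j)) (fun a => φ (fr a)) i j := by
  induction j using Fin.addCases with
  | left j => induction i using Fin.addCases <;> simp [mkM]
  | right j => simp [mkM]

end Blocks

section Points

variable {K : Type*} [Field K] {m : ℕ}

/-- Extension by zero. -/
def extZero (K : Type*) [Field K] (m : ℕ) : (Fin 3 → K) →ₗ[K] (Fin (3 + m) → K) where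
  toFun x := Fin.addCases x 0
  map_add' x y := by
    ext i; induction i using Fin.addCases <;> simp
  map_smul' c x := by
    ext i; induction i using Fin.addCases <;> simp

@[simp] theorem extZero_castAdd (x : Fin 3 → K) (i : Fin 3) :
    extZero K m x (Fin.castAdd m i) = x i := by simp [extZero]

@[simp] theorem extZero_natAdd (x : Fin 3 → K) (i : Fin m) :
    extZero K m x (Fin.natAdd 3 i) = 0 := by simp [extZero]

theorem extZero_injective : Function.Injective (extZero K m) := fun x y h => by
  ext i
  simpa using congrFun h (Fin.castAdd m i)

theorem mulVec_extZero_castAdd (M : Matrix (Fin (3 + m)) (Fin (3 + m)) K) (x : Fin 3 → K)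
    (i : Fin 3) : (M *ᵥ extZero K m x) (Fin.castAdd m i) = (alph M *ᵥ x) i := by
  simp [Matrix.mulVec, dotProduct, Fin.sum_univ_add, alph]

theorem mulVec_extZero_natAdd (M : Matrix (Fin (3 + m)) (Fin (3 + m)) K) (x : Fin 3 → K)
    (i : Fin m) : (M *ᵥ extZero K m x) (Fin.natAdd 3 i) = (gam M *ᵥ x) i := by
  simp [Matrix.mulVec, dotProduct, Fin.sum_univ_add, gam]

theorem exists_extZero {v : Fin (3 + m) → K} (hv : v ∈ firstCoordsSubspace K (3 + m) 3) :
    ∃ x, extZero K m x = v := by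
  refine ⟨fun i => v (Fin.castAdd m i), ?_⟩
  ext i
  induction i using Fin.addCases with
  | left i => simp
  | right i => simpa using (hv (Fin.natAdd 3 i) (by simp)).symm

theorem extZero_mem (x : Fin 3 → K) : extZero K m x ∈ firstCoordsSubspace K (3 + m) 3 := by
  intro i hi
  induction i using Fin.addCases with
  | left i => have := i.isLt; simp at hi; omega
  | right i => simp

theorem mem_kalmanSet_iff {s : ℕ} (M : Matrix (Fin (3 + m)) (Fin (3 + m)) K) :
    M ∈ kalmanSet K (3 + m) 3 s ↔ ∃ U : Submodule K (Fin 3 → K),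
      Module.finrank K U = s ∧ ∀ x ∈ U, alph M *ᵥ x ∈ U ∧ gam M *ᵥ x = 0 := by
  constructor
  · rintro ⟨U, hU, hs, hM⟩
    refine ⟨U.comap (extZero K m), ?_, ?_⟩
    · rw [← hs, (Submodule.equivMapOfInjective _ (extZero_injective (m := m)) _).finrank_eq,
        Submodule.map_comap_eq_self]
      intro v hv
      obtain ⟨x, rfl⟩ := exists_extZero (hU hv)
      exact ⟨x, rfl⟩
    · intro x hx
      have h1 := hM _ hx
      have h2 := hU h1
      have h3 : gam M *ᵥ x = 0 := by
        ext i
        rw [← mulVec_extZero_natAdd]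
        exact h2 _ (by simp)
      refine ⟨?_, h3⟩
      have h4 : extZero K m (alph M *ᵥ x) = M *ᵥ extZero K m x := by
        ext i
        induction i using Fin.addCases with
        | left i => simp [mulVec_extZero_castAdd]
        | right i => simp [mulVec_extZero_natAdd, h3]
      simpa [h4] using h1
  · rintro ⟨U, hs, hM⟩
    refine ⟨U.map (extZero K m), ?_, ?_, ?_⟩
    · rintro _ ⟨x, -, rfl⟩
      exact extZero_mem x
    · rw [← hs]
      exact (Submodule.equivMapOfInjective _ (extZero_injective (m := m)) _).finrank_eq.symm
    · rintro _ ⟨x, hx, rfl⟩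
      refine ⟨alph M *ᵥ x, (hM x hx).1, ?_⟩
      ext i
      induction i using Fin.addCases with
      | left i => simp [mulVec_extZero_castAdd]
      | right i => simp [mulVec_extZero_natAdd, (hM x hx).2]

theorem exists_smul_of_cross_eq_zero {v w : Fin 3 → K} (hv : v ≠ 0) (h : v ⨯₃ w = 0) :
    ∃ c : K, w = c • v := by
  by_contra! hc
  refine crossProduct_ne_zero_iff_linearIndependent.2 ?_ h
  exact (LinearIndependent.pair_iff' hv).2 fun a ha => hc a ha.symm

theorem exists_smul_cross {a b r : Fin 3 → K} (hab : a ⨯₃ b ≠ 0) (ha : r ⬝ᵥ a = 0)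
    (hb : r ⬝ᵥ b = 0) : ∃ c : K, r = c • a ⨯₃ b := by
  refine exists_smul_of_cross_eq_zero hab ?_
  rw [cross_cross_eq_smul_sub_smul, dotProduct_comm a r, dotProduct_comm b r, ha, hb]
  simp

theorem exists_cross_eq {v r : Fin 3 → K} (hv : v ≠ 0) (h : r ⬝ᵥ v = 0) :
    ∃ y : Fin 3 → K, v ⨯₃ y = r := by
  obtain ⟨i, hi⟩ := Function.ne_iff.1 hv
  refine ⟨(Pi.single i (-(v i)⁻¹)) ⨯₃ r, ?_⟩
  rw [cross_cross_eq_smul_sub_smul', dotProduct_comm v r, h]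
  have : Pi.single i (-(v i)⁻¹) ⬝ᵥ v = -1 := by
    rw [single_dotProduct, neg_mul, inv_mul_cancel₀ hi]
  rw [this]
  simp

theorem mem_kalmanSet_one_iff (M : Matrix (Fin (3 + m)) (Fin (3 + m)) K) :
    M ∈ kalmanSet K (3 + m) 3 1 ↔ ∃ (v : Fin 3 → K) (l : K), v ≠ 0 ∧
      alph M *ᵥ v = l • v ∧ gam M *ᵥ v = 0 := by
  rw [mem_kalmanSet_iff]
  constructor
  · rintro ⟨U, hU, hM⟩
    obtain ⟨v, hv, hs⟩ := finrank_eq_one_iff'.1 hU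
    obtain ⟨l, hl⟩ := hs ⟨_, (hM v v.2).1⟩
    exact ⟨v, l, by simpa using hv, (congrArg Subtype.val hl).symm, (hM v v.2).2⟩
  · rintro ⟨v, l, hv, h1, h2⟩
    refine ⟨K ∙ v, finrank_span_singleton hv, ?_⟩
    intro x hx
    obtain ⟨c, rfl⟩ := Submodule.mem_span_singleton.1 hx
    rw [mulVec_smul, mulVec_smul, h1, h2, smul_zero, smul_smul]
    exact ⟨Submodule.smul_mem _ _ (Submodule.mem_span_singleton_self v), rfl⟩

theorem mem_kalmanSet_two_iff (M : Matrix (Fin (3 + m)) (Fin (3 + m)) K) :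
    M ∈ kalmanSet K (3 + m) 3 2 ↔ ∃ (w : Fin 3 → K) (l : K) (u : Fin m → K), w ≠ 0 ∧
      w ᵥ* alph M = l • w ∧ gam M = vecMulVec u w := by
  rw [mem_kalmanSet_iff]
  constructor
  · rintro ⟨U, hU, hM⟩
    let b := Module.finBasisOfFinrankEq K U hU
    have hw : (b 0 : Fin 3 → K) ⨯₃ (b 1 : Fin 3 → K) ≠ 0 := by
      rw [crossProduct_ne_zero_iff_linearIndependent]
      have h1 := b.linearIndependent.map' U.subtype (by simp)
      have h2 : ![(b 0 : Fin 3 → K), (b 1 : Fin 3 → K)] = U.subtype ∘ b := by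
        ext i j
        fin_cases i <;> rfl
      rw [h2]
      exact h1
    have hU' : ∀ x ∈ U, (b 0 : Fin 3 → K) ⨯₃ (b 1 : Fin 3 → K) ⬝ᵥ x = 0 := by
      intro x hx
      have h1 := b.sum_repr ⟨x, hx⟩
      have h2 := congrArg Subtype.val h1
      simp only [Fin.sum_univ_two, Submodule.coe_add, Submodule.coe_smul] at h2
      rw [← h2, dotProduct_add, dotProduct_smul, dotProduct_smul, dotProduct_comm,
        dot_self_cross, dotProduct_comm, dot_cross_self]
      simp
    have h3 : ∀ r : Fin 3 → K, (∀ x ∈ U, r ⬝ᵥ x = 0) →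
        ∃ c : K, r = c • (b 0 : Fin 3 → K) ⨯₃ (b 1 : Fin 3 → K) := fun r hr =>
      exists_smul_cross hw (hr _ (b 0).2) (hr _ (b 1).2)
    obtain ⟨l, hl⟩ := h3 (((b 0 : Fin 3 → K) ⨯₃ (b 1 : Fin 3 → K)) ᵥ* alph M) (fun x hx => by
      rw [← dotProduct_mulVec]
      exact hU' _ (hM x hx).1)
    have h4 : ∀ k, ∃ c : K, gam M k = c • (b 0 : Fin 3 → K) ⨯₃ (b 1 : Fin 3 → K) := fun k =>
      h3 _ fun x hx => congrFun (hM x hx).2 k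
    choose u hu using h4
    refine ⟨_, l, u, hw, hl, ?_⟩
    ext k j
    rw [hu]
    rfl
  · rintro ⟨w, l, u, hw, h1, h2⟩
    let φ : Module.Dual K (Fin 3 → K) := 
      { toFun := fun x => w ⬝ᵥ x
        map_add' := fun x y => dotProduct_add _ _ _
        map_smul' := fun c x => dotProduct_smul _ _ _ }
    have hφ : φ ≠ 0 := by
      obtain ⟨i, hi⟩ := Function.ne_iff.1 hw
      intro h0
      apply hi
      have := LinearMap.congr_fun h0 (Pi.single i 1)
      simpa [φ] using this
    refine ⟨LinearMap.ker φ, ?_, ?_⟩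
    · have := Module.Dual.finrank_ker_add_one_of_ne_zero hφ
      simp at this
      omega
    · intro x hx
      have hx' : w ⬝ᵥ x = 0 := hx
      refine ⟨?_, ?_⟩
      · change w ⬝ᵥ (alph M *ᵥ x) = 0
        rw [dotProduct_mulVec, h1, smul_dotProduct, hx', smul_zero]
      · rw [h2, vecMulVec_mulVec, hx']
        simp

theorem mem_kalmanSet_three_iff (M : Matrix (Fin (3 + m)) (Fin (3 + m)) K) :
    M ∈ kalmanSet K (3 + m) 3 3 ↔ gam M = 0 := by
  rw [mem_kalmanSet_iff]
  constructor
  · rintro ⟨U, hU, hM⟩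
    have hU' : U = ⊤ := Submodule.eq_top_of_finrank_eq (by simpa using hU)
    refine Matrix.ext_of_mulVec_single fun i => ?_
    rw [(hM _ (by simp [hU'])).2, zero_mulVec]
  · intro h
    exact ⟨⊤, by simp, fun x _ => ⟨trivial, by rw [h, zero_mulVec]⟩⟩

end Points
end KalmanAux

namespace KalmanAux
open MvPolynomial

section Interface

variable {K : Type*} [Field K]

theorem eq_zero_of_forall_algHom [Infinite K] {σ S : Type*} [CommRing S] [Algebra K S]
    (hS : ∀ x : S, (∀ φ : S →ₐ[K] K, φ x = 0) → x = 0) (x : MvPolynomial σ S)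
    (hx : ∀ φ : MvPolynomial σ S →ₐ[K] K, φ x = 0) : x = 0 := by
  ext ν
  rw [coeff_zero]
  refine hS _ fun φ => ?_
  have h1 : map (φ : S →+* K) x = 0 := by
    refine MvPolynomial.funext fun y => ?_
    have h2 := hx (aevalTower φ y)
    rw [map_zero, ← h2, eval_map]
    rfl
  have := congrArg (coeff ν) h1
  rwa [coeff_map, coeff_zero] at this

/-- Evaluation at a matrix. -/
noncomputable abbrev evM {n : ℕ} (M : Matrix (Fin n) (Fin n) K) : MatCoordRing K n →+* K :=
  eval fun p => M p.1 p.2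

/-- Evaluation at a matrix and a scalar. -/
noncomputable abbrev evMl {n : ℕ} (M : Matrix (Fin n) (Fin n) K) (l : K) :
    Polynomial (MatCoordRing K n) →+* K :=
  Polynomial.eval₂RingHom (evM M) l

theorem exists_interface {n s : ℕ} {S : Type*} [CommRing S] [IsDomain S] [IsIntegrallyClosed S]
    [Algebra K S] (hS : ∀ x : S, (∀ φ : S →ₐ[K] K, φ x = 0) → x = 0)
    (π : MatCoordRing K n →ₐ[K] S) (lam : S) {nz : S} (hnz : nz ≠ 0)
    (Pts : Matrix (Fin n) (Fin n) K → K → Prop)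
    (hmem : ∀ φ : S →ₐ[K] K, φ nz ≠ 0 → Pts (fun i j => φ (π (X (i, j)))) (φ lam))
    (hpt : ∀ M l, Pts M l → ∃ φ : S →ₐ[K] K, (∀ i j, φ (π (X (i, j))) = M i j) ∧ φ lam = l)
    (hset : ∀ M, M ∈ kalmanSet K n 3 s ↔ ∃ l, Pts M l)
    {c₀ c₁ c₂ : MatCoordRing K n}
    (hcubic : ∀ M l, Pts M l → l ^ 3 = evM M c₂ * l ^ 2 + evM M c₁ * l + evM M c₀)
    {f g : MatCoordRing K n} (hg : ∃ M l, Pts M l ∧ evM M g ≠ 0)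
    (hfg : ∀ M l, Pts M l → evM M g * l = evM M f)
    (hT : lam ^ 3 = π c₂ * lam ^ 2 + π c₁ * lam + π c₀ →
      ∀ x a b, π b ≠ 0 → π b * x = π a → ∃ a b c, x = π a + π b * lam + π c * lam ^ 2) :
    ∃ q : (MatCoordRing K n × MatCoordRing K n × MatCoordRing K n) →ₗ[MatCoordRing K n]
        KalmanNormalization K n 3 s,
      Function.Surjective q ∧
      (∀ a b c, q (a, b, c) = 0 ↔
        ∀ M l, Pts M l → evM M a + evM M b * l + evM M c * l ^ 2 = 0) ∧
      (∀ a, q (a, 0, 0) = kalmanNormInclusion K n 3 s (Ideal.Quotient.mk _ a)) ∧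
      ∀ P Q : Polynomial (MatCoordRing K n), (∀ M l, Pts M l → evMl M l P * evMl M l Q = 0) →
        (∃ M l, Pts M l ∧ evMl M l P ≠ 0) → ∀ M l, Pts M l → evMl M l Q = 0 := by
  have hφ : ∀ (φ : S →ₐ[K] K) (P : Polynomial (MatCoordRing K n)),
      φ (Polynomial.eval₂RingHom (π : MatCoordRing K n →+* S) lam P) =
        evMl (fun i j => φ (π (X (i, j)))) (φ lam) P := by
    intro φ P
    have h1 : ((φ : S →+* K).comp (Polynomial.eval₂RingHom (π : MatCoordRing K n →+* S) lam)) =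
        evMl (fun i j => φ (π (X (i, j)))) (φ lam) := by
      refine Polynomial.ringHom_ext' ?_ ?_
      · refine MvPolynomial.ringHom_ext ?_ ?_
        · intro r
          simp [← MvPolynomial.algebraMap_eq]
        · rintro ⟨i, j⟩
          simp
      · simp
    exact RingHom.congr_fun h1 P
  have key : ∀ P : Polynomial (MatCoordRing K n),
      Polynomial.eval₂RingHom (π : MatCoordRing K n →+* S) lam P = 0 ↔
        ∀ M l, Pts M l → evMl M l P = 0 := by
    intro P
    constructor
    · intro h M l hM
      obtain ⟨φ, h1, rfl⟩ := hpt M l hM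
      have h2 : (fun i j => φ (π (X (i, j)))) = M := by ext i j; exact h1 i j
      rw [← h2, ← hφ, h, map_zero]
    · intro h
      refine (mul_eq_zero.1 (hS (nz * _) fun φ => ?_)).resolve_left hnz
      rw [map_mul, hφ]
      by_cases h0 : φ nz = 0
      · rw [h0, zero_mul]
      · rw [h _ _ (hmem φ h0), mul_zero]
  have keyA : ∀ a : MatCoordRing K n, π a = 0 ↔ ∀ M l, Pts M l → evM M a = 0 := by
    intro a
    have := key (Polynomial.C a)
    simpa using this
  have key3 : ∀ a b c : MatCoordRing K n, π a + π b * lam + π c * lam ^ 2 = 0 ↔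
      ∀ M l, Pts M l → evM M a + evM M b * l + evM M c * l ^ 2 = 0 := by
    intro a b c
    have := key (Polynomial.C a + Polynomial.C b * Polynomial.X +
      Polynomial.C c * Polynomial.X ^ 2)
    simpa using this
  have hker : RingHom.ker (π : MatCoordRing K n →+* S) = kalmanIdeal K n 3 s := by
    ext a
    refine (keyA a).trans ?_
    constructor
    · intro h M hM
      obtain ⟨l, hl⟩ := (hset M).1 hM
      exact h M l hl
    · intro h M l hM
      exact h M ((hset M).2 ⟨l, hM⟩)
  have hcub : lam ^ 3 = π c₂ * lam ^ 2 + π c₁ * lam + π c₀ := by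
    have := (key (Polynomial.X ^ 3 - (Polynomial.C c₂ * Polynomial.X ^ 2 +
      Polynomial.C c₁ * Polynomial.X + Polynomial.C c₀))).2 (fun M l hM => by
        simpa [sub_eq_zero] using hcubic M l hM)
    simpa [sub_eq_zero] using this
  have hfg' : π g * lam = π f := by
    have := (key (Polynomial.C g * Polynomial.X - Polynomial.C f)).2 (fun M l hM => by
        simpa [sub_eq_zero] using hfg M l hM)
    simpa [sub_eq_zero] using this
  have hg' : π g ≠ 0 := by
    intro h
    obtain ⟨M, l, h1, h2⟩ := hg
    exact h2 ((keyA g).1 h M l h1)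
  obtain ⟨q, h1, h2, h3⟩ := exists_presentation (π : MatCoordRing K n →+* S) hker lam hcub hg' hfg'
    (hT hcub)
  refine ⟨q, h1, fun a b c => (h2 a b c).trans (key3 a b c), h3, ?_⟩
  intro P Q h hP
  refine (key Q).1 ?_
  have h4 := (key (P * Q)).2 (fun M l hM => by rw [map_mul]; exact h M l hM)
  rw [map_mul] at h4
  refine (mul_eq_zero.1 h4).resolve_left fun h5 => ?_
  obtain ⟨M, l, h6, h7⟩ := hP
  exact h7 ((key P).1 h5 M l h6)

theorem exists_combination_subalgebra {A S : Type*} [CommRing A] [Algebra K A] [CommRing S]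
    [Algebra K S] (π : A →ₐ[K] S) {lam : S} {c₀ c₁ c₂ : A}
    (hcubic : lam ^ 3 = π c₂ * lam ^ 2 + π c₁ * lam + π c₀) :
    ∃ T : Subalgebra K S, ∀ x, x ∈ T ↔ ∃ a b c, x = π a + π b * lam + π c * lam ^ 2 := by
  refine ⟨{ carrier := {x | ∃ a b c, x = π a + π b * lam + π c * lam ^ 2}
            mul_mem' := ?_
            add_mem' := ?_
            algebraMap_mem' := fun r => ⟨algebraMap K A r, 0, 0, by simp⟩ }, fun x => Iff.rfl⟩
  · rintro _ _ ⟨a, b, c, rfl⟩ ⟨a', b', c', rfl⟩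
    refine ⟨a * a' + (b * c' + c * b') * c₀ + c * c' * c₂ * c₀,
      a * b' + b * a' + (b * c' + c * b') * c₁ + c * c' * (c₂ * c₁ + c₀),
      a * c' + b * b' + c * a' + (b * c' + c * b') * c₂ + c * c' * (c₂ ^ 2 + c₁), ?_⟩
    simp only [map_add, map_mul, map_pow]
    linear_combination (π b * π c' + π c * π b' + π c * π c' * lam + π c * π c' * π c₂) * hcubic
  · rintro _ _ ⟨a, b, c, rfl⟩ ⟨a', b', c', rfl⟩
    refine ⟨a + a', b + b', c + c', ?_⟩
    simp only [map_add]
    ring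

/-- The second coefficient of the characteristic polynomial. -/
def e2 {R : Type*} [CommRing R] (α : Matrix (Fin 3) (Fin 3) R) : R :=
  α 0 0 * α 1 1 - α 0 1 * α 1 0 + (α 0 0 * α 2 2 - α 0 2 * α 2 0) +
    (α 1 1 * α 2 2 - α 1 2 * α 2 1)

theorem det_sub_smul {R : Type*} [CommRing R] (α : Matrix (Fin 3) (Fin 3) R) (l : R) :
    (α - l • (1 : Matrix (Fin 3) (Fin 3) R)).det =
      -l ^ 3 + α.trace * l ^ 2 - e2 α * l + α.det := by
  simp [det_fin_three, e2, Matrix.trace, Fin.sum_univ_three]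
  ring

theorem cubic_of_mulVec {α : Matrix (Fin 3) (Fin 3) K} {v : Fin 3 → K} {l : K} (hv : v ≠ 0)
    (h : α *ᵥ v = l • v) : l ^ 3 = α.trace * l ^ 2 + (-e2 α) * l + α.det := by
  have h1 := exists_mulVec_eq_zero_iff.1
    ⟨v, hv, (by rw [sub_mulVec, smul_mulVec, one_mulVec, h, sub_self] :
      (α - l • (1 : Matrix (Fin 3) (Fin 3) K)) *ᵥ v = 0)⟩
  rw [det_sub_smul] at h1
  linear_combination -h1

theorem cubic_of_vecMul {α : Matrix (Fin 3) (Fin 3) K} {v : Fin 3 → K} {l : K} (hv : v ≠ 0)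
    (h : v ᵥ* α = l • v) : l ^ 3 = α.trace * l ^ 2 + (-e2 α) * l + α.det := by
  have h1 := exists_vecMul_eq_zero_iff.1
    ⟨v, hv, (by rw [vecMul_sub, vecMul_smul, vecMul_one, h, sub_self] :
      v ᵥ* (α - l • (1 : Matrix (Fin 3) (Fin 3) K)) = 0)⟩
  rw [det_sub_smul] at h1
  linear_combination -h1

end Interface
end KalmanAux

namespace KalmanAux
open MvPolynomial

section Param

theorem map_cross_apply {R S F : Type*} [CommRing R] [CommRing S] [FunLike F R S]
    [RingHomClass F R S] (φ : F) (a b : Fin 3 → R) (i : Fin 3) :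
    φ ((a ⨯₃ b) i) = ((fun j => φ (a j)) ⨯₃ fun j => φ (b j)) i := by
  fin_cases i <;> simp [cross_apply]

variable (K : Type*) [Field K]

/-- The generic matrix. -/
noncomputable def genM (n : ℕ) : Matrix (Fin n) (Fin n) (MatCoordRing K n) := fun i j => X (i, j)

variable {K} in
theorem evM_alph {m : ℕ} (M : Matrix (Fin (3 + m)) (Fin (3 + m)) K) (i j) :
    evM M (alph (genM K (3 + m)) i j) = alph M i j := by simp [alph, genM]

variable {K} in
theorem evM_gam {m : ℕ} (M : Matrix (Fin (3 + m)) (Fin (3 + m)) K) (i j) :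
    evM M (gam (genM K (3 + m)) i j) = gam M i j := by simp [gam, genM]

variable {K} in
theorem evM_trace {m : ℕ} (M : Matrix (Fin (3 + m)) (Fin (3 + m)) K) :
    evM M (alph (genM K (3 + m))).trace = (alph M).trace := by
  simp only [Matrix.trace, Fin.sum_univ_three, map_add, Matrix.diag, evM_alph]

variable {K} in
theorem evM_det {m : ℕ} (M : Matrix (Fin (3 + m)) (Fin (3 + m)) K) :
    evM M (alph (genM K (3 + m))).det = (alph M).det := by
  simp only [det_fin_three, map_add, map_sub, map_mul, evM_alph]

variable {K} in
theorem evM_e2 {m : ℕ} (M : Matrix (Fin (3 + m)) (Fin (3 + m)) K) :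
    evM M (e2 (alph (genM K (3 + m)))) = e2 (alph M) := by
  simp only [e2, map_add, map_sub, map_mul, evM_alph]

/-- The coefficient ring of the parametrizations. -/
abbrev ParRing (m : ℕ) := MvPolynomial (Option (Fin (3 + m) × Fin m)) K

/-- The eigenvalue. -/
noncomputable def lamP (p q m : ℕ) : BigRing p q (ParRing K m) := C (C (X none))

variable {K}

theorem bigRing_eq_zero [Infinite K] (p q m : ℕ) (x : BigRing p q (ParRing K m))
    (hx : ∀ φ : BigRing p q (ParRing K m) →ₐ[K] K, φ x = 0) : x = 0 := by
  refine eq_zero_of_forall_algHom (fun x hx => ?_) x hx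
  refine eq_zero_of_forall_algHom (fun x hx => ?_) x hx
  refine eq_zero_of_forall_algHom (fun x hx => ?_) x hx
  exact hx (AlgHom.id K K)

theorem exists_bigRing_point (p q m : ℕ) (v : Fin 3 → K) (u : Fin q → K) (y : Fin p → Fin 3 → K)
    (l : K) (fr : Fin (3 + m) × Fin m → K) : ∃ φ : BigRing p q (ParRing K m) →ₐ[K] K,
      (∀ i, φ (vV p q _ i) = v i) ∧ (∀ i, φ (uV p q _ i) = u i) ∧ (∀ j i, φ (X (j, i)) = y j i) ∧
      φ (lamP K p q m) = l ∧ ∀ a, φ (C (C (X (some a)))) = fr a := by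
  refine ⟨aevalTower (aevalTower (aeval (fun a => a.elim l fr)) (Sum.elim v u))
    (fun a => y a.1 a.2), ?_, ?_, ?_, ?_, ?_⟩ <;> intros <;> simp [vV, uV, lamP]

theorem adjoin_gens_le {p q m : ℕ} {π : MatCoordRing K (3 + m) →ₐ[K] BigRing p q (ParRing K m)}
    (hfr : ∀ a : Fin (3 + m) × Fin m, C (C (X (some a))) ∈ π.range)
    (h1 : ∀ i j, uV p q _ i * vV p q _ j ∈ π.range)
    (h2 : ∀ i j, rV p q _ i j ∈ π.range ∨ rV p q _ i j + lamP K p q m ∈ π.range)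
    {T : Subalgebra K (BigRing p q (ParRing K m))} (hT : π.range ≤ T) (hl : lamP K p q m ∈ T)
    {x : BigRing p q (ParRing K m)}
    (hx : x ∈ Algebra.adjoin (ParRing K m) (gens p q (ParRing K m))) : x ∈ T := by
  induction hx using Algebra.adjoin_induction with
  | mem x hx =>
    rcases hx with ⟨⟨i, j⟩, rfl⟩ | ⟨⟨i, j⟩, rfl⟩
    · exact hT (h1 i j)
    · rcases h2 i j with h | h
      · exact hT h
      · simpa using T.sub_mem (hT h) hl
  | algebraMap r =>
    change C (C r) ∈ T
    induction r using MvPolynomial.induction_on with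
    | C a => exact T.algebraMap_mem a
    | add a b ha hb => rw [map_add, map_add]; exact T.add_mem ha hb
    | mul_X a i ha =>
      rw [map_mul, map_mul]
      refine T.mul_mem ha ?_
      cases i with
      | none => exact hl
      | some a => exact hT (hfr a)
  | add x y _ _ hx hy => exact T.add_mem hx hy
  | mul x y _ _ hx hy => exact T.mul_mem hx hy

theorem range_le_adjoin {p q m : ℕ} {π : MatCoordRing K (3 + m) →ₐ[K] BigRing p q (ParRing K m)}
    (h : ∀ i j, π (X (i, j)) ∈ Algebra.adjoin (ParRing K m) (gens p q (ParRing K m))) (a) :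
    π a ∈ Algebra.adjoin (ParRing K m) (gens p q (ParRing K m)) := by
  induction a using MvPolynomial.induction_on with
  | C r =>
    have : π (C r) = algebraMap (ParRing K m) _ (C r) := π.commutes r
    rw [this]
    exact Subalgebra.algebraMap_mem _ _
  | add a b ha hb => rw [map_add]; exact Subalgebra.add_mem _ ha hb
  | mul_X a i ha => rw [map_mul]; exact Subalgebra.mul_mem _ ha (h i.1 i.2)

theorem exists_combination {p q m : ℕ}
    {π : MatCoordRing K (3 + m) →ₐ[K] BigRing p q (ParRing K m)}
    (hfr : ∀ a : Fin (3 + m) × Fin m, C (C (X (some a))) ∈ π.range)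
    (h1 : ∀ i j, uV p q _ i * vV p q _ j ∈ π.range)
    (h2 : ∀ i j, rV p q _ i j ∈ π.range ∨ rV p q _ i j + lamP K p q m ∈ π.range)
    (h : ∀ i j, π (X (i, j)) ∈ Algebra.adjoin (ParRing K m) (gens p q (ParRing K m)))
    {c₀ c₁ c₂ : MatCoordRing K (3 + m)}
    (hcub : lamP K p q m ^ 3 = π c₂ * lamP K p q m ^ 2 + π c₁ * lamP K p q m + π c₀)
    (x a b) (hb : π b ≠ 0) (hx : π b * x = π a) :
    ∃ a b c, x = π a + π b * lamP K p q m + π c * lamP K p q m ^ 2 := by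
  obtain ⟨T, hT⟩ := exists_combination_subalgebra π hcub
  refine (hT x).1 (adjoin_gens_le hfr h1 h2 ?_ ?_ (mem_adjoin_of_mul_mem (range_le_adjoin h b) hb
    (hx ▸ range_le_adjoin h a)))
  · rintro _ ⟨a, rfl⟩
    exact (hT _).2 ⟨a, 0, 0, by simp⟩
  · exact (hT _).2 ⟨0, 1, 0, by simp⟩

end Param

end KalmanAux

namespace KalmanAux
open MvPolynomial

section Param

variable {K : Type*} [Field K]

/-- Pairs of a matrix and an eigenvalue coming from the first Kalman variety. -/
def PtsOne {m : ℕ} (M : Matrix (Fin (3 + m)) (Fin (3 + m)) K) (l : K) : Prop :=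
  ∃ v : Fin 3 → K, v ≠ 0 ∧ alph M *ᵥ v = l • v ∧ gam M *ᵥ v = 0

/-- Pairs of a matrix and a left eigenvalue coming from the second Kalman variety. -/
def PtsTwo {m : ℕ} (M : Matrix (Fin (3 + m)) (Fin (3 + m)) K) (l : K) : Prop :=
  ∃ (w : Fin 3 → K) (u : Fin m → K), w ≠ 0 ∧ w ᵥ* alph M = l • w ∧ gam M = vecMulVec u w

theorem exists_smul_of_orthogonal {r s v : Fin 3 → K} (hv : v ≠ 0) (hr : r ⬝ᵥ v = 0)
    (hs : s ⬝ᵥ v = 0) : ∃ c : K, r ⨯₃ s = c • v := by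
  refine exists_smul_of_cross_eq_zero hv ?_
  rw [cross_cross_eq_smul_sub_smul', dotProduct_comm v s, dotProduct_comm r v,
    dotProduct_comm v r, hr, hs]
  simp

/-- The cross product of the first row of the lower left block with its product with the
upper left block. -/
noncomputable def crossRow (K : Type*) [Field K] {m : ℕ} (k : Fin m) : Fin 3 → MatCoordRing K (3 + m) :=
  (gam (genM K (3 + m)) k) ⨯₃ (gam (genM K (3 + m)) k ᵥ* alph (genM K (3 + m)))

theorem evM_crossRow {m : ℕ} (k : Fin m) (M : Matrix (Fin (3 + m)) (Fin (3 + m)) K) (i : Fin 3) :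
    evM M (crossRow K k i) = ((gam M k) ⨯₃ (gam M k ᵥ* alph M)) i := by
  rw [crossRow, map_cross_apply]
  simp only [evM_gam, vecMul, dotProduct, map_sum, map_mul, evM_alph]
  rfl

theorem exists_blocks {R : Type*} [Zero R] {m : ℕ} (α : Matrix (Fin 3) (Fin 3) R)
    (γ : Matrix (Fin m) (Fin 3) R) : ∃ M : Matrix (Fin (3 + m)) (Fin (3 + m)) R,
      alph M = α ∧ gam M = γ :=
  ⟨mkM α γ 0, alph_mkM _ _ _, gam_mkM _ _ _⟩

/-- The parametrization of the first Kalman variety. -/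
noncomputable def paramOne (K : Type*) [Field K] (m : ℕ) :
    Matrix (Fin (3 + m)) (Fin (3 + m)) (BigRing (3 + m) 0 (ParRing K m)) :=
  mkM (fun i j => rV (3 + m) 0 _ (Fin.castAdd m i) j +
      lamP K (3 + m) 0 m * (1 : Matrix (Fin 3) (Fin 3) _) i j)
    (fun k j => rV (3 + m) 0 _ (Fin.natAdd 3 k) j) fun a => C (C (X (some a)))

theorem interface_one [IsAlgClosed K] {m : ℕ} (hm : 0 < m) :
    ∃ q : (MatCoordRing K (3 + m) × MatCoordRing K (3 + m) × MatCoordRing K (3 + m))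
        →ₗ[MatCoordRing K (3 + m)] KalmanNormalization K (3 + m) 3 1,
      Function.Surjective q ∧
      (∀ a b c, q (a, b, c) = 0 ↔
        ∀ M l, PtsOne M l → evM M a + evM M b * l + evM M c * l ^ 2 = 0) ∧
      (∀ a, q (a, 0, 0) = kalmanNormInclusion K (3 + m) 3 1 (Ideal.Quotient.mk _ a)) := by
  have hK : Infinite K := IsAlgClosed.instInfinite
  let S := BigRing (3 + m) 0 (ParRing K m)
  let π : MatCoordRing K (3 + m) →ₐ[K] S := aeval fun p => paramOne K m p.1 p.2
  have hπ : ∀ i j, π (X (i, j)) = paramOne K m i j := fun i j => aeval_X _ _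
  have hπα : ∀ i j : Fin 3, π (X (Fin.castAdd m i, Fin.castAdd m j)) =
      rV (3 + m) 0 _ (Fin.castAdd m i) j + lamP K (3 + m) 0 m * (1 : Matrix (Fin 3) (Fin 3) S) i j := by
    intro i j
    rw [hπ]
    simp [paramOne, mkM]
  have hπγ : ∀ (i : Fin m) (j : Fin 3), π (X (Fin.natAdd 3 i, Fin.castAdd m j)) =
      rV (3 + m) 0 _ (Fin.natAdd 3 i) j := by
    intro i j
    rw [hπ]
    simp [paramOne, mkM]
  have hπf : ∀ (i : Fin (3 + m)) (j : Fin m), π (X (i, Fin.natAdd 3 j)) = C (C (X (some (i, j)))) := by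
    intro i j
    rw [hπ]
    simp [paramOne, mkM]
  have hφr : ∀ (φ : S →ₐ[K] K) (a : Fin (3 + m)) (j : Fin 3), φ (rV (3 + m) 0 _ a j) =
      ((fun i => φ (vV (3 + m) 0 _ i)) ⨯₃ fun i => φ (X (a, i))) j := fun φ a j =>
    map_cross_apply φ _ _ j
  have key := exists_interface (K := K) (s := 1) (n := 3 + m) (S := S)
    (bigRing_eq_zero (3 + m) 0 m) π (lamP K (3 + m) 0 m) (nz := vV (3 + m) 0 _ 0)
    (C_ne_zero.2 (X_ne_zero _)) PtsOne ?_ ?_ ?_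
    (c₂ := (alph (genM K (3 + m))).trace) (c₁ := -e2 (alph (genM K (3 + m)))) (c₀ := (alph (genM K (3 + m))).det)
    ?_ (g := crossRow K ⟨0, hm⟩ 2) (f := (alph (genM K (3 + m)) *ᵥ crossRow K ⟨0, hm⟩) 2) ?_ ?_ ?_
  · obtain ⟨q, h1, h2, h3, -⟩ := key
    exact ⟨q, h1, h2, h3⟩
  · intro φ hφ
    refine ⟨fun i => φ (vV (3 + m) 0 _ i), fun h => hφ (congrFun h 0), ?_, ?_⟩
    · ext i
      have e1 : alph (fun i j => φ (π (X (i, j)))) i =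
          ((fun i => φ (vV (3 + m) 0 _ i)) ⨯₃ fun j => φ (X (Fin.castAdd m i, j))) +
            φ (lamP K (3 + m) 0 m) • (1 : Matrix (Fin 3) (Fin 3) K) i := by
        ext j
        simp only [alph, hπα, map_add, hφr, map_mul, Pi.add_apply, Pi.smul_apply, smul_eq_mul,
          Matrix.one_apply]
        split <;> simp
      rw [mulVec, e1, add_dotProduct, dotProduct_comm, dot_self_cross, smul_dotProduct,
        ← mulVec, one_mulVec]
      simp
    · ext i
      have e1 : gam (fun i j => φ (π (X (i, j)))) i =
          ((fun i => φ (vV (3 + m) 0 _ i)) ⨯₃ fun j => φ (X (Fin.natAdd 3 i, j))) := by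
        ext j
        simp only [gam, hπγ, hφr]
      rw [mulVec, e1, dotProduct_comm, dot_self_cross]
      rfl
  · rintro M l ⟨v, hv, ha, hc⟩
    have e1 : ∀ i : Fin 3, ∃ y : Fin 3 → K, v ⨯₃ y =
        alph M i - l • (1 : Matrix (Fin 3) (Fin 3) K) i := fun i => by
      refine exists_cross_eq hv ?_
      rw [sub_dotProduct, smul_dotProduct]
      have := congrFun ha i
      have e2 : (1 : Matrix (Fin 3) (Fin 3) K) i ⬝ᵥ v = v i := congrFun (one_mulVec v) i
      rw [e2]
      exact sub_eq_zero.2 this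
    have e2 : ∀ k : Fin m, ∃ y : Fin 3 → K, v ⨯₃ y = gam M k := fun k =>
      exists_cross_eq hv (congrFun hc k)
    choose y hy using e1
    choose y' hy' using e2
    obtain ⟨φ, h1, -, h2, h3, h4⟩ := exists_bigRing_point (3 + m) 0 m v ![] (Fin.addCases y y') l
      (fun a => M a.1 (Fin.natAdd 3 a.2))
    have h1' : (fun i => φ (vV (3 + m) 0 _ i)) = v := funext h1
    refine ⟨φ, ?_, h3⟩
    intro i j
    induction j using Fin.addCases with
    | left j =>
      induction i using Fin.addCases with
      | left i =>
        rw [hπα, map_add, hφr, h1', map_mul, h3]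
        have : (fun j => φ (X (Fin.castAdd m i, j))) = y i := by
          ext j; rw [h2]; simp
        rw [this, hy]
        by_cases hij : i = j <;> simp [Matrix.one_apply, hij, alph]
      | right i =>
        rw [hπγ, hφr, h1']
        have : (fun j => φ (X (Fin.natAdd 3 i, j))) = y' i := by
          ext j; rw [h2]; simp
        rw [this, hy']
        rfl
    | right j => rw [hπf, h4]
  · intro M
    rw [mem_kalmanSet_one_iff, exists_comm]
    simp [PtsOne]
  · rintro M l ⟨v, hv, ha, -⟩
    rw [map_neg, evM_trace, evM_e2, evM_det]
    exact cubic_of_mulVec hv ha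
  · obtain ⟨M, hα, hγ⟩ := exists_blocks (m := m)
      (fun i j => if i = 0 ∧ j = 1 then (1 : K) else 0) (fun k j => if j = 0 then 1 else 0)
    refine ⟨M, 0, ⟨Pi.single 2 1, by simp, ?_, ?_⟩, ?_⟩
    · rw [hα]
      ext i
      simp [mulVec, dotProduct, Fin.sum_univ_three]
    · rw [hγ]
      ext i
      simp [mulVec, dotProduct]
    · rw [evM_crossRow, hα, hγ]
      simp [cross_apply, vecMul, dotProduct]
  · rintro M l ⟨v, hv, ha, hc⟩
    obtain ⟨c, hz⟩ := exists_smul_of_orthogonal (r := gam M ⟨0, hm⟩)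
      (s := gam M ⟨0, hm⟩ ᵥ* alph M) hv (congrFun hc _) (by
        rw [← dotProduct_mulVec, ha, dotProduct_smul]
        have : gam M ⟨0, hm⟩ ⬝ᵥ v = 0 := congrFun hc _
        rw [this, smul_zero])
    rw [mulVec, dotProduct, map_sum]
    simp only [map_mul, evM_alph, evM_crossRow, hz]
    have := congrFun ha 2
    simp only [mulVec, dotProduct, Fin.sum_univ_three, Pi.smul_apply, smul_eq_mul] at this ⊢
    linear_combination -c * this
  · intro hcub x a b hb hx
    refine exists_combination (p := 3 + m) (q := 0) (π := π) ?_ ?_ ?_ ?_ hcub x a b hb hx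
    · rintro ⟨i, j⟩
      exact ⟨_, hπf i j⟩
    · intro i
      exact i.elim0
    · intro i j
      induction i using Fin.addCases with
      | left i =>
        by_cases hij : i = j
        · exact Or.inr ⟨_, (hπα i j).trans (by simp [Matrix.one_apply, hij])⟩
        · exact Or.inl ⟨_, (hπα i j).trans (by simp [hij])⟩
      | right i => exact Or.inl ⟨_, hπγ i j⟩
    · have hr : ∀ i j, rV (3 + m) 0 (ParRing K m) i j ∈
          Algebra.adjoin (ParRing K m) (gens (3 + m) 0 (ParRing K m)) := fun i j =>
        Algebra.subset_adjoin (Or.inr ⟨(i, j), rfl⟩)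
      have hl : ∀ x : ParRing K m, (C (C x) : S) ∈
          Algebra.adjoin (ParRing K m) (gens (3 + m) 0 (ParRing K m)) := fun x =>
        Subalgebra.algebraMap_mem _ x
      intro i j
      induction j using Fin.addCases with
      | left j =>
        induction i using Fin.addCases with
        | left i =>
          rw [hπα]
          refine Subalgebra.add_mem _ (hr _ _) ?_
          by_cases hij : i = j
          · simpa [Matrix.one_apply, hij, lamP] using hl (X none)
          · simp [hij]
        | right i => rw [hπγ]; exact hr _ _
      | right j => rw [hπf]; exact hl _

end Param

end KalmanAux

namespace KalmanAux
open MvPolynomial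

section Param

variable {K : Type*} [Field K]

/-- The parametrization of the second Kalman variety. -/
noncomputable def paramTwo (K : Type*) [Field K] (m : ℕ) :
    Matrix (Fin (3 + m)) (Fin (3 + m)) (BigRing 3 m (ParRing K m)) :=
  mkM (fun i j => rV 3 m _ j i + lamP K 3 m m * (1 : Matrix (Fin 3) (Fin 3) _) i j)
    (fun k j => uV 3 m _ k * vV 3 m _ j) fun a => C (C (X (some a)))

theorem interface_two [IsAlgClosed K] {m : ℕ} (hm : 0 < m) :
    ∃ q : (MatCoordRing K (3 + m) × MatCoordRing K (3 + m) × MatCoordRing K (3 + m))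
        →ₗ[MatCoordRing K (3 + m)] KalmanNormalization K (3 + m) 3 2,
      Function.Surjective q ∧
      (∀ a b c, q (a, b, c) = 0 ↔
        ∀ M l, PtsTwo M l → evM M a + evM M b * l + evM M c * l ^ 2 = 0) ∧
      ∀ P Q : Polynomial (MatCoordRing K (3 + m)),
        (∀ M l, PtsTwo M l → evMl M l P * evMl M l Q = 0) →
        (∃ M l, PtsTwo M l ∧ evMl M l P ≠ 0) → ∀ M l, PtsTwo M l → evMl M l Q = 0 := by
  have hK : Infinite K := IsAlgClosed.instInfinite
  let S := BigRing 3 m (ParRing K m)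
  let π : MatCoordRing K (3 + m) →ₐ[K] S := aeval fun p => paramTwo K m p.1 p.2
  have hπ : ∀ i j, π (X (i, j)) = paramTwo K m i j := fun i j => aeval_X _ _
  have hπα : ∀ i j : Fin 3, π (X (Fin.castAdd m i, Fin.castAdd m j)) =
      rV 3 m _ j i + lamP K 3 m m * (1 : Matrix (Fin 3) (Fin 3) S) i j := by
    intro i j
    rw [hπ]
    simp [paramTwo, mkM]
  have hπγ : ∀ (i : Fin m) (j : Fin 3), π (X (Fin.natAdd 3 i, Fin.castAdd m j)) =
      uV 3 m _ i * vV 3 m _ j := by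
    intro i j
    rw [hπ]
    simp [paramTwo, mkM]
  have hπf : ∀ (i : Fin (3 + m)) (j : Fin m),
      π (X (i, Fin.natAdd 3 j)) = C (C (X (some (i, j)))) := by
    intro i j
    rw [hπ]
    simp [paramTwo, mkM]
  have hφr : ∀ (φ : S →ₐ[K] K) (a : Fin 3) (j : Fin 3), φ (rV 3 m _ a j) =
      ((fun i => φ (vV 3 m _ i)) ⨯₃ fun i => φ (X (a, i))) j := fun φ a j =>
    map_cross_apply φ _ _ j
  have key := exists_interface (K := K) (s := 2) (n := 3 + m) (S := S)
    (bigRing_eq_zero 3 m m) π (lamP K 3 m m) (nz := vV 3 m _ 0)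
    (C_ne_zero.2 (X_ne_zero _)) PtsTwo ?_ ?_ ?_
    (c₂ := (alph (genM K (3 + m))).trace) (c₁ := -e2 (alph (genM K (3 + m))))
    (c₀ := (alph (genM K (3 + m))).det) ?_ (g := gam (genM K (3 + m)) ⟨0, hm⟩ 0)
    (f := (gam (genM K (3 + m)) ⟨0, hm⟩ ᵥ* alph (genM K (3 + m))) 0) ?_ ?_ ?_
  · obtain ⟨q, h1, h2, -, h3⟩ := key
    exact ⟨q, h1, h2, h3⟩
  · intro φ hφ
    refine ⟨fun i => φ (vV 3 m _ i), fun i => φ (uV 3 m _ i), fun h => hφ (congrFun h 0), ?_, ?_⟩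
    · ext j
      have e1 : (fun i => alph (fun i j => φ (π (X (i, j)))) i j) =
          ((fun i => φ (vV 3 m _ i)) ⨯₃ fun i => φ (X (j, i))) +
            φ (lamP K 3 m m) • fun i => (1 : Matrix (Fin 3) (Fin 3) K) i j := by
        ext i
        simp only [alph, hπα, map_add, hφr, map_mul, Pi.add_apply, Pi.smul_apply, smul_eq_mul,
          Matrix.one_apply]
        split <;> simp
      have e2 : (fun i => φ (vV 3 m _ i)) ⬝ᵥ (fun i => (1 : Matrix (Fin 3) (Fin 3) K) i j) =
          φ (vV 3 m _ j) :=
        congrFun (vecMul_one (fun i => φ (vV 3 m _ i))) j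
      rw [vecMul, e1, dotProduct_add, dot_self_cross, dotProduct_smul, e2]
      simp
    · ext i j
      simp only [gam, hπγ, map_mul, vecMulVec_apply]
  · rintro M l ⟨w, u, hw, ha, hc⟩
    have e1 : ∀ j : Fin 3, ∃ y : Fin 3 → K, w ⨯₃ y =
        fun i => alph M i j - l * (1 : Matrix (Fin 3) (Fin 3) K) i j := fun j => by
      refine exists_cross_eq hw ?_
      have e3 := congrFun ha j
      have e2 : w ⬝ᵥ (fun i => (1 : Matrix (Fin 3) (Fin 3) K) i j) = w j :=
        congrFun (vecMul_one w) j
      simp only [vecMul, dotProduct, Pi.smul_apply, smul_eq_mul] at e2 e3 ⊢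
      simp only [sub_mul, Finset.sum_sub_distrib]
      rw [← sub_eq_zero.2 e3]
      congr 1
      · exact Finset.sum_congr rfl fun i _ => mul_comm _ _
      · rw [← e2, Finset.mul_sum]
        exact Finset.sum_congr rfl fun i _ => by ring
    choose y hy using e1
    obtain ⟨φ, h1, h1u, h2, h3, h4⟩ := exists_bigRing_point 3 m m w u y l
      (fun a => M a.1 (Fin.natAdd 3 a.2))
    have h1' : (fun i => φ (vV 3 m _ i)) = w := funext h1
    refine ⟨φ, ?_, h3⟩
    intro i j
    induction j using Fin.addCases with
    | left j =>
      induction i using Fin.addCases with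
      | left i =>
        rw [hπα, map_add, hφr, h1', map_mul, h3]
        have : (fun i => φ (X (j, i))) = y j := funext (h2 j)
        rw [this, hy]
        by_cases hij : i = j <;> simp [Matrix.one_apply, hij, alph]
      | right i =>
        rw [hπγ, map_mul, h1, h1u]
        exact (congrFun (congrFun hc i) j).symm
    | right j => rw [hπf, h4]
  · intro M
    rw [mem_kalmanSet_two_iff, exists_comm]
    simp [PtsTwo]
  · rintro M l ⟨v, u, hv, ha, -⟩
    rw [map_neg, evM_trace, evM_e2, evM_det]
    exact cubic_of_vecMul hv ha
  · obtain ⟨M, hα, hγ⟩ := exists_blocks (m := m) (0 : Matrix (Fin 3) (Fin 3) K)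
      (vecMulVec (fun _ => 1) (Pi.single 0 1))
    refine ⟨M, 0, ⟨Pi.single 0 1, fun _ => 1, by simp, ?_, hγ⟩, ?_⟩
    · rw [hα]
      simp
    · rw [evM_gam, hγ]
      simp [vecMulVec_apply]
  · rintro M l ⟨w, u, hw, ha, hc⟩
    have h1 := congrFun ha 0
    simp only [vecMul, dotProduct, Fin.sum_univ_three, map_add, map_mul, evM_gam, evM_alph, hc,
      vecMulVec_apply, Pi.smul_apply, smul_eq_mul] at h1 ⊢
    linear_combination -u ⟨0, hm⟩ * h1
  · intro hcub x a b hb hx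
    refine exists_combination (p := 3) (q := m) (π := π) ?_ ?_ ?_ ?_ hcub x a b hb hx
    · rintro ⟨i, j⟩
      exact ⟨_, hπf i j⟩
    · intro i j
      exact ⟨_, hπγ i j⟩
    · intro i j
      by_cases hij : j = i
      · exact Or.inr ⟨_, (hπα j i).trans (by simp [Matrix.one_apply, hij])⟩
      · exact Or.inl ⟨_, (hπα j i).trans (by simp [hij])⟩
    · have hr : ∀ i j, rV 3 m (ParRing K m) i j ∈
          Algebra.adjoin (ParRing K m) (gens 3 m (ParRing K m)) := fun i j =>
        Algebra.subset_adjoin (Or.inr ⟨(i, j), rfl⟩)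
      have hl : ∀ x : ParRing K m, (C (C x) : S) ∈
          Algebra.adjoin (ParRing K m) (gens 3 m (ParRing K m)) := fun x =>
        Subalgebra.algebraMap_mem _ x
      intro i j
      induction j using Fin.addCases with
      | left j =>
        induction i using Fin.addCases with
        | left i =>
          rw [hπα]
          refine Subalgebra.add_mem _ (hr _ _) ?_
          by_cases hij : i = j
          · simpa [Matrix.one_apply, hij, lamP] using hl (X none)
          · simp [hij]
        | right i => rw [hπγ]; exact Algebra.subset_adjoin (Or.inl ⟨(i, j), rfl⟩)
      | right j => rw [hπf]; exact hl _

end Param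

end KalmanAux

namespace KalmanAux
open MvPolynomial

section Relations

variable {K : Type*} [Field K]

theorem exists_mulVec_eq_smul {α : Matrix (Fin 3) (Fin 3) K} {l : K}
    (h : l ^ 3 = α.trace * l ^ 2 + (-e2 α) * l + α.det) :
    ∃ v : Fin 3 → K, v ≠ 0 ∧ α *ᵥ v = l • v := by
  obtain ⟨v, hv, h1⟩ := exists_mulVec_eq_zero_iff.2
    (show (α - l • (1 : Matrix (Fin 3) (Fin 3) K)).det = 0 by
      rw [det_sub_smul]; linear_combination -h)
  rw [sub_mulVec, smul_mulVec, one_mulVec, sub_eq_zero] at h1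
  exact ⟨v, hv, h1⟩

theorem exists_vecMul_eq_smul {α : Matrix (Fin 3) (Fin 3) K} {l : K}
    (h : l ^ 3 = α.trace * l ^ 2 + (-e2 α) * l + α.det) :
    ∃ v : Fin 3 → K, v ≠ 0 ∧ v ᵥ* α = l • v := by
  obtain ⟨v, hv, h1⟩ := exists_vecMul_eq_zero_iff.2
    (show (α - l • (1 : Matrix (Fin 3) (Fin 3) K)).det = 0 by
      rw [det_sub_smul]; linear_combination -h)
  rw [vecMul_sub, vecMul_smul, vecMul_one, sub_eq_zero] at h1
  exact ⟨v, hv, h1⟩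

theorem exists_quadratic_root [IsAlgClosed K] (p q : K) : ∃ x : K, x ^ 2 - p * x + q = 0 := by
  obtain ⟨x, hx⟩ := IsAlgClosed.exists_root
    (Polynomial.C 1 * Polynomial.X ^ 2 + Polynomial.C (-p) * Polynomial.X + Polynomial.C q)
    (by rw [Polynomial.degree_quadratic one_ne_zero]; norm_num)
  refine ⟨x, ?_⟩
  simp only [Polynomial.IsRoot, Polynomial.eval_add, Polynomial.eval_mul, Polynomial.eval_C,
    Polynomial.eval_pow, Polynomial.eval_X] at hx
  linear_combination hx

theorem PtsTwo.ptsOne {m : ℕ} {M : Matrix (Fin (3 + m)) (Fin (3 + m)) K} {mu l : K}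
    (h : PtsTwo M mu) (hl : l ^ 2 - ((alph M).trace - mu) * l +
      (e2 (alph M) - mu * (alph M).trace + mu ^ 2) = 0) (hne : l ≠ mu) : PtsOne M l := by
  obtain ⟨w, u, hw, ha, hc⟩ := h
  have h1 := cubic_of_vecMul hw ha
  obtain ⟨v, hv, h2⟩ := exists_mulVec_eq_smul (α := alph M) (l := l)
    (by linear_combination (l - mu) * hl + h1)
  refine ⟨v, hv, h2, ?_⟩
  have h3 : w ⬝ᵥ v = 0 := by
    have h4 : w ⬝ᵥ (alph M *ᵥ v) = (w ᵥ* alph M) ⬝ᵥ v := dotProduct_mulVec _ _ _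
    rw [h2, ha, dotProduct_smul, smul_dotProduct, smul_eq_mul, smul_eq_mul] at h4
    have h5 : (l - mu) * (w ⬝ᵥ v) = 0 := by linear_combination h4
    exact (mul_eq_zero.1 h5).resolve_left (sub_ne_zero.2 hne)
  rw [hc, vecMulVec_mulVec, h3]
  simp

theorem exists_distinct [Infinite K] : ∃ x : K, x ≠ 0 ∧ x ≠ 1 := by
  classical
  obtain ⟨x, hx⟩ := Infinite.exists_notMem_finset ({0, 1} : Finset K)
  simp at hx
  exact ⟨x, hx⟩

theorem relation_two_of_one [IsAlgClosed K] {m : ℕ} {a b c : MatCoordRing K (3 + m)}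
    (hdom : ∀ P Q : Polynomial (MatCoordRing K (3 + m)),
        (∀ M l, PtsTwo M l → evMl M l P * evMl M l Q = 0) →
        (∃ M l, PtsTwo M l ∧ evMl M l P ≠ 0) → ∀ M l, PtsTwo M l → evMl M l Q = 0)
    (h : ∀ M l, PtsOne M l → evM M a + evM M b * l + evM M c * l ^ 2 = 0)
    (M : Matrix (Fin (3 + m)) (Fin (3 + m)) K) (l : K) (hM : PtsTwo M l) :
    evM M b + evM M c * ((alph M).trace - l) = 0 := by
  have hK : Infinite K := IsAlgClosed.instInfinite
  have key := hdom
    (((Polynomial.C (alph (genM K (3 + m))).trace - Polynomial.X) ^ 2 - 4 *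
      (Polynomial.C (e2 (alph (genM K (3 + m)))) - Polynomial.X *
        Polynomial.C (alph (genM K (3 + m))).trace + Polynomial.X ^ 2)) *
      (3 * Polynomial.X ^ 2 - 2 * Polynomial.C (alph (genM K (3 + m))).trace * Polynomial.X +
        Polynomial.C (e2 (alph (genM K (3 + m))))))
    (Polynomial.C b + Polynomial.C c * (Polynomial.C (alph (genM K (3 + m))).trace -
      Polynomial.X)) ?_ ?_ M l hM
  · simpa [evM_trace] using key
  · intro M mu hM
    simp only [map_mul, map_sub, map_add, map_pow, map_ofNat, Polynomial.coe_eval₂RingHom,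
      Polynomial.eval₂_C, Polynomial.eval₂_X, evM_trace, evM_e2]
    by_cases hX : 3 * mu ^ 2 - 2 * (alph M).trace * mu + e2 (alph M) = 0
    · rw [hX]; ring
    obtain ⟨l, hl⟩ := exists_quadratic_root ((alph M).trace - mu)
      (e2 (alph M) - mu * (alph M).trace + mu ^ 2)
    have h1 := h M l (hM.ptsOne hl (by
      rintro rfl
      exact hX (by linear_combination hl)))
    have hl' : ((alph M).trace - mu - l) ^ 2 - ((alph M).trace - mu) * ((alph M).trace - mu - l) +
      (e2 (alph M) - mu * (alph M).trace + mu ^ 2) = 0 := by linear_combination hl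
    have h2 := h M _ (hM.ptsOne hl' (by
      intro h0
      rw [h0] at hl'
      exact hX (by linear_combination hl')))
    linear_combination (3 * mu ^ 2 - 2 * (alph M).trace * mu + e2 (alph M)) *
      ((2 * l - ((alph M).trace - mu)) * (h1 - h2) - 4 *
      (evM M b + evM M c * ((alph M).trace - mu)) * hl)
  · obtain ⟨x, hx0, hx1⟩ := exists_distinct (K := K)
    obtain ⟨M, hα, hγ⟩ := exists_blocks (m := m) (diagonal ![0, 1, x]) 0
    refine ⟨M, x, ⟨Pi.single 2 1, 0, by simp, ?_, ?_⟩, ?_⟩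
    · rw [hα]
      ext i
      fin_cases i <;> simp [vecMul_diagonal]
    · rw [hγ]
      ext i j
      simp [vecMulVec_apply]
    · have ht : (alph M).trace = 1 + x := by simp [hα, Matrix.trace, Fin.sum_univ_three]
      have he : e2 (alph M) = x := by simp [hα, e2]
      simp only [map_mul, map_sub, map_add, map_pow, map_ofNat, Polynomial.coe_eval₂RingHom,
        Polynomial.eval₂_C, Polynomial.eval₂_X, evM_trace, evM_e2, ht, he]
      intro h0
      exact mul_ne_zero hx0 (sub_ne_zero.2 hx1) (by linear_combination h0)

theorem exists_mem_kalman_three_nodup {m : ℕ} [Infinite K] :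
    ∃ N : Matrix (Fin (3 + m)) (Fin (3 + m)) K, gam N = 0 ∧
      (Cubic.mk 1 (-(alph N).trace) (e2 (alph N)) (-(alph N).det)).discr ≠ 0 := by
  obtain ⟨x, hx0, hx1⟩ := exists_distinct (K := K)
  obtain ⟨M, hα, hγ⟩ := exists_blocks (m := m) (diagonal ![0, 1, x]) 0
  refine ⟨M, hγ, ?_⟩
  have ht : (alph M).trace = 1 + x := by simp [hα, Matrix.trace, Fin.sum_univ_three]
  have he : e2 (alph M) = x := by simp [hα, e2]
  have hd : (alph M).det = 0 := by simp [hα, Fin.prod_univ_three]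
  rw [ht, he, hd, Cubic.discr]
  intro h0
  exact mul_ne_zero (pow_ne_zero 2 hx0) (pow_ne_zero 2 (sub_ne_zero.2 hx1))
    (by linear_combination h0)

theorem eq_zero_of_three {a b c x y z : K} (hxy : x ≠ y) (hxz : x ≠ z) (hyz : y ≠ z)
    (hx : a + b * x + c * x ^ 2 = 0) (hy : a + b * y + c * y ^ 2 = 0)
    (hz : a + b * z + c * z ^ 2 = 0) : a = 0 ∧ b = 0 ∧ c = 0 := by
  have h1 : b + c * (x + y) = 0 :=
    (mul_eq_zero.1 (by linear_combination hx - hy : (x - y) * (b + c * (x + y)) = 0)).resolve_left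
      (sub_ne_zero.2 hxy)
  have h2 : b + c * (x + z) = 0 :=
    (mul_eq_zero.1 (by linear_combination hx - hz : (x - z) * (b + c * (x + z)) = 0)).resolve_left
      (sub_ne_zero.2 hxz)
  have hc : c = 0 :=
    (mul_eq_zero.1 (by linear_combination h1 - h2 : (y - z) * c = 0)).resolve_left
      (sub_ne_zero.2 hyz)
  subst hc
  have hb : b = 0 := by linear_combination h1
  subst hb
  exact ⟨by linear_combination hx, rfl, rfl⟩

theorem eq_zero_of_discr_ne_zero [IsAlgClosed K] {m : ℕ} {a b c : MatCoordRing K (3 + m)}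
    (h : ∀ M l, PtsTwo M l → evM M a + evM M b * l + evM M c * l ^ 2 = 0)
    {M : Matrix (Fin (3 + m)) (Fin (3 + m)) K} (hM : gam M = 0)
    (hd : (Cubic.mk 1 (-(alph M).trace) (e2 (alph M)) (-(alph M).det)).discr ≠ 0) :
    evM M a = 0 ∧ evM M b = 0 ∧ evM M c = 0 := by
  set P : Cubic K := Cubic.mk 1 (-(alph M).trace) (e2 (alph M)) (-(alph M).det) with hP
  have ha : P.a ≠ 0 := one_ne_zero
  have h3 : (P.toPoly.map (RingHom.id K)).Splits := IsAlgClosed.splits _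
  obtain ⟨x, y, z, hr⟩ := (Cubic.splits_iff_roots_eq_three ha).1 h3
  have hnd := (Cubic.discr_ne_zero_iff_roots_ne ha hr).1 hd
  have hroot : ∀ t, t ∈ (Cubic.map (RingHom.id K) P).roots →
      evM M a + evM M b * t + evM M c * t ^ 2 = 0 := by
    intro t ht
    rw [Cubic.mem_roots_iff (Cubic.ne_zero_of_a_ne_zero (by simpa [Cubic.map] using ha))] at ht
    obtain ⟨w, hw, h1⟩ := exists_vecMul_eq_smul (α := alph M) (l := t) (by
      simp [Cubic.map, hP] at ht
      linear_combination ht)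
    refine h M t ⟨w, 0, hw, h1, ?_⟩
    rw [hM]
    ext i j
    simp [vecMulVec_apply]
  exact eq_zero_of_three hnd.1 hnd.2.1 hnd.2.2 (hroot x (by simp [hr])) (hroot y (by simp [hr]))
    (hroot z (by simp [hr]))

theorem eval_line {m : ℕ} (M N : Matrix (Fin (3 + m)) (Fin (3 + m)) K) (t : K)
    (a : MatCoordRing K (3 + m)) :
    Polynomial.eval t (aeval (fun p => Polynomial.C (M p.1 p.2) +
      Polynomial.X * Polynomial.C (N p.1 p.2 - M p.1 p.2)) a) = evM (M + t • (N - M)) a := by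
  induction a using MvPolynomial.induction_on with
  | C r => simp
  | add a b ha hb => rw [map_add, Polynomial.eval_add, ha, hb, map_add]
  | mul_X a i ha => rw [map_mul, Polynomial.eval_mul, ha, map_mul]; simp

theorem vanish_three_of_discr [IsAlgClosed K] {m : ℕ} {a : MatCoordRing K (3 + m)}
    (h : ∀ M : Matrix (Fin (3 + m)) (Fin (3 + m)) K, gam M = 0 →
      (Cubic.mk 1 (-(alph M).trace) (e2 (alph M)) (-(alph M).det)).discr ≠ 0 → evM M a = 0)
    (M : Matrix (Fin (3 + m)) (Fin (3 + m)) K) (hM : gam M = 0) : evM M a = 0 := by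
  have hK : Infinite K := IsAlgClosed.instInfinite
  obtain ⟨N, hN, hd⟩ := exists_mem_kalman_three_nodup (K := K) (m := m)
  let L : MatCoordRing K (3 + m) →ₐ[K] Polynomial K := aeval (fun p => Polynomial.C (M p.1 p.2) +
      Polynomial.X * Polynomial.C (N p.1 p.2 - M p.1 p.2))
  let d : MatCoordRing K (3 + m) := (Cubic.mk 1 (-(alph (genM K (3 + m))).trace)
    (e2 (alph (genM K (3 + m)))) (-(alph (genM K (3 + m))).det)).discr
  have hdM : ∀ M : Matrix (Fin (3 + m)) (Fin (3 + m)) K, evM M d =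
      (Cubic.mk 1 (-(alph M).trace) (e2 (alph M)) (-(alph M).det)).discr := by
    intro M
    simp only [d, Cubic.discr, map_sub, map_add, map_mul, map_pow, map_neg, map_one, evM_trace,
      evM_e2, evM_det, map_ofNat]
  have h1 : L d * L a = 0 := by
    refine Polynomial.funext fun t => ?_
    rw [Polynomial.eval_mul, eval_line, eval_line, Polynomial.eval_zero]
    have hg : gam (M + t • (N - M)) = 0 := by
      ext i j
      have e1 : M (Fin.natAdd 3 i) (Fin.castAdd m j) = 0 := congrFun (congrFun hM i) j
      have e2 : N (Fin.natAdd 3 i) (Fin.castAdd m j) = 0 := congrFun (congrFun hN i) j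
      simp [gam, e1, e2]
    by_cases h0 : evM (M + t • (N - M)) d = 0
    · rw [h0, zero_mul]
    · rw [h _ hg (by rwa [← hdM]), mul_zero]
  have h2 : L d ≠ 0 := by
    intro h0
    have := eval_line M N 1 d
    rw [show aeval _ d = (0 : Polynomial K) from h0, one_smul, add_sub_cancel, hdM] at this
    exact hd (by simpa using this.symm)
  have h3 := (mul_eq_zero.1 h1).resolve_left h2
  have := eval_line M N 0 a
  rw [show aeval _ a = (0 : Polynomial K) from h3] at this
  simpa using this.symm

theorem vanish_three_of_relation_two [IsAlgClosed K] {m : ℕ} {a b c : MatCoordRing K (3 + m)}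
    (h : ∀ M l, PtsTwo M l → evM M a + evM M b * l + evM M c * l ^ 2 = 0)
    (M : Matrix (Fin (3 + m)) (Fin (3 + m)) K) (hM : gam M = 0) : evM M c = 0 :=
  vanish_three_of_discr (fun _ hN hd => (eq_zero_of_discr_ne_zero h hN hd).2.2) M hM

theorem exists_sum_gam_of_vanish [Infinite K] {m : ℕ} {c : MatCoordRing K (3 + m)}
    (h : ∀ M : Matrix (Fin (3 + m)) (Fin (3 + m)) K, gam M = 0 → evM M c = 0) :
    ∃ e : Fin m → Fin 3 → MatCoordRing K (3 + m),
      c = ∑ i, ∑ j, e i j * gam (genM K (3 + m)) i j := by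
  let I : Ideal (MatCoordRing K (3 + m)) :=
    Ideal.span (Set.range fun p : Fin m × Fin 3 => gam (genM K (3 + m)) p.1 p.2)
  let σ : MatCoordRing K (3 + m) →ₐ[K] MatCoordRing K (3 + m) :=
    aeval fun p => mkM (alph (genM K (3 + m))) 0 (fun a => X (a.1, Fin.natAdd 3 a.2)) p.1 p.2
  have h1 : ∀ a, a - σ a ∈ I := by
    intro a
    induction a using MvPolynomial.induction_on with
    | C r => simp [σ]
    | add a b ha hb => rw [map_add, add_sub_add_comm]; exact I.add_mem ha hb
    | mul_X a i ha =>
      have h2 : X i - σ (X i) ∈ I := by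
        obtain ⟨i, j⟩ := i
        simp only [σ, aeval_X]
        induction j using Fin.addCases with
        | left j =>
          induction i using Fin.addCases with
          | left i => simp [mkM, alph, genM]
          | right i =>
            simp [mkM]
            exact Ideal.subset_span ⟨(i, j), rfl⟩
        | right j => simp [mkM]
      rw [map_mul, show a * X i - σ a * σ (X i) = (a - σ a) * X i + σ a * (X i - σ (X i)) by ring]
      exact I.add_mem (I.mul_mem_right _ ha) (I.mul_mem_left _ h2)
  have h2 : σ c = 0 := by
    refine MvPolynomial.funext fun y => ?_
    rw [map_zero]
    have h3 : eval y (σ c) = evM (mkM (fun i j => y (Fin.castAdd m i, Fin.castAdd m j)) 0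
        (fun a => y (a.1, Fin.natAdd 3 a.2))) c := by
      have h4 : (eval y).comp (σ : MatCoordRing K (3 + m) →+* MatCoordRing K (3 + m)) =
          evM (mkM (fun i j => y (Fin.castAdd m i, Fin.castAdd m j)) 0
            (fun a => y (a.1, Fin.natAdd 3 a.2))) := by
        refine MvPolynomial.ringHom_ext (fun r => by simp [σ]) ?_
        rintro ⟨i, j⟩
        simp only [σ, RingHom.comp_apply, RingHom.coe_coe, aeval_X, eval_X]
        refine (mkM_map (fun x => eval y x) _ _ _ _ _).trans ?_
        congr 1
        · ext i j; simp [alph, genM]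
        · ext i; simp
      exact RingHom.congr_fun h4 c
    rw [h3]
    exact h _ (gam_mkM _ _ _)
  have h3 : c ∈ I := by simpa [h2] using h1 c
  obtain ⟨e, he⟩ := (Submodule.mem_span_range_iff_exists_fun _).1 h3
  refine ⟨fun i j => e (i, j), ?_⟩
  rw [← he, Fintype.sum_prod_type]
  rfl

end Relations
end KalmanAux

namespace KalmanAux
open MvPolynomial

section Colon

variable {S σ : Type*} [CommRing S]

/-- The product of `w` and the matrix of the variables `X (a i j)`. -/
noncomputable def imgRow (w : Fin 3 → S) (a : Fin 3 → Fin 3 → σ) (j : Fin 3) : MvPolynomial σ S :=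
  C (w 0) * X (a 0 j) + C (w 1) * X (a 1 j) + C (w 2) * X (a 2 j)

theorem exists_syzygy [IsDomain S] {x y : S} (hx : x ≠ 0)
    (reg : ∀ a b, y * a = x * b → x ∣ a) {i j : σ} (hij : i ≠ j) {z₀ z₁ q₀ q₁ q₂ : MvPolynomial σ S}
    (hz : ∀ f : σ → MvPolynomial σ S, (∀ l, l ≠ i → l ≠ j → f l = X l) →
      aeval (R := S) f (C x * z₁ - C y * z₀) = C x * z₁ - C y * z₀)
    (hne : C x * z₁ - C y * z₀ ≠ 0)
    (h : q₀ * (C y * (C x * X i + C y * X j)) - q₁ * (C x * (C x * X i + C y * X j)) +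
      q₂ * (C x * z₁ - C y * z₀) = 0) :
    ∃ s t, q₀ = t * z₀ + s * C x ∧ q₁ = t * z₁ + s * C y ∧ q₂ = t * (C x * X i + C y * X j) := by
  classical
  have hCx : (C x : MvPolynomial σ S) ≠ 0 := C_ne_zero.2 hx
  have h1 : (C x * X i - C (-y) * X j : MvPolynomial σ S) ∣ q₂ := by
    refine line_dvd hx (fun a b hab => reg a (-b) (by linear_combination -hab)) hij.symm ?_
    generalize C x * z₁ - C y * z₀ = D at h hne hz
    have h2 := congrArg (aeval (R := S) (S₁ := MvPolynomial σ S)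
      (fun l => if l = i then C (-y) * X j else if l = j then C x * X j else X l)) h
    simp only [map_add, map_sub, map_mul] at h2
    rw [hz _ (fun l h1 h2 => by simp [h1, h2])] at h2
    simp only [aeval_X, if_true, hij.symm, if_false, algHom_C, algebraMap_eq, map_zero] at h2
    refine (mul_eq_zero.1 ?_).resolve_right hne
    rw [← h2]
    simp only [map_neg]
    ring
  obtain ⟨t, ht⟩ := h1
  have h3 : (C x * X i - C (-y) * X j : MvPolynomial σ S) = C x * X i + C y * X j := by
    simp only [map_neg]; ring
  rw [h3] at ht
  have hl : (C x * X i + C y * X j : MvPolynomial σ S) ≠ 0 := by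
    intro h0
    have h4 := congrArg (aeval (R := S) (S₁ := S) (fun l => if l = i then 1 else 0)) h0
    simp [hij.symm] at h4
    exact hx h4
  have h5 : C y * (q₀ - t * z₀) = C x * (q₁ - t * z₁) := by
    refine mul_left_cancel₀ hl ?_
    rw [ht] at h
    linear_combination h
  have h6 : C x ∣ q₀ - t * z₀ := by
    rw [C_dvd_iff]
    intro ν
    have h7 := congrArg (coeff ν) h5
    rw [coeff_C_mul, coeff_C_mul] at h7
    exact reg _ _ h7
  obtain ⟨s, hs⟩ := h6
  refine ⟨s, t, by linear_combination hs, ?_, by rw [ht]; ring⟩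
  have h8 : q₁ - t * z₁ = C y * s := by
    refine mul_left_cancel₀ hCx ?_
    rw [← h5, hs]; ring
  linear_combination h8

theorem exists_of_C_mul [IsDomain S] {w : Fin 3 → S} (hw : ∀ i, w i ≠ 0)
    (reg : ∀ a b, w 1 * a = w 0 * b → w 0 ∣ a) (ε : S →+* S) (h0 : ε (w 0) = w 0)
    (h1 : ε (w 1) = w 1) (h2 : ε (w 2) = 0) (hε : ∀ s, w 2 ∣ s - ε s)
    {a : Fin 3 → Fin 3 → σ} (ha : ∀ i j k l, a i j = a k l → i = k ∧ j = l)
    {x : MvPolynomial σ S} {q : Fin 3 → MvPolynomial σ S}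
    (h : C (w 2) * x = q ⬝ᵥ ((fun i => C (w i)) ⨯₃ imgRow w a)) :
    ∃ q' : Fin 3 → MvPolynomial σ S, x = q' ⬝ᵥ ((fun i => C (w i)) ⨯₃ imgRow w a) := by
  classical
  have hne : ∀ i j k l, (i ≠ k ∨ j ≠ l) → a i j ≠ a k l := by
    intro i j k l hh he
    obtain ⟨h1, h2⟩ := ha i j k l he
    rcases hh with hh | hh
    · exact hh h1
    · exact hh h2
  have hq : ∀ i, ∃ r, q i = map ε (q i) + C (w 2) * r := by
    intro i
    have hd : C (w 2) ∣ q i - map ε (q i) := by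
      rw [C_dvd_iff]
      intro ν
      rw [coeff_sub, coeff_map]
      exact hε _
    obtain ⟨r, hr⟩ := hd
    exact ⟨r, by linear_combination hr⟩
  choose r hr using hq
  have hb := congrArg (map ε) h
  simp only [cross_apply, vec3_dotProduct, imgRow, map_mul, map_add, map_sub, map_C, map_X, h0, h1,
    h2, map_zero, zero_mul, cons_val_zero, cons_val_one, cons_val, add_zero, sub_zero] at hb
  obtain ⟨s, t, e0, e1, e2⟩ := exists_syzygy (x := w 0) (y := w 1) (hw 0) reg
    (i := a 0 2) (j := a 1 2) (hne _ _ _ _ (by decide))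
    (z₀ := C (w 0) * X (a 0 0) + C (w 1) * X (a 1 0))
    (z₁ := C (w 0) * X (a 0 1) + C (w 1) * X (a 1 1))
    (q₀ := map ε (q 0)) (q₁ := map ε (q 1)) (q₂ := map ε (q 2))
    (by
      intro f hf
      simp only [map_add, map_sub (aeval _), map_mul, aeval_X, algHom_C, algebraMap_eq]
      rw [hf _ (hne 0 0 0 2 (by decide)) (hne 0 0 1 2 (by decide)),
        hf _ (hne 0 1 0 2 (by decide)) (hne 0 1 1 2 (by decide)),
        hf _ (hne 1 0 0 2 (by decide)) (hne 1 0 1 2 (by decide)),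
        hf _ (hne 1 1 0 2 (by decide)) (hne 1 1 1 2 (by decide))])
    (by
      intro hh
      have h4 := congrArg (aeval (R := S) (S₁ := S) (fun l => if l = a 0 1 then 1 else 0)) hh
      simp [hne 0 0 0 1 (by decide), hne 1 0 0 1 (by decide), hne 1 1 0 1 (by decide), hw 0] at h4)
    (by linear_combination -hb)
  have hw2 : (C (w 2) : MvPolynomial σ S) ≠ 0 := C_ne_zero.2 (hw 2)
  refine ⟨![r 0 - t * X (a 2 0), r 1 - t * X (a 2 1), r 2 - t * X (a 2 2) - s], ?_⟩
  refine mul_left_cancel₀ hw2 ?_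
  rw [h]
  simp only [cross_apply, vec3_dotProduct, imgRow, cons_val_zero, cons_val_one, cons_val]
  rw [hr 0, hr 1, hr 2, e0, e1, e2]
  ring

end Colon
end KalmanAux

namespace KalmanAux
open MvPolynomial

section Vanish

variable (K : Type*) [Field K] (m : ℕ)

/-- Polynomials in the coordinates of a column `u` and of a row `w`. -/
abbrev RowRing := MvPolynomial (Fin m ⊕ Fin 3) K

/-- The coordinates of the row `w`. -/
noncomputable def wRow (i : Fin 3) : RowRing K m := X (Sum.inr i)

variable {m} in
/-- The position of an entry of the upper left block. -/
def pos (i j : Fin 3) : Fin (3 + m) × Fin (3 + m) := (Fin.castAdd m i, Fin.castAdd m j)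

/-- The substitution of `u wᵀ` for the lower left block of the generic matrix. -/
noncomputable def rankOne : MatCoordRing K (3 + m) →ₐ[K]
    MvPolynomial (Fin (3 + m) × Fin (3 + m)) (RowRing K m) :=
  aeval fun p => mkM (fun i j => X (pos i j)) (fun k j => C (X (Sum.inl k) * wRow K m j))
    (fun a => X (a.1, Fin.natAdd 3 a.2)) p.1 p.2

/-- The relations expressing that `w` is a left eigenvector of the upper left block. -/
noncomputable def eigRel : Fin 3 → MvPolynomial (Fin (3 + m) × Fin (3 + m)) (RowRing K m) :=
  (fun i => C (wRow K m i)) ⨯₃ imgRow (wRow K m) pos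

variable {K m}

theorem pos_inj (i j k l : Fin 3) (h : pos (m := m) i j = pos k l) : i = k ∧ j = l := by
  simpa [pos, Fin.ext_iff] using h

theorem algHom_rankOne (φ : MvPolynomial (Fin (3 + m) × Fin (3 + m)) (RowRing K m) →ₐ[K] K)
    (b : MatCoordRing K (3 + m)) : φ (rankOne K m b) =
      evM (mkM (fun i j => φ (X (pos i j))) (vecMulVec (fun k => φ (C (X (Sum.inl k))))
        (fun j => φ (C (wRow K m j)))) (fun a => φ (X (a.1, Fin.natAdd 3 a.2)))) b := by
  have h : (φ.comp (rankOne K m) : MatCoordRing K (3 + m) →+* K) = evM (mkM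
      (fun i j => φ (X (pos i j))) (vecMulVec (fun k => φ (C (X (Sum.inl k))))
        (fun j => φ (C (wRow K m j)))) (fun a => φ (X (a.1, Fin.natAdd 3 a.2)))) := by
    refine MvPolynomial.ringHom_ext (fun r => ?_) ?_
    · simp only [RingHom.coe_coe, algHom_C, eval_C]
      rfl
    · rintro ⟨i, j⟩
      simp only [RingHom.coe_coe, AlgHom.comp_apply, rankOne, aeval_X, eval_X]
      refine (mkM_map φ _ _ _ _ _).trans ?_
      congr 1
      funext k j
      simp [vecMulVec]
  exact RingHom.congr_fun h b

theorem algHom_eigRel (φ : MvPolynomial (Fin (3 + m) × Fin (3 + m)) (RowRing K m) →ₐ[K] K)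
    (i : Fin 3) : φ (eigRel K m i) = ((fun j => φ (C (wRow K m j))) ⨯₃
      ((fun j => φ (C (wRow K m j))) ᵥ* fun i j => φ (X (pos i j)))) i := by
  rw [eigRel, map_cross_apply]
  refine congrFun (congrArg (crossProduct _) (funext fun j => ?_)) i
  simp [imgRow, vecMul, dotProduct, Fin.sum_univ_three]

/-- Modulo the relations, the entries `X (pos 2 0)` and `X (pos 2 1)` can be eliminated
after multiplication by a power of `w 2`. -/
theorem exists_eliminated (x : MvPolynomial (Fin (3 + m) × Fin (3 + m)) (RowRing K m)) :
    ∃ (N : ℕ) (y : MvPolynomial (Fin (3 + m) × Fin (3 + m)) (RowRing K m)),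
      C (wRow K m 2 ^ N) * x - y ∈ Ideal.span (Set.range (eigRel K m)) ∧
      ∀ φ φ' : MvPolynomial (Fin (3 + m) × Fin (3 + m)) (RowRing K m) →ₐ[K] K,
        (∀ s, φ (C s) = φ' (C s)) →
        (∀ p, p ≠ pos 2 0 → p ≠ pos 2 1 → φ (X p) = φ' (X p)) → φ y = φ' y := by
  set I := Ideal.span (Set.range (eigRel K m)) with hI
  have hmem : ∀ i, eigRel K m i ∈ I := fun i => Ideal.subset_span ⟨i, rfl⟩
  have hm0 := hmem 0
  have hm1 := hmem 1
  simp only [eigRel, cross_apply, imgRow, cons_val_zero, cons_val_one] at hm0 hm1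
  have hne : ∀ i j k l : Fin 3, (i ≠ k ∨ j ≠ l) → pos (m := m) i j ≠ pos k l := by
    intro i j k l hh he
    obtain ⟨h1, h2⟩ := pos_inj i j k l he
    rcases hh with hh | hh
    · exact hh h1
    · exact hh h2
  have hX : ∀ p, ∃ y : MvPolynomial (Fin (3 + m) × Fin (3 + m)) (RowRing K m),
      C (wRow K m 2 ^ 2) * X p - y ∈ I ∧
      ∀ φ φ' : MvPolynomial (Fin (3 + m) × Fin (3 + m)) (RowRing K m) →ₐ[K] K,
        (∀ s, φ (C s) = φ' (C s)) →
        (∀ p, p ≠ pos 2 0 → p ≠ pos 2 1 → φ (X p) = φ' (X p)) → φ y = φ' y := by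
    intro p
    by_cases h0 : p = pos 2 0
    · refine ⟨C (wRow K m 0) * imgRow (wRow K m) pos 2 - C (wRow K m 2) *
        (C (wRow K m 0) * X (pos 0 0) + C (wRow K m 1) * X (pos 1 0)), ?_, ?_⟩
      · rw [h0]
        convert hm1 using 1
        simp only [imgRow, map_pow]
        ring
      · intro φ φ' hs hp
        simp only [imgRow, map_sub, map_mul, map_add, hs]
        rw [hp (pos 0 0) (hne _ _ _ _ (by decide)) (hne _ _ _ _ (by decide)),
          hp (pos 1 0) (hne _ _ _ _ (by decide)) (hne _ _ _ _ (by decide)),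
          hp (pos 0 2) (hne _ _ _ _ (by decide)) (hne _ _ _ _ (by decide)),
          hp (pos 1 2) (hne _ _ _ _ (by decide)) (hne _ _ _ _ (by decide)),
          hp (pos 2 2) (hne _ _ _ _ (by decide)) (hne _ _ _ _ (by decide))]
    · by_cases h1 : p = pos 2 1
      · refine ⟨C (wRow K m 1) * imgRow (wRow K m) pos 2 - C (wRow K m 2) *
          (C (wRow K m 0) * X (pos 0 1) + C (wRow K m 1) * X (pos 1 1)), ?_, ?_⟩
        · rw [h1]
          convert I.neg_mem hm0 using 1
          simp only [imgRow, map_pow]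
          ring
        · intro φ φ' hs hp
          simp only [imgRow, map_sub, map_mul, map_add, hs]
          rw [hp (pos 0 1) (hne _ _ _ _ (by decide)) (hne _ _ _ _ (by decide)),
            hp (pos 1 1) (hne _ _ _ _ (by decide)) (hne _ _ _ _ (by decide)),
            hp (pos 0 2) (hne _ _ _ _ (by decide)) (hne _ _ _ _ (by decide)),
            hp (pos 1 2) (hne _ _ _ _ (by decide)) (hne _ _ _ _ (by decide)),
            hp (pos 2 2) (hne _ _ _ _ (by decide)) (hne _ _ _ _ (by decide))]
      · refine ⟨C (wRow K m 2 ^ 2) * X p, by simp, ?_⟩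
        intro φ φ' hs hp
        rw [map_mul, map_mul, hs, hp p h0 h1]
  induction x using MvPolynomial.induction_on with
  | C s => exact ⟨0, C s, by simp, fun φ φ' hs _ => hs s⟩
  | add x x' hx hx' =>
    obtain ⟨N, y, h1, h2⟩ := hx
    obtain ⟨N', y', h1', h2'⟩ := hx'
    refine ⟨N + N', C (wRow K m 2 ^ N') * y + C (wRow K m 2 ^ N) * y', ?_, ?_⟩
    · convert I.add_mem (I.mul_mem_left (C (wRow K m 2 ^ N')) h1)
        (I.mul_mem_left (C (wRow K m 2 ^ N)) h1') using 1
      simp only [map_pow]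
      ring
    · intro φ φ' hs hp
      rw [map_add, map_mul, map_mul, map_add, map_mul, map_mul, hs, hs, h2 φ φ' hs hp,
        h2' φ φ' hs hp]
  | mul_X x p hx =>
    obtain ⟨N, y, h1, h2⟩ := hx
    obtain ⟨y', h1', h2'⟩ := hX p
    refine ⟨N + 2, y * y', ?_, ?_⟩
    · convert I.add_mem (I.mul_mem_left (C (wRow K m 2 ^ 2) * X p) h1)
        (I.mul_mem_left y h1') using 1
      simp only [map_pow]
      ring
    · intro φ φ' hs hp
      rw [map_mul, map_mul, h2 φ φ' hs hp, h2' φ φ' hs hp]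

theorem rankOne_mem [Infinite K] {b : MatCoordRing K (3 + m)}
    (hb : ∀ M l, PtsTwo M l → evM M b = 0) :
    ∃ q : Fin 3 → MvPolynomial (Fin (3 + m) × Fin (3 + m)) (RowRing K m),
      rankOne K m b = q ⬝ᵥ eigRel K m := by
  obtain ⟨N, y, h1, h2⟩ := exists_eliminated (rankOne K m b)
  have hw2 : (C (wRow K m 2) : MvPolynomial (Fin (3 + m) × Fin (3 + m)) (RowRing K m)) ≠ 0 :=
    C_ne_zero.2 (X_ne_zero _)
  have hy : y = 0 := by
    refine (mul_eq_zero.1 (?_ : C (wRow K m 2) * y = 0)).resolve_left hw2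
    refine eq_zero_of_forall_algHom (fun x hx => eq_zero_of_forall_algHom
      (fun x hx => hx (AlgHom.id K K)) x hx) _ fun φ => ?_
    rw [map_mul]
    by_cases hφ : φ (C (wRow K m 2)) = 0
    · rw [hφ, zero_mul]
    refine mul_eq_zero_of_right _ ?_
    set w : Fin 3 → K := fun j => φ (C (wRow K m j)) with hw
    have hw2' : w 2 ≠ 0 := hφ
    set α : Fin 3 → Fin 3 → K := fun i j => φ (X (pos i j)) with hα
    set z : K := w 0 * α 0 2 + w 1 * α 1 2 + w 2 * α 2 2 with hz
    let φS : RowRing K m →ₐ[K] K := φ.comp (IsScalarTower.toAlgHom K (RowRing K m) _)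
    let φ' : MvPolynomial (Fin (3 + m) × Fin (3 + m)) (RowRing K m) →ₐ[K] K :=
      aevalTower φS fun p =>
        if p = pos 2 0 then (w 0 * z / w 2 - w 0 * α 0 0 - w 1 * α 1 0) / w 2
        else if p = pos 2 1 then (w 1 * z / w 2 - w 0 * α 0 1 - w 1 * α 1 1) / w 2
        else φ (X p)
    have hC : ∀ s, φ (C s) = φ' (C s) := fun s => by simp [φ', φS, algebraMap_eq]
    have hX : ∀ p, p ≠ pos 2 0 → p ≠ pos 2 1 → φ (X p) = φ' (X p) := fun p h h' => by
      simp [φ', h, h']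
    have hX0 : φ' (X (pos 2 0)) = (w 0 * z / w 2 - w 0 * α 0 0 - w 1 * α 1 0) / w 2 := by
      simp [φ']
    have hX1 : φ' (X (pos 2 1)) = (w 1 * z / w 2 - w 0 * α 0 1 - w 1 * α 1 1) / w 2 := by
      simp [φ', pos]
    have hα' : ∀ i j, (i ≠ 2 ∨ (j ≠ 0 ∧ j ≠ 1)) → φ' (X (pos i j)) = α i j := by
      intro i j hij
      refine (hX _ (fun h => ?_) (fun h => ?_)).symm
      · obtain ⟨e, e'⟩ := pos_inj _ _ _ _ h
        rcases hij with hij | hij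
        · exact hij e
        · exact hij.1 e'
      · obtain ⟨e, e'⟩ := pos_inj _ _ _ _ h
        rcases hij with hij | hij
        · exact hij e
        · exact hij.2 e'
    rw [h2 φ φ' hC hX]
    have heig : w ᵥ* (fun i j => φ' (X (pos i j)) : Matrix (Fin 3) (Fin 3) K) = (z / w 2) • w := by
      ext j
      simp only [vecMul, dotProduct, Fin.sum_univ_three, Pi.smul_apply, smul_eq_mul]
      fin_cases j
      · simp only [Fin.zero_eta, hX0, hα' 0 0 (by decide), hα' 1 0 (by decide)]
        field_simp
        ring
      · simp only [Fin.mk_one, hX1, hα' 0 1 (by decide), hα' 1 1 (by decide)]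
        field_simp
        ring
      · simp only [Fin.reduceFinMk, hα' 0 2 (by decide), hα' 1 2 (by decide), hα' 2 2 (by decide)]
        field_simp
        rw [hz]
    have hrel : ∀ i, φ' (eigRel K m i) = 0 := by
      intro i
      have e : (fun j => φ' (C (wRow K m j))) = w := by
        ext j; exact (hC _).symm
      rw [algHom_eigRel, e, heig, map_smul, cross_self, smul_zero, Pi.zero_apply]
    have h3 : φ' (rankOne K m b) = 0 := by
      rw [algHom_rankOne]
      refine hb _ (z / w 2) ⟨w, fun k => φ' (C (X (Sum.inl k))), ?_, ?_, ?_⟩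
      · intro h0
        exact hw2' (congrFun h0 2)
      · exact (congrArg _ (alph_mkM _ _ _)).trans heig
      · refine (gam_mkM _ _ _).trans ?_
        congr 1
        funext j; exact (hC _).symm
    have h4 : φ' (C (wRow K m 2 ^ N) * rankOne K m b - y) = 0 := by
      have h5 : Ideal.span (Set.range (eigRel K m)) ≤ RingHom.ker φ' := by
        rw [Ideal.span_le]
        rintro _ ⟨i, rfl⟩
        exact hrel i
      exact h5 h1
    rw [map_sub, map_mul, h3, mul_zero, zero_sub, neg_eq_zero] at h4
    exact h4
  rw [hy, sub_zero] at h1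
  have h3 : ∀ x : MvPolynomial (Fin (3 + m) × Fin (3 + m)) (RowRing K m),
      (∃ q : Fin 3 → _, C (wRow K m 2) * x = q ⬝ᵥ eigRel K m) → ∃ q : Fin 3 → _, x = q ⬝ᵥ eigRel K m := by
    rintro x ⟨q, hq⟩
    refine exists_of_C_mul (w := wRow K m) (fun i => X_ne_zero _) ?_
      (aeval (fun l => if l = Sum.inr 2 then 0 else X l) : RowRing K m →ₐ[K] RowRing K m).toRingHom
      (by simp [wRow]) (by simp [wRow]) (by simp [wRow]) ?_ pos_inj hq
    · intro a b hab
      have h5 : wRow K m 0 ∣ wRow K m 1 * a := ⟨b, hab⟩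
      refine ((X_prime (R := K) (i := (Sum.inr 0 : Fin m ⊕ Fin 3))).dvd_or_dvd h5).resolve_left ?_
      rw [wRow, X_dvd_X]
      simp
    · intro s
      change _ ∣ s - aeval _ s
      induction s using MvPolynomial.induction_on with
      | C r => simp
      | add s s' h h' =>
        rw [map_add, add_sub_add_comm]; exact dvd_add h h'
      | mul_X s i h =>
        rw [map_mul, aeval_X]
        split_ifs with hi
        · rw [hi, mul_zero, sub_zero]; exact dvd_mul_left _ _
        · rw [← sub_mul]; exact h.mul_right _
  have h4 : ∃ q : Fin 3 → _, C (wRow K m 2 ^ N) * rankOne K m b = q ⬝ᵥ eigRel K m := by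
    obtain ⟨q, hq⟩ := (Submodule.mem_span_range_iff_exists_fun _).1 h1
    exact ⟨q, hq.symm⟩
  clear h1
  induction N with
  | zero => simpa using h4
  | succ N ih =>
    refine ih (h3 _ ?_)
    obtain ⟨q, hq⟩ := h4
    exact ⟨q, by rw [← hq, pow_succ, map_mul]; ring⟩

end Vanish
end KalmanAux

namespace KalmanAux
open MvPolynomial

section Polarize

variable {B κ ι : Type*} [CommRing B]

/-- The product of the entries of `g` along two lists of the same length. -/
def pairProd (g : κ → ι → B) : List κ → List ι → B
  | [], [] => 1
  | k :: s, i :: t => g k i * pairProd g s t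
  | [], _ :: _ => 0
  | _ :: _, [] => 0

theorem pairProd_flip (g : κ → ι → B) (s : List κ) (t : List ι) :
    pairProd g s t = pairProd (fun i k => g k i) t s := by
  induction s generalizing t with
  | nil => cases t <;> rfl
  | cons k s ih =>
    cases t with
    | nil => rfl
    | cons i t => simp only [pairProd, ih]

theorem pairProd_perm_right {g : κ → ι → B} (hg : ∀ k l i j, g k i * g l j = g k j * g l i)
    {t t' : List ι} (h : t.Perm t') (s : List κ) : pairProd g s t = pairProd g s t' := by
  induction h generalizing s with
  | nil => rfl
  | cons i _ ih => cases s <;> simp only [pairProd, ih]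
  | swap i j t =>
    rcases s with _ | ⟨k, _ | ⟨l, s⟩⟩
    · rfl
    · simp only [pairProd, mul_zero]
    · simp only [pairProd, ← mul_assoc, hg k l j i]
  | trans _ _ ih ih' => rw [ih, ih']

theorem pairProd_perm {g : κ → ι → B} (hg : ∀ k l i j, g k i * g l j = g k j * g l i)
    {s s' : List κ} {t t' : List ι} (hs : s.Perm s') (ht : t.Perm t') :
    pairProd g s t = pairProd g s' t' := by
  rw [pairProd_perm_right hg ht, pairProd_flip, pairProd_flip g,
    pairProd_perm_right (fun i j k l => by rw [mul_comm, hg, mul_comm, mul_comm, hg, mul_comm]) hs]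

theorem pairProd_eq_zero {g : κ → ι → B} {s : List κ} {t : List ι} (h : s.length ≠ t.length) :
    pairProd g s t = 0 := by
  induction s generalizing t with
  | nil => cases t with
    | nil => simp at h
    | cons => rfl
  | cons k s ih => cases t with
    | nil => rfl
    | cons i t => rw [pairProd, ih (by simpa using h), mul_zero]

/-- The first part of an exponent, as a multiset. -/
noncomputable def leftPart (ν : κ ⊕ ι →₀ ℕ) : Multiset κ :=
  Finsupp.toMultiset (ν.comapDomain Sum.inl Sum.inl_injective.injOn)

/-- The second part of an exponent, as a multiset. -/
noncomputable def rightPart (ν : κ ⊕ ι →₀ ℕ) : Multiset ι :=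
  Finsupp.toMultiset (ν.comapDomain Sum.inr Sum.inr_injective.injOn)

theorem leftPart_add_inl (ν : κ ⊕ ι →₀ ℕ) (k : κ) :
    leftPart (ν + Finsupp.single (Sum.inl k) 1) = k ::ₘ leftPart ν := by
  rw [leftPart, leftPart, Finsupp.comapDomain_add_of_injective Sum.inl_injective,
    Finsupp.comapDomain_single, map_add, Finsupp.toMultiset_single, one_smul, add_comm,
    Multiset.singleton_add]

theorem leftPart_add_inr (ν : κ ⊕ ι →₀ ℕ) (i : ι) :
    leftPart (ν + Finsupp.single (Sum.inr i) 1) = leftPart ν := by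
  rw [leftPart, leftPart]
  congr 1
  ext k
  simp

theorem rightPart_add_inr (ν : κ ⊕ ι →₀ ℕ) (i : ι) :
    rightPart (ν + Finsupp.single (Sum.inr i) 1) = i ::ₘ rightPart ν := by
  rw [rightPart, rightPart, Finsupp.comapDomain_add_of_injective Sum.inr_injective,
    Finsupp.comapDomain_single, map_add, Finsupp.toMultiset_single, one_smul, add_comm,
    Multiset.singleton_add]

theorem rightPart_add_inl (ν : κ ⊕ ι →₀ ℕ) (k : κ) :
    rightPart (ν + Finsupp.single (Sum.inl k) 1) = rightPart ν := by
  rw [rightPart, rightPart]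
  congr 1
  ext k
  simp

theorem exists_eq_add_of_leftPart {ν : κ ⊕ ι →₀ ℕ} (h : Multiset.card (leftPart ν) ≠ 0) :
    ∃ μ k, ν = μ + Finsupp.single (Sum.inl k) 1 := by
  classical
  obtain ⟨k, hk⟩ := Multiset.card_pos_iff_exists_mem.1 (Nat.pos_of_ne_zero h)
  rw [leftPart, Finsupp.mem_toMultiset, Finsupp.mem_support_iff, Finsupp.comapDomain_apply] at hk
  refine ⟨ν - Finsupp.single (Sum.inl k) 1, k, (tsub_add_cancel_of_le ?_).symm⟩
  rw [Finsupp.single_le_iff]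
  omega

/-- The linear form sending a monomial in `u` and `w` to the corresponding product of entries
of `g`. -/
noncomputable def polarize (g : κ → ι → B) : MvPolynomial (κ ⊕ ι) B →ₗ[B] B :=
  (basisMonomials (κ ⊕ ι) B).constr B
    fun ν => pairProd g (leftPart ν).toList (rightPart ν).toList

theorem polarize_monomial (g : κ → ι → B) (ν : κ ⊕ ι →₀ ℕ) (c : B) :
    polarize g (monomial ν c) = c * pairProd g (leftPart ν).toList (rightPart ν).toList := by
  have h := (basisMonomials (κ ⊕ ι) B).constr_basis B
    (fun ν => pairProd g (leftPart ν).toList (rightPart ν).toList) ν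
  rw [coe_basisMonomials] at h
  rw [← mul_one c, ← smul_eq_mul, ← smul_monomial, map_smul, polarize, h, smul_eq_mul, smul_eq_mul,
    mul_one]

theorem polarize_monomial_eq_zero (g : κ → ι → B) {ν : κ ⊕ ι →₀ ℕ} (c : B)
    (h : Multiset.card (leftPart ν) ≠ Multiset.card (rightPart ν)) :
    polarize g (monomial ν c) = 0 := by
  rw [polarize_monomial, pairProd_eq_zero (by simpa using h), mul_zero]

theorem polarize_one (g : κ → ι → B) : polarize g 1 = 1 := by
  rw [← C_1, ← monomial_zero', polarize_monomial]
  simp [leftPart, rightPart, pairProd]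

theorem mul_monomial_inl (k : κ) (ν : κ ⊕ ι →₀ ℕ) (c : B) :
    (X (Sum.inl k) * monomial ν c : MvPolynomial (κ ⊕ ι) B) =
      monomial (ν + Finsupp.single (Sum.inl k) 1) c := by
  rw [X, monomial_mul, one_mul, add_comm]

theorem mul_monomial_inr (i : ι) (ν : κ ⊕ ι →₀ ℕ) (c : B) :
    (X (Sum.inr i) * monomial ν c : MvPolynomial (κ ⊕ ι) B) =
      monomial (ν + Finsupp.single (Sum.inr i) 1) c := by
  rw [X, monomial_mul, one_mul, add_comm]

theorem polarize_mul {g : κ → ι → B} (hg : ∀ k l i j, g k i * g l j = g k j * g l i) (k : κ)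
    (i : ι) (x : MvPolynomial (κ ⊕ ι) B) :
    polarize g (X (Sum.inl k) * X (Sum.inr i) * x) = g k i * polarize g x := by
  induction x using MvPolynomial.induction_on' with
  | monomial ν c =>
    rw [mul_assoc, mul_monomial_inr, mul_monomial_inl, polarize_monomial, polarize_monomial,
      leftPart_add_inl, leftPart_add_inr, rightPart_add_inl, rightPart_add_inr]
    have h : pairProd g (k ::ₘ leftPart ν).toList (i ::ₘ rightPart ν).toList =
        pairProd g (k :: (leftPart ν).toList) (i :: (rightPart ν).toList) := by
      refine pairProd_perm hg ?_ ?_ <;> rw [← Multiset.coe_eq_coe] <;> simp [← Multiset.cons_coe]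
    rw [h, pairProd]
    ring
  | add p q hp hq => rw [mul_add, map_add, hp, hq, map_add, mul_add]

theorem polarize_quadratic {g : κ → ι → B} [Fintype ι]
    (hg : ∀ k l i j, g k i * g l j = g k j * g l i) {T : ι → ι → B}
    (hT : ∀ k l, ∑ i, ∑ j, T i j * (g k i * g l j) = 0) (x : MvPolynomial (κ ⊕ ι) B) :
    polarize g ((∑ i, ∑ j, C (T i j) * (X (Sum.inr i) * X (Sum.inr j))) * x) = 0 := by
  simp only [Finset.sum_mul, map_sum, ← smul_eq_C_mul, smul_mul_assoc, map_smul, smul_eq_mul,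
    mul_assoc]
  induction x using MvPolynomial.induction_on' with
  | monomial ν c =>
    by_cases h : Multiset.card (leftPart ν) = Multiset.card (rightPart ν) + 2
    · obtain ⟨ν, k, rfl⟩ := exists_eq_add_of_leftPart (ν := ν) (by omega)
      rw [leftPart_add_inl, rightPart_add_inl, Multiset.card_cons] at h
      obtain ⟨ν, l, rfl⟩ := exists_eq_add_of_leftPart (ν := ν) (by omega)
      rw [← mul_monomial_inl, ← mul_monomial_inl]
      calc _ = ∑ i, ∑ j, T i j * (g k i * g l j) * polarize g (monomial ν c) := by
            refine Finset.sum_congr rfl fun i _ => Finset.sum_congr rfl fun j _ => ?_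
            rw [mul_assoc, mul_assoc, ← polarize_mul hg, ← polarize_mul hg]
            congr 2
            ring
        _ = 0 := by simp only [← Finset.sum_mul, hT, zero_mul]
    · refine Finset.sum_eq_zero fun i _ => Finset.sum_eq_zero fun j _ => ?_
      rw [mul_monomial_inr, mul_monomial_inr, polarize_monomial_eq_zero, mul_zero]
      rw [leftPart_add_inr, leftPart_add_inr, rightPart_add_inr, rightPart_add_inr,
        Multiset.card_cons, Multiset.card_cons]
      exact h
  | add p q hp hq =>
    simp only [mul_add, map_add, Finset.sum_add_distrib, hp, hq]
    simp

end Polarize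
end KalmanAux

namespace KalmanAux
open MvPolynomial

section Eigenvalue

variable (K : Type*) [Field K] (m : ℕ)

/-- The polynomials whose product with the eigenvalue of a right eigenvector is polynomial. -/
def eigIdeal : Ideal (MatCoordRing K (3 + m)) where
  carrier := {b | ∃ a, ∀ M l, PtsOne M l → l * evM M b = evM M a}
  add_mem' := by
    rintro b b' ⟨a, ha⟩ ⟨a', ha'⟩
    exact ⟨a + a', fun M l h => by rw [map_add, map_add, mul_add, ha M l h, ha' M l h]⟩
  zero_mem' := ⟨0, fun M l _ => by simp⟩
  smul_mem' := by
    rintro c b ⟨a, ha⟩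
    refine ⟨c * a, fun M l h => ?_⟩
    rw [smul_eq_mul, map_mul, map_mul, ← ha M l h]
    ring

variable {K m}

theorem cross_mem_eigIdeal {r s : Fin 3 → MatCoordRing K (3 + m)}
    (hr : ∀ (M : Matrix (Fin (3 + m)) (Fin (3 + m)) K) (l : K) v, alph M *ᵥ v = l • v →
      gam M *ᵥ v = 0 → (fun i => evM M (r i)) ⬝ᵥ v = 0)
    (hs : ∀ (M : Matrix (Fin (3 + m)) (Fin (3 + m)) K) (l : K) v, alph M *ᵥ v = l • v →
      gam M *ᵥ v = 0 → (fun i => evM M (s i)) ⬝ᵥ v = 0) (q : Fin 3) :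
    (r ⨯₃ s) q ∈ eigIdeal K m := by
  refine ⟨(alph (genM K (3 + m)) *ᵥ (r ⨯₃ s)) q, ?_⟩
  rintro M l ⟨v, hv, ha, hc⟩
  obtain ⟨c, h⟩ := exists_smul_of_orthogonal hv (hr M l v ha hc) (hs M l v ha hc)
  have h1 : ∀ j, evM M ((r ⨯₃ s) j) = c * v j := fun j => by
    rw [map_cross_apply, h, Pi.smul_apply, smul_eq_mul]
  have h2 := congrFun ha q
  simp only [mulVec, dotProduct, Fin.sum_univ_three, Pi.smul_apply, smul_eq_mul] at h2
  simp only [mulVec, dotProduct, Fin.sum_univ_three, map_add, map_mul, evM_alph, h1]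
  linear_combination -c * h2

theorem gam_cross_mem_eigIdeal (k l : Fin m) (q : Fin 3) :
    (gam (genM K (3 + m)) k ⨯₃ gam (genM K (3 + m)) l) q ∈ eigIdeal K m := by
  refine cross_mem_eigIdeal ?_ ?_ q
  · intro M l v _ hc
    simp only [evM_gam]
    exact congrFun hc k
  · intro M _ v _ hc
    simp only [evM_gam]
    exact congrFun hc l

theorem gam_cross_vecMul_mem_eigIdeal (k l : Fin m) (q : Fin 3) :
    (gam (genM K (3 + m)) k ⨯₃ (gam (genM K (3 + m)) l ᵥ* alph (genM K (3 + m)))) q ∈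
      eigIdeal K m := by
  refine cross_mem_eigIdeal ?_ ?_ q
  · intro M l v _ hc
    simp only [evM_gam]
    exact congrFun hc k
  · intro M c v ha hc
    have h1 : (fun i => evM M ((gam (genM K (3 + m)) l ᵥ* alph (genM K (3 + m))) i)) =
        gam M l ᵥ* alph M := by
      ext i
      simp only [vecMul, dotProduct, Fin.sum_univ_three, map_add, map_mul, evM_alph, evM_gam]
    rw [h1, ← dotProduct_mulVec, ha, dotProduct_smul]
    exact smul_eq_zero_of_right _ (congrFun hc l)

variable (K m) in
/-- The class of an entry of the lower left block modulo `eigIdeal`. -/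
noncomputable def gamBar (k : Fin m) (i : Fin 3) : MatCoordRing K (3 + m) ⧸ eigIdeal K m :=
  Ideal.Quotient.mk _ (gam (genM K (3 + m)) k i)

theorem gamBar_cross (k l : Fin m) (q : Fin 3) : (gamBar K m k ⨯₃ gamBar K m l) q = 0 := by
  rw [← Ideal.Quotient.eq_zero_iff_mem.2 (gam_cross_mem_eigIdeal (K := K) k l q), map_cross_apply]
  rfl

theorem gamBar_comm (k l : Fin m) (i j : Fin 3) :
    gamBar K m k i * gamBar K m l j = gamBar K m k j * gamBar K m l i := by
  have h0 := gamBar_cross (K := K) k l 0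
  have h1 := gamBar_cross (K := K) k l 1
  have h2 := gamBar_cross (K := K) k l 2
  simp only [cross_apply, cons_val_zero, cons_val_one, cons_val] at h0 h1 h2
  fin_cases i <;> fin_cases j <;>
    simp only [Fin.zero_eta, Fin.mk_one, Fin.reduceFinMk]
  · linear_combination h2
  · linear_combination -h1
  · linear_combination -h2
  · linear_combination h0
  · linear_combination h1
  · linear_combination -h0

variable (K m) in
/-- The reduction of the matrix entries modulo `eigIdeal`. -/
noncomputable def reduceEntries :
    MvPolynomial (Fin (3 + m) × Fin (3 + m)) (RowRing K m) →+*
      MvPolynomial (Fin m ⊕ Fin 3) (MatCoordRing K (3 + m) ⧸ eigIdeal K m) :=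
  eval₂Hom (map (algebraMap K _)) fun p => C (Ideal.Quotient.mk _ (X p))

theorem polarize_rankOne (b : MatCoordRing K (3 + m))
    (x : MvPolynomial (Fin m ⊕ Fin 3) (MatCoordRing K (3 + m) ⧸ eigIdeal K m)) :
    polarize (gamBar K m) (reduceEntries K m (rankOne K m b) * x) =
      Ideal.Quotient.mk _ b * polarize (gamBar K m) x := by
  induction b using MvPolynomial.induction_on generalizing x with
  | C r =>
    have h : reduceEntries K m (rankOne K m (C r)) =
        C (Ideal.Quotient.mk (eigIdeal K m) (C r)) := by
      rw [rankOne, algHom_C, IsScalarTower.algebraMap_apply K (RowRing K m), algebraMap_eq,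
        algebraMap_eq, reduceEntries, coe_eval₂Hom, eval₂_C, map_C]
      rfl
    rw [h, ← smul_eq_C_mul, map_smul, smul_eq_mul]
  | add b b' h h' => rw [map_add, map_add, add_mul, map_add, h, h', map_add, add_mul]
  | mul_X b p h =>
    rw [map_mul (rankOne K m), map_mul (reduceEntries K m), mul_assoc, h, map_mul (Ideal.Quotient.mk _),
      mul_assoc]
    congr 1
    obtain ⟨i, j⟩ := p
    rw [rankOne, aeval_X]
    have hC : ∀ p : Fin (3 + m) × Fin (3 + m), polarize (gamBar K m) (reduceEntries K m (X p) * x) =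
        Ideal.Quotient.mk (eigIdeal K m) (X p) * polarize (gamBar K m) x := fun p => by
      rw [reduceEntries, coe_eval₂Hom, eval₂_X, ← smul_eq_C_mul, map_smul, smul_eq_mul]
    induction j using Fin.addCases with
    | left j =>
      induction i using Fin.addCases with
      | left i =>
        simp only [mkM, Fin.addCases_left]
        exact hC _
      | right k =>
        simp only [mkM, Fin.addCases_left, Fin.addCases_right]
        rw [reduceEntries, coe_eval₂Hom, eval₂_C, wRow, map_mul (MvPolynomial.map _), map_X, map_X,
          polarize_mul gamBar_comm]
        rfl
    | right j =>
      simp only [mkM, Fin.addCases_right]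
      exact hC _

theorem polarize_eigRel (q : Fin 3)
    (x : MvPolynomial (Fin m ⊕ Fin 3) (MatCoordRing K (3 + m) ⧸ eigIdeal K m)) :
    polarize (gamBar K m) (reduceEntries K m (eigRel K m q) * x) = 0 := by
  set aBar : Fin 3 → Fin 3 → MatCoordRing K (3 + m) ⧸ eigIdeal K m :=
    fun i j => Ideal.Quotient.mk _ (X (pos i j)) with haBar
  have h := polarize_quadratic (g := gamBar K m) gamBar_comm
    (T := fun i j => (Pi.single i 1 ⨯₃ aBar j) q) ?_ x
  · rw [← h]
    congr 2
    have hrow : ∀ j, reduceEntries K m (imgRow (wRow K m) pos j) =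
        X (Sum.inr 0) * C (aBar 0 j) + X (Sum.inr 1) * C (aBar 1 j) +
          X (Sum.inr 2) * C (aBar 2 j) := fun j => by
      simp [imgRow, reduceEntries, wRow, haBar]
    have hw : ∀ j, reduceEntries K m (C (wRow K m j)) = X (Sum.inr j) := fun j => by
      simp [reduceEntries, wRow]
    rw [eigRel, map_cross_apply]
    simp only [hrow, hw, Fin.sum_univ_three]
    fin_cases q <;> simp [cross_apply] <;> ring
  · intro k l
    have h1 := Ideal.Quotient.eq_zero_iff_mem.2 (gam_cross_vecMul_mem_eigIdeal (K := K) k l q)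
    rw [map_cross_apply] at h1
    have h2 : (fun j => Ideal.Quotient.mk (eigIdeal K m)
        ((gam (genM K (3 + m)) l ᵥ* alph (genM K (3 + m))) j)) =
        fun j => gamBar K m l 0 * aBar 0 j + gamBar K m l 1 * aBar 1 j +
          gamBar K m l 2 * aBar 2 j := by
      ext j
      simp only [vecMul, dotProduct, Fin.sum_univ_three, map_add, map_mul]
      rfl
    rw [h2] at h1
    change (gamBar K m k ⨯₃ _) q = 0 at h1
    rw [← h1]
    simp only [Fin.sum_univ_three]
    fin_cases q <;> simp [cross_apply] <;> ring

theorem exists_eigenvalue_mul [Infinite K] {b : MatCoordRing K (3 + m)}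
    (hb : ∀ M l, PtsTwo M l → evM M b = 0) :
    ∃ a : MatCoordRing K (3 + m), ∀ M l, PtsOne M l → l * evM M b = evM M a := by
  change b ∈ eigIdeal K m
  obtain ⟨q, hq⟩ := rankOne_mem hb
  have h := polarize_rankOne b 1
  rw [polarize_one, mul_one, mul_one, hq, vec3_dotProduct] at h
  simp only [mul_comm (q _), map_add, map_mul (reduceEntries K m), polarize_eigRel, add_zero] at h
  exact Ideal.Quotient.eq_zero_iff_mem.1 h.symm

end Eigenvalue
end KalmanAux

namespace KalmanAux
open MvPolynomial

section Sequence

variable {K : Type*} [Field K] {m : ℕ}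

theorem PtsTwo.gam_mul {M : Matrix (Fin (3 + m)) (Fin (3 + m)) K} {l : K} (h : PtsTwo M l) :
    gam M * alph M = l • gam M := by
  obtain ⟨w, u, -, ha, hc⟩ := h
  rw [hc, vecMulVec_mul, ha, vecMulVec_smul]

theorem evM_gam_mul (M : Matrix (Fin (3 + m)) (Fin (3 + m)) K) (i j) :
    evM M ((gam (genM K (3 + m)) * alph (genM K (3 + m))) i j) = (gam M * alph M) i j := by
  simp only [mul_apply, Fin.sum_univ_three, map_add, map_mul, evM_alph, evM_gam]

theorem evM_gam_mul_mul (M : Matrix (Fin (3 + m)) (Fin (3 + m)) K) (i j) :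
    evM M ((gam (genM K (3 + m)) * alph (genM K (3 + m)) * alph (genM K (3 + m))) i j) =
      (gam M * alph M * alph M) i j := by
  rw [mul_apply, mul_apply]
  simp only [Fin.sum_univ_three, map_add, map_mul (evM M), evM_alph, evM_gam_mul]

/-- The maximal minor of the stacked blocks obtained by replacing one row. -/
noncomputable def minorRow {R : Type*} [CommRing R] (M : Matrix (Fin (3 + m)) (Fin (3 + m)) R)
    (i : Fin m) (j : Fin 3) : R := ((alph M).updateRow j (gam M i)).det

theorem evM_minorRow (M : Matrix (Fin (3 + m)) (Fin (3 + m)) K) (i j) :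
    evM M (minorRow (genM K (3 + m)) i j) = minorRow M i j := by
  fin_cases j <;>
  simp [minorRow, det_fin_three, updateRow_apply, evM_alph, evM_gam, -coe_eval₂Hom]

theorem PtsOne.minorRow_eq {M : Matrix (Fin (3 + m)) (Fin (3 + m)) K} {l : K} (h : PtsOne M l)
    (i : Fin m) (j : Fin 3) : gam M i j * l ^ 2 +
      ((gam M * alph M) i j - (alph M).trace * gam M i j) * l + minorRow M i j = 0 := by
  obtain ⟨v, hv, ha, hc⟩ := h
  have h1 : ((alph M - l • (1 : Matrix (Fin 3) (Fin 3) K)).updateRow j (gam M i)).det = 0 := by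
    refine exists_mulVec_eq_zero_iff.1 ⟨v, hv, ?_⟩
    ext k
    by_cases hk : k = j
    · rw [mulVec, hk, updateRow_self]
      exact congrFun hc i
    · rw [mulVec, updateRow_ne hk]
      have h2 : (alph M - l • (1 : Matrix (Fin 3) (Fin 3) K)) *ᵥ v = 0 := by
        rw [sub_mulVec, smul_mulVec, one_mulVec, ha, sub_self]
      exact congrFun h2 k
  rw [← h1]
  fin_cases j <;>
  simp [minorRow, det_fin_three, updateRow_apply, mul_apply, Fin.sum_univ_three, trace,
    one_apply] <;> ring

theorem exists_relation_one [IsAlgClosed K] {b c : MatCoordRing K (3 + m)}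
    (h : ∀ M l, PtsTwo M l → evM M b + evM M c * ((alph M).trace - l) = 0) :
    ∃ a, ∀ M l, PtsOne M l → evM M a + evM M b * l + evM M c * l ^ 2 = 0 := by
  have hK : Infinite K := IsAlgClosed.instInfinite
  have h1 : ∀ M l, PtsTwo M l → evM M (b + c * (alph (genM K (3 + m))).trace) +
      evM M (-c) * l + evM M 0 * l ^ 2 = 0 := fun M l hM => by
    rw [map_add, map_mul, evM_trace, map_neg, map_zero]
    linear_combination h M l hM
  obtain ⟨e, he⟩ := exists_sum_gam_of_vanish (c := c) (vanish_three_of_discr fun M hM hd => by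
    have h2 := (eq_zero_of_discr_ne_zero h1 hM hd).2.1
    rwa [map_neg, neg_eq_zero] at h2)
  have hce : ∀ M, evM M c = ∑ i, ∑ j, evM M (e i j) * gam M i j := fun M => by
    conv_lhs => rw [he]
    simp only [map_sum, map_mul, evM_gam]
  obtain ⟨a', ha'⟩ := exists_eigenvalue_mul (b := b + c * (alph (genM K (3 + m))).trace -
      ∑ i, ∑ j, e i j * (gam (genM K (3 + m)) * alph (genM K (3 + m))) i j) fun M l hM => by
    simp only [map_sub, map_add, map_mul (evM M), map_sum, evM_trace, evM_gam_mul, hM.gam_mul]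
    have h3 : ∑ i, ∑ j, evM M (e i j) * (l • gam M) i j = l * evM M c := by
      rw [hce, Finset.mul_sum]
      refine Finset.sum_congr rfl fun i _ => ?_
      rw [Finset.mul_sum]
      refine Finset.sum_congr rfl fun j _ => ?_
      rw [Matrix.smul_apply, smul_eq_mul]
      ring
    rw [h3]
    linear_combination h M l hM
  refine ⟨-a' + ∑ i, ∑ j, e i j * minorRow (genM K (3 + m)) i j, fun M l hM => ?_⟩
  have h4 := ha' M l hM
  simp only [map_sub, map_add, map_mul (evM M), map_sum, evM_trace, evM_gam_mul] at h4
  simp only [map_add, map_neg, map_sum, map_mul (evM M), evM_minorRow]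
  have h5 : ∑ i, ∑ j, evM M (e i j) * minorRow M i j = -(evM M c * l ^ 2 +
      l * ∑ i, ∑ j, evM M (e i j) * (gam M * alph M) i j - (alph M).trace * l * evM M c) := by
    rw [hce, Finset.sum_mul, Finset.mul_sum, Finset.mul_sum, ← Finset.sum_add_distrib,
      ← Finset.sum_sub_distrib, ← Finset.sum_neg_distrib]
    refine Finset.sum_congr rfl fun i _ => ?_
    rw [Finset.sum_mul, Finset.mul_sum, Finset.mul_sum, ← Finset.sum_add_distrib,
      ← Finset.sum_sub_distrib, ← Finset.sum_neg_distrib]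
    refine Finset.sum_congr rfl fun j _ => ?_
    linear_combination evM M (e i j) * hM.minorRow_eq i j
  rw [h5]
  linear_combination h4

theorem exists_sq_mul [Infinite K] {c : MatCoordRing K (3 + m)}
    (h : ∀ M : Matrix (Fin (3 + m)) (Fin (3 + m)) K, gam M = 0 → evM M c = 0) :
    ∃ d : MatCoordRing K (3 + m), ∀ M l, PtsTwo M l → evM M c * l ^ 2 = evM M d := by
  obtain ⟨e, he⟩ := exists_sum_gam_of_vanish h
  refine ⟨∑ i, ∑ j, e i j *
    (gam (genM K (3 + m)) * alph (genM K (3 + m)) * alph (genM K (3 + m))) i j, fun M l hM => ?_⟩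
  rw [he]
  simp only [map_sum, map_mul (evM M), evM_gam_mul_mul, evM_gam, hM.gam_mul, smul_mul,
    Matrix.smul_apply, smul_eq_mul]
  rw [Finset.sum_mul]
  refine Finset.sum_congr rfl fun i _ => ?_
  rw [Finset.sum_mul]
  refine Finset.sum_congr rfl fun j _ => ?_
  ring

theorem exists_linearMap_of_ker_le {R M N P : Type*} [CommRing R] [AddCommGroup M] [CommRing N]
    [CommRing P] [Module R M] [Algebra R N] [Algebra R P] {q : M →ₗ[R] N}
    (hq : Function.Surjective q) {φ : M →ₗ[R] P} (h : ∀ x, q x = 0 → φ x = 0) :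
    ∃ f : N →ₗ[R] P, ∀ x, f (q x) = φ x := by
  refine ⟨(LinearMap.ker q).liftQ φ (fun x hx => h x (LinearMap.mem_ker.1 hx)) ∘ₗ
    (q.quotKerEquivOfSurjective hq).symm.toLinearMap, fun x => ?_⟩
  have h1 : (q.quotKerEquivOfSurjective hq).symm (q x) = Submodule.Quotient.mk x := by
    rw [LinearEquiv.symm_apply_eq]; rfl
  rw [LinearMap.comp_apply, LinearEquiv.coe_coe, h1]
  exact Submodule.liftQ_apply _ _ _

theorem injective_of_ker {R N P : Type*} [CommRing R] [CommRing N] [CommRing P] [Algebra R N]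
    [Algebra R P] {f : N →ₗ[R] P} (h : ∀ x, f x = 0 → x = 0) : Function.Injective f :=
  (injective_iff_map_eq_zero f).2 h

/-- The map on coefficient triples underlying the map between the normalizations. -/
def shiftMap {R : Type*} [CommRing R] (T : R) : R × R × R →ₗ[R] R × R × R :=
  (LinearMap.fst R R R ∘ₗ LinearMap.snd R R (R × R) +
    T • (LinearMap.snd R R R ∘ₗ LinearMap.snd R R (R × R))).prod
  ((-(LinearMap.snd R R R ∘ₗ LinearMap.snd R R (R × R))).prod 0)

theorem shiftMap_apply {R : Type*} [CommRing R] (T a b c : R) :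
    shiftMap T (a, b, c) = (b + T * c, -c, 0) := rfl

theorem mem_kalmanIdeal_iff {n s : ℕ} {a : MatCoordRing K n} :
    a ∈ kalmanIdeal K n 3 s ↔ ∀ M ∈ kalmanSet K n 3 s, evM M a = 0 := Iff.rfl

theorem exact_sequence [IsAlgClosed K] (hm : 0 < m) :
    ∃ (f : KalmanNormalization K (3 + m) 3 1 →ₗ[MatCoordRing K (3 + m)]
        KalmanNormalization K (3 + m) 3 2)
      (g : KalmanNormalization K (3 + m) 3 2 →ₗ[MatCoordRing K (3 + m)]
        KalmanCoordRing K (3 + m) 3 3),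
      Function.Injective (kalmanNormInclusion K (3 + m) 3 1) ∧
      LinearMap.ker f = LinearMap.range (kalmanNormInclusion K (3 + m) 3 1) ∧
      LinearMap.ker g = LinearMap.range f ∧
      Function.Surjective g := by
  have hK : Infinite K := IsAlgClosed.instInfinite
  obtain ⟨q₁, hq₁, hk₁, hi₁⟩ := interface_one (K := K) hm
  obtain ⟨q₂, hq₂, hk₂, hdom⟩ := interface_two (K := K) hm
  set T : MatCoordRing K (3 + m) := (alph (genM K (3 + m))).trace with hT
  have hqF : ∀ a b c, q₂ (shiftMap T (a, b, c)) = 0 ↔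
      ∀ M l, PtsTwo M l → evM M b + evM M c * ((alph M).trace - l) = 0 := by
    intro a b c
    rw [shiftMap_apply, hk₂]
    refine forall_congr' fun M => forall_congr' fun l => forall_congr' fun _ => ?_
    rw [map_add, map_mul, evM_trace, map_neg, map_zero]
    refine Eq.congr_left ?_
    ring
  obtain ⟨f, hf⟩ := exists_linearMap_of_ker_le hq₁ (φ := q₂ ∘ₗ shiftMap T) (by
    rintro ⟨a, b, c⟩ h
    exact (hqF a b c).2 (relation_two_of_one hdom ((hk₁ a b c).1 h)))
  have hmem : ∀ c, Ideal.Quotient.mk (kalmanIdeal K (3 + m) 3 3) c = 0 ↔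
      ∀ M : Matrix (Fin (3 + m)) (Fin (3 + m)) K, gam M = 0 → evM M c = 0 := by
    intro c
    rw [Ideal.Quotient.eq_zero_iff_mem, mem_kalmanIdeal_iff]
    simp only [mem_kalmanSet_three_iff]
  obtain ⟨g, hg⟩ := exists_linearMap_of_ker_le hq₂
    (φ := (Submodule.mkQ (kalmanIdeal K (3 + m) 3 3)) ∘ₗ
    LinearMap.snd _ _ _ ∘ₗ LinearMap.snd _ _ _) (by
      rintro ⟨a, b, c⟩ h
      exact (hmem c).2 (vanish_three_of_relation_two ((hk₂ a b c).1 h)))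
  have hg' : ∀ a b c, g (q₂ (a, b, c)) = Ideal.Quotient.mk (kalmanIdeal K (3 + m) 3 3) c :=
    fun a b c => hg (a, b, c)
  have hf' : ∀ a b c, f (q₁ (a, b, c)) = q₂ (b + T * c, -c, 0) := fun a b c => hf (a, b, c)
  refine ⟨f, g, ?_, ?_, ?_, ?_⟩
  · refine injective_of_ker fun x hx => ?_
    obtain ⟨a, rfl⟩ := Ideal.Quotient.mk_surjective x
    rw [← hi₁, hk₁] at hx
    rw [Ideal.Quotient.eq_zero_iff_mem, mem_kalmanIdeal_iff]
    intro M hM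
    obtain ⟨v, l, hv, h1, h2⟩ := (mem_kalmanSet_one_iff M).1 hM
    simpa using hx M l ⟨v, hv, h1, h2⟩
  · ext x
    rw [LinearMap.mem_ker, LinearMap.mem_range]
    constructor
    · intro hx
      obtain ⟨⟨a, b, c⟩, rfl⟩ := hq₁ x
      rw [hf] at hx
      obtain ⟨a', ha'⟩ := exists_relation_one ((hqF a b c).1 hx)
      refine ⟨Ideal.Quotient.mk _ (a - a'), ?_⟩
      rw [← hi₁, ← sub_eq_zero, ← map_sub, Prod.mk_sub_mk, Prod.mk_sub_mk, hk₁]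
      intro M l hM
      have := ha' M l hM
      simp only [map_sub, map_zero]
      linear_combination -this
    · rintro ⟨y, rfl⟩
      obtain ⟨a, rfl⟩ := Ideal.Quotient.mk_surjective y
      rw [← hi₁, hf', mul_zero, add_zero, neg_zero]
      exact map_zero q₂
  · ext x
    rw [LinearMap.mem_ker, LinearMap.mem_range]
    constructor
    · intro hx
      obtain ⟨⟨a, b, c⟩, rfl⟩ := hq₂ x
      rw [hg', hmem] at hx
      obtain ⟨d, hd⟩ := exists_sq_mul hx
      refine ⟨q₁ (0, a + d + T * b, -b), ?_⟩
      rw [hf', ← sub_eq_zero, ← map_sub]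
      refine (hk₂ _ _ _).2 fun M l hM => ?_
      have := hd M l hM
      simp only [map_sub, map_neg, map_zero, map_add, map_mul (evM M)]
      linear_combination -this
    · rintro ⟨y, rfl⟩
      obtain ⟨⟨a, b, c⟩, rfl⟩ := hq₁ y
      rw [hf', hg', map_zero]
  · intro x
    obtain ⟨c, rfl⟩ := Ideal.Quotient.mk_surjective x
    exact ⟨q₂ (0, 0, c), hg' 0 0 c⟩

end Sequence
end KalmanAux

theorem stmt6 (K : Type*) [Field K] [IsAlgClosed K] (n : ℕ) (hn : 4 ≤ n) :
    ∃ (f : KalmanNormalization K n 3 1 →ₗ[MatCoordRing K n] KalmanNormalization K n 3 2)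
      (g : KalmanNormalization K n 3 2 →ₗ[MatCoordRing K n] KalmanCoordRing K n 3 3),
      Function.Injective (kalmanNormInclusion K n 3 1) ∧
      LinearMap.ker f = LinearMap.range (kalmanNormInclusion K n 3 1) ∧
      LinearMap.ker g = LinearMap.range f ∧
      Function.Surjective g := by
  obtain ⟨m, rfl⟩ : ∃ m, n = 3 + m := ⟨n - 3, by omega⟩
  exact KalmanAux.exact_sequence (by omega)
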